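/- arXiv:1809.09226 — 3 statements merged into one kernel-verified Lean document; each statement's English description precedes it below -/
import Mathlib

section
/- Let U be an irreducible six-dimensional complex representation of the quasi-simple group 3.A7, and let Q ⊆ S²U∨ be a six-dimensional subrepresentation of the induced representation on quadratic forms on U. Then the base locus of Q on ℙ(U) is empty: for every nonzero vector u ∈ U there exists a quadratic form q ∈ Q with q(u) ≠ 0. -/
/-- `G` is isomorphic to `3.A₇`: a quasi-simple (in particular perfect) group whose center is
cyclic of order `3` and whose quotient by the center is the alternating group `A₇`.  Such a
group is unique up to isomorphism. -/
def IsTripleCoverA7 (G : Type*) [Group G] : Prop :=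
  commutator G = ⊤ ∧ IsCyclic (Subgroup.center G) ∧ Nat.card (Subgroup.center G) = 3 ∧
    Nonempty (G ⧸ Subgroup.center G ≃* alternatingGroup (Fin 7))

namespace TripleA7

/-- Group-theoretic data extracted from a triple cover of `A₇`. -/
structure GD (G : Type) [Group G] where
  (u v t s A B c z : G)
  uu : u * u = 1
  vv : v * v = 1
  tt : t * t = 1
  ss : s * s = 1
  vu : v * u = u * v
  AAA : A * (A * A) = 1
  BBB : B * (B * B) = 1
  Au : A * u = u * v * A
  Av : A * v = u * A
  Bu : B * u = u * B
  Bv : B * v = v * B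
  tu : t * u = u * t
  tv : t * v = u * v * t
  tA : t * A = A * A * t
  tB : t * B = B * B * t
  st : s * t = t * s
  su : s * u = u * t * s
  hz : z ∈ Subgroup.center G
  BA : B * A = z * (A * B)
  z3 : z * z * z = 1
  cc : c * c * c * c * c = 1
  kc : t * v * c = c * c * (t * v)
  cv : ∃ g, g * u * g⁻¹ = v
  cuv : ∃ g, g * u * g⁻¹ = u * v
  ct : ∃ g, g * u * g⁻¹ = t
  ctu : ∃ g, g * u * g⁻¹ = t * u
  cs : ∃ g, g * u * g⁻¹ = s
  cB : ∃ g, ∃ y ∈ Subgroup.center G, g * A * g⁻¹ = y * B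
  csv : ∃ g, ∃ y ∈ Subgroup.center G, g * (A * B) * g⁻¹ = y * (s * v)
  csAB : ∃ g, ∃ y ∈ Subgroup.center G, g * (A * B) * g⁻¹ = y * (s * (A * B))
  csABBt : ∃ g, ∃ y ∈ Subgroup.center G, g * (A * B) * g⁻¹ = y * (s * (A * (B * (B * t))))
  csAu : ∃ g, ∃ y ∈ Subgroup.center G, g * (t * v) * g⁻¹ = y * (s * (A * u))
  nu : ∀ K : Subgroup G, K.Normal → u ∈ K → K = ⊤
  nc : ∀ K : Subgroup G, K.Normal → c ∈ K → K = ⊤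
  nB : ∀ K : Subgroup G, K.Normal → B ∈ K → K = ⊤

open scoped commutatorElement in
open Equiv in
theorem exists_GD (G : Type) [Group G] (hG : IsTripleCoverA7 G) : Nonempty (GD G) := by
  obtain ⟨hcomm, -, hcard, ⟨e⟩⟩ := hG
  set p0 : G →* alternatingGroup (Fin 7) :=
    e.toMonoidHom.comp (QuotientGroup.mk' (Subgroup.center G)) with hp0
  have hsurj0 : Function.Surjective p0 :=
    e.surjective.comp (QuotientGroup.mk'_surjective _)
  have hker0 : ∀ g, p0 g = 1 → g ∈ Subgroup.center G := by
    intro g hg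
    have : e (QuotientGroup.mk' (Subgroup.center G) g) = 1 := hg
    rw [map_eq_one_iff e e.injective] at this
    exact (QuotientGroup.eq_one_iff g).1 this
  have hz3 : ∀ z ∈ Subgroup.center G, z * z * z = 1 := by
    intro z hz
    have h := pow_card_eq_one' (x := (⟨z, hz⟩ : Subgroup.center G))
    rw [hcard] at h
    have := congrArg Subtype.val h
    simpa [pow_succ] using this
  set p : G →* Perm (Fin 7) := (alternatingGroup (Fin 7)).subtype.comp p0 with hp
  have hsurj : ∀ σ : Perm (Fin 7), Perm.sign σ = 1 → ∃ g, p g = σ := by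
    intro σ hσ
    obtain ⟨g, hg⟩ := hsurj0 ⟨σ, hσ⟩
    exact ⟨g, by simp [hp, hg]⟩
  have hker : ∀ g, p g = 1 → g ∈ Subgroup.center G := by
    intro g hg
    apply hker0
    apply Subtype.ext
    simpa [hp] using hg
  have hcen : ∀ x y, p x = p y → ∃ z ∈ Subgroup.center G, x = z * y := by
    intro x y h
    refine ⟨x * y⁻¹, hker _ (by simp [h]), by group⟩
  have hinv : ∀ σ : Perm (Fin 7), Perm.sign σ = 1 → σ * σ = 1 → ∃ g, p g = σ ∧ g * g = 1 := by
    intro σ h1 h2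
    obtain ⟨h, rfl⟩ := hsurj σ h1
    have hc := hz3 _ (hker (h * h) (by simpa using h2))
    refine ⟨h * h * h, ?_, ?_⟩
    · simp [h2]
    · rw [← hc]; group
  have huniq : ∀ x y : G, x * x = 1 → y * y = 1 → p x = p y → x = y := by
    intro x y hx hy h
    obtain ⟨z, hz, rfl⟩ := hcen x y h
    have hzy := Subgroup.mem_center_iff.1 hz y
    have h3 := hz3 z hz
    have : z * z = 1 := by
      have : z * z * (y * y) = 1 := by
        rw [← hx]; simp only [mul_assoc]; rw [← mul_assoc y z y, hzy]; simp only [mul_assoc]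
      simpa [hy] using this
    have hz1 : z = 1 := by simpa [this] using h3
    simp [hz1]
  have hconj : ∀ (σ : Perm (Fin 7)), Perm.sign σ = 1 → ∀ x y : G, x * x = 1 → y * y = 1 →
      σ * p x = p y * σ → ∃ g, g * x * g⁻¹ = y := by
    intro σ hs x y hx hy h
    obtain ⟨g, rfl⟩ := hsurj σ hs
    refine ⟨g, huniq _ _ ?_ hy ?_⟩
    · calc g * x * g⁻¹ * (g * x * g⁻¹) = g * (x * x) * g⁻¹ := by group
        _ = 1 := by simp [hx]
    · simp [h]
  have hconjc : ∀ (σ : Perm (Fin 7)), Perm.sign σ = 1 → ∀ x y : G,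
      σ * p x = p y * σ → ∃ g, ∃ z ∈ Subgroup.center G, g * x * g⁻¹ = z * y := by
    intro σ hs x y h
    obtain ⟨g, rfl⟩ := hsurj σ hs
    exact ⟨g, hcen _ _ (by simp [h])⟩
  have hnorm : ∀ x : G, p x ≠ 1 → ∀ K : Subgroup G, K.Normal → x ∈ K → K = ⊤ := by
    intro x hx K hK hxK
    have hsim : IsSimpleGroup (alternatingGroup (Fin 7)) :=
      alternatingGroup.isSimpleGroup (by simp)
    have hmap : (K.map p0).Normal := hK.map p0 hsurj0
    have htop : K.map p0 = ⊤ := by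
      rcases hmap.eq_bot_or_eq_top with h | h
      · exfalso
        have : p0 x ∈ K.map p0 := ⟨x, hxK, rfl⟩
        rw [h, Subgroup.mem_bot] at this
        exact hx (by simp [hp, this])
      · exact h
    rw [eq_top_iff, ← hcomm, commutator_def, Subgroup.commutator_le]
    intro g1 _ g2 _
    have : p0 g1 ∈ K.map p0 := by rw [htop]; trivial
    obtain ⟨k, hk, hkg⟩ := this
    have hz := hker0 (k⁻¹ * g1) (by simp [hkg])
    set z := k⁻¹ * g1 with hzd
    have hg1 : g1 = k * z := by rw [hzd]; group
    have hc := Subgroup.mem_center_iff.1 hz g2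
    have : ⁅g1, g2⁆ = k * (g2 * k⁻¹ * g2⁻¹) := by
      rw [commutatorElement_def, hg1]
      calc k * z * g2 * (k * z)⁻¹ * g2⁻¹ = k * (z * g2) * z⁻¹ * k⁻¹ * g2⁻¹ := by group
        _ = k * (g2 * z) * z⁻¹ * k⁻¹ * g2⁻¹ := by rw [hc]
        _ = _ := by group
    rw [this]
    exact K.mul_mem hk (hK.conj_mem _ (K.inv_mem hk) _)
  -- involutions
  obtain ⟨u, pu, uu⟩ := hinv (swap 2 3 * swap 4 5) (by decide) (by decide)
  obtain ⟨v, pv, vv⟩ := hinv (swap 2 4 * swap 3 5) (by decide) (by decide)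
  obtain ⟨t, pt, tt⟩ := hinv (swap 2 3 * swap 6 0) (by decide) (by decide)
  obtain ⟨s, ps, ss⟩ := hinv (swap 2 6 * swap 3 0) (by decide) (by decide)
  obtain ⟨a, pa, aa⟩ := hinv (swap 3 4 * swap 6 0) (by decide) (by decide)
  obtain ⟨b, pb, bb⟩ := hinv (swap 1 0 * swap 2 3) (by decide) (by decide)
  -- a fifth involution inverting a 5-cycle, with product `c`
  have hcj : ∀ x y : G, y * y = 1 → (x * y * x⁻¹) * (x * y * x⁻¹) = 1 := by
    intro x y hy
    calc x * y * x⁻¹ * (x * y * x⁻¹) = x * (y * y) * x⁻¹ := by group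
      _ = 1 := by simp [hy]
  have hrel : ∀ x y w : G, y * y = 1 → w * w = 1 → p x * p y = p w * p x → x * y = w * x := by
    intro x y w hy hw h
    have := huniq (x * y * x⁻¹) w (hcj x y hy) hw (by simp [h])
    rw [← this]; group
  have vu : v * u = u * v := hrel v u u uu uu (by rw [pu, pv]; decide)
  have tu : t * u = u * t := hrel t u u uu uu (by rw [pu, pt]; decide)
  have hprod : ∀ x y : G, x * x = 1 → y * y = 1 → x * y = y * x → (x * y) * (x * y) = 1 := by
    intro x y hx hy h
    calc x * y * (x * y) = x * y * (y * x) := by rw [h]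
      _ = x * (y * y) * x := by group
      _ = 1 := by simp [hx, hy]
  have uvuv := hprod u v uu vv vu.symm
  have utut := hprod u t uu tt tu.symm
  have tutu := hprod t u tt uu tu
  have tv : t * v = u * v * t := hrel t v (u * v) vv uvuv (by simp only [map_mul, pu, pv, pt]; decide)
  have st : s * t = t * s := hrel s t t tt tt (by rw [ps, pt]; decide)
  have su : s * u = u * t * s := hrel s u (u * t) uu utut (by simp only [map_mul, pu, ps, pt]; decide)
  -- order three elements
  have hthree : ∀ x y : G, x * x = 1 → y * y = 1 → p (x * y) * p (x * y) * p (x * y) = 1 →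
      (x * y) * ((x * y) * (x * y)) = 1 := by
    intro x y hx hy h
    have hc := hker ((x * y) * ((x * y) * (x * y))) (by
      rw [map_mul p (x * y), map_mul p (x * y), ← mul_assoc]; exact h)
    have h3 := hz3 _ hc
    have hcx := Subgroup.mem_center_iff.1 hc x
    set w := (x * y) * ((x * y) * (x * y)) with hw
    have hxi : x⁻¹ = x := inv_eq_of_mul_eq_one_left hx
    have hyi : y⁻¹ = y := inv_eq_of_mul_eq_one_left hy
    have : w * w = 1 := by
      have h1 : x * w * x = w⁻¹ := by
        rw [hw]; simp only [mul_inv_rev, hxi, hyi]; simp only [mul_assoc]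
        rw [← mul_assoc x x, hx, one_mul]
      rw [hcx, mul_assoc, hx, mul_one] at h1
      nth_rewrite 1 [h1]; simp
    simpa [this] using h3
  have hti : ∀ x y : G, x * x = 1 → y * y = 1 → (x * y) * ((x * y) * (x * y)) = 1 →
      x * (x * y) = (x * y) * (x * y) * x := by
    intro x y hx hy h
    have h1 : (x * y) * (x * y) = (x * y)⁻¹ := (inv_eq_of_mul_eq_one_right h).symm
    have hxi : x⁻¹ = x := inv_eq_of_mul_eq_one_left hx
    have hyi : y⁻¹ = y := inv_eq_of_mul_eq_one_left hy
    rw [h1, mul_inv_rev, hxi, hyi, mul_assoc, hx, ← mul_assoc, hx]; simp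
  have AAA := hthree t a tt aa (by simp only [map_mul, pt, pa]; decide)
  have BBB := hthree t b tt bb (by simp only [map_mul, pt, pb]; decide)
  have tA := hti t a tt aa AAA
  have tB := hti t b tt bb BBB
  have Au : (t * a) * u = u * v * (t * a) :=
    hrel _ u (u * v) uu uvuv (by simp only [map_mul, pu, pv, pt, pa]; decide)
  have Av : (t * a) * v = u * (t * a) :=
    hrel _ v u vv uu (by simp only [map_mul, pu, pv, pt, pa]; decide)
  have Bu : (t * b) * u = u * (t * b) :=
    hrel _ u u uu uu (by simp only [map_mul, pu, pt, pb]; decide)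
  have Bv : (t * b) * v = v * (t * b) :=
    hrel _ v v vv vv (by simp only [map_mul, pv, pt, pb]; decide)
  obtain ⟨z, hz, hBA⟩ := hcen ((t * b) * (t * a)) ((t * a) * (t * b))
    (by simp only [map_mul, pt, pa, pb]; decide)
  -- order five
  obtain ⟨c0, pc0⟩ := hsurj (swap 1 2 * swap 2 4 * swap 4 5 * swap 5 3) (by decide)
  have hc5 := hker (c0 * c0 * c0 * c0 * c0) (by simp only [map_mul, pc0]; decide)
  have hc53 := hz3 _ hc5
  set c := c0 * c0 * c0 * c0 * c0 * c0 with hcdef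
  have pc : p c = swap 1 2 * swap 2 4 * swap 4 5 * swap 5 3 := by
    simp only [hcdef, map_mul, pc0]; decide
  have hpow : c = c0 ^ 6 := by rw [hcdef]; simp only [pow_succ, pow_zero, one_mul, mul_assoc]
  have h15 : c0 ^ 15 = 1 := by rw [← hc53]; simp only [pow_succ, pow_zero, one_mul, mul_assoc]
  have cc : c * c * c * c * c = 1 := by
    rw [hpow]
    calc c0 ^ 6 * c0 ^ 6 * c0 ^ 6 * c0 ^ 6 * c0 ^ 6 = (c0 ^ 15) ^ 2 := by group
      _ = 1 := by simp [h15]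
  have kc : t * v * c = c * c * (t * v) := by
    obtain ⟨y, hy, h⟩ := hcen (t * v * c * (t * v)⁻¹) (c * c) (by
      rw [map_mul, map_mul, map_inv, mul_inv_eq_iff_eq_mul]
      simp only [map_mul, pt, pv, pc]; decide)
    have hyc : Commute y (c * c) := ((Subgroup.mem_center_iff.1 hy (c * c))).symm
    have h5 : (t * v * c * (t * v)⁻¹) ^ 5 = 1 := by
      rw [conj_pow]
      have : c ^ 5 = 1 := by rw [← cc]; simp only [pow_succ, pow_zero, one_mul, mul_assoc]
      simp [this]
    rw [h, hyc.mul_pow] at h5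
    have hc10 : (c * c) ^ 5 = 1 := by
      calc (c * c) ^ 5 = (c * c * c * c * c) ^ 2 := by
            simp only [pow_succ, pow_zero, one_mul, mul_assoc]
        _ = 1 := by simp [cc]
    rw [hc10, mul_one] at h5
    have hy3 : y ^ 3 = 1 := by rw [← hz3 y hy]; simp only [pow_succ, pow_zero, one_mul, mul_assoc]
    have hy1 : y = 1 := by
      calc y = (y ^ 3) ^ 2 * (y ^ 5)⁻¹ := by group
        _ = 1 := by simp [hy3, h5]
    rw [hy1, one_mul] at h
    rw [← h]; group
  refine ⟨⟨u, v, t, s, t * a, t * b, c, z, uu, vv, tt, ss, vu, AAA, BBB, Au, Av, Bu, Bv, tu, tv,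
    tA, tB, st, su, hz, hBA, hz3 z hz, cc, kc, ?_, ?_, ?_, ?_, ?_, ?_, ?_, ?_, ?_, ?_,
    hnorm u ?_, hnorm c ?_, hnorm (t * b) ?_⟩⟩
  · exact hconj (swap 3 4 * swap 6 0) (by decide) u v uu vv (by rw [pu, pv]; decide)
  · exact hconj (swap 3 5 * swap 5 4) (by decide) u (u * v) uu uvuv
      (by simp only [map_mul, pu, pv]; decide)
  · exact hconj (swap 4 6 * swap 5 0) (by decide) u t uu tt (by rw [pu, pt]; decide)
  · exact hconj (swap 2 4 * swap 4 6 * swap 3 5 * swap 5 0) (by decide) u (t * u) uu tutu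
      (by simp only [map_mul, pu, pt]; decide)
  · exact hconj (swap 3 6 * swap 6 5 * swap 5 0 * swap 0 4) (by decide) u s uu ss
      (by rw [pu, ps]; decide)
  · exact hconjc (swap 1 2 * swap 3 6 * swap 6 5 * swap 4 0) (by decide) _ _
      (by simp only [map_mul, pt, pa, pb]; decide)
  · exact hconjc (swap 1 3 * swap 3 4 * swap 4 6 * swap 6 5) (by decide) _ _
      (by simp only [map_mul, pt, pa, pb, ps, pv]; decide)
  · exact hconjc (swap 1 3 * swap 3 2 * swap 4 0 * swap 0 6) (by decide) _ _
      (by simp only [map_mul, pt, pa, pb, ps, pv]; decide)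
  · exact hconjc (swap 3 4 * swap 4 6) (by decide) _ _
      (by simp only [map_mul, pt, pa, pb, ps, pv]; decide)
  · exact hconjc (swap 3 5 * swap 5 6) (by decide) _ _
      (by simp only [map_mul, pt, pa, pb, ps, pv, pu]; decide)
  · rw [pu]; decide
  · rw [pc]; decide
  · rw [map_mul, pt, pb]; decide


section opers

variable {W : Type} [AddCommGroup W] [Module ℂ W] [FiniteDimensional ℂ W]

local notation "tr" => LinearMap.trace ℂ W

theorem idem_nat (P : Module.End ℂ W) (h : P * P = P) :
    tr P = (Module.finrank ℂ (LinearMap.range P) : ℂ) := by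
  have h1 : IsIdempotentElem P := h
  exact (LinearMap.IsIdempotentElem.isProj_range P h1).trace

theorem idem_zero (P : Module.End ℂ W) (h : P * P = P) (h0 : tr P = 0) : P = 0 := by
  rw [idem_nat P h] at h0
  have : Module.finrank ℂ (LinearMap.range P) = 0 := by exact_mod_cast h0
  rw [Submodule.finrank_eq_zero] at this
  exact LinearMap.range_eq_bot.1 this

theorem idem_one (P : Module.End ℂ W) (h : P * P = P) (h0 : tr P = 1) :
    ∃ f : W, f ≠ 0 ∧ P f = f ∧ ∀ x, P x = x → ∃ a : ℂ, x = a • f := by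
  rw [idem_nat P h] at h0
  have : Module.finrank ℂ (LinearMap.range P) = 1 := by exact_mod_cast h0
  obtain ⟨⟨f, y, hy⟩, hf0, hf⟩ := finrank_eq_one_iff'.1 this
  refine ⟨f, ?_, ?_, ?_⟩
  · intro h; apply hf0; ext; exact h
  · rw [← hy]; exact LinearMap.congr_fun h y
  · intro x hx
    obtain ⟨a, ha⟩ := hf ⟨x, x, hx⟩
    exact ⟨a, by simpa using (congrArg Subtype.val ha).symm⟩

theorem idem_mul {P R : Module.End ℂ W} (hP : P * P = P) (hR : R * R = R) (h : P * R = R * P) :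
    (P * R) * (P * R) = P * R := by
  calc (P * R) * (P * R) = P * (R * P) * R := by simp only [mul_assoc]
    _ = (P * P) * (R * R) := by rw [← h]; simp only [mul_assoc]
    _ = _ := by rw [hP, hR]

theorem idem_half {u : Module.End ℂ W} (h : u * u = 1) :
    ((1 / 2 : ℂ) • (1 + u)) * ((1 / 2 : ℂ) • (1 + u)) = (1 / 2 : ℂ) • (1 + u) := by
  simp only [smul_mul_smul_comm, mul_add, add_mul, h, one_mul, mul_one]
  module

theorem idem_half' {u : Module.End ℂ W} (h : u * u = 1) :
    ((1 / 2 : ℂ) • (1 - u)) * ((1 / 2 : ℂ) • (1 - u)) = (1 / 2 : ℂ) • (1 - u) := by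
  simp only [smul_mul_smul_comm, mul_sub, sub_mul, h, one_mul, mul_one]
  module

theorem idem_compl {P : Module.End ℂ W} (h : P * P = P) : (1 - P) * (1 - P) = 1 - P := by
  simp only [mul_sub, sub_mul, h, one_mul, mul_one]
  abel

theorem tr_twist (c x : Module.End ℂ W) (m b j : ℕ) (hc : c ^ 5 = 1) (h : x * c = c ^ m * x)
    (hj : (m * b + 4 * b) % 5 = j) : tr (c ^ j * x) = tr x := by
  have hx : ∀ n, x * c ^ n = c ^ (m * n) * x := by
    intro n
    induction n with
    | zero => simp
    | succ n ih =>
      rw [pow_succ, ← mul_assoc, ih, mul_assoc, h, ← mul_assoc, ← pow_add]; congr 2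
  have hmod : ∀ n, c ^ n = c ^ (n % 5) := by
    intro n
    conv_lhs => rw [← Nat.div_add_mod n 5, pow_add, pow_mul, hc, one_pow, one_mul]
  rw [← hj, ← hmod, add_comm, pow_add, mul_assoc, ← hx, LinearMap.trace_mul_comm, mul_assoc,
    ← pow_add, hmod, show (b + 4 * b) % 5 = 0 by omega]
  simp

theorem stepV (h6 : Module.finrank ℂ W = 6) (u v k c : Module.End ℂ W)
    (uu : u * u = 1) (vv : v * v = 1) (vu : v * u = u * v) (kk : k * k = u)
    (vk : v * k = k * u * v)
    (hv : tr v = tr u) (huv : tr (u * v) = tr u) (hkv : tr (k * v) = tr u)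
    (hkuv : tr (k * (u * v)) = tr u) (hc : c ^ 5 = 1) (kc : k * c = c ^ 2 * k)
    (u1 : u ≠ 1) (c1 : c ≠ 1) : tr u = 2 := by
  have h1 : tr (1 : Module.End ℂ W) = 6 := by rw [LinearMap.trace_one, h6]; norm_num
  have ku : k * u = u * k := by rw [← kk, mul_assoc]
  have hP0 := idem_mul (idem_half uu) (idem_half vv) (by
    simp only [smul_mul_smul_comm, mul_add, add_mul, one_mul, mul_one, vu]; module)
  have hPx := idem_mul (idem_half uu) (idem_half' vv) (by
    simp only [smul_mul_smul_comm, mul_add, add_mul, mul_sub, sub_mul, one_mul, mul_one, vu]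
    module)
  have t0 : tr (((1 / 2 : ℂ) • (1 + u)) * ((1 / 2 : ℂ) • (1 + v))) = (6 + 3 * tr u) / 4 := by
    simp only [smul_mul_smul_comm, mul_add, add_mul, one_mul, mul_one, map_add, map_smul, h1, hv,
      huv, smul_eq_mul]
    ring
  have tx : tr (((1 / 2 : ℂ) • (1 + u)) * ((1 / 2 : ℂ) • (1 - v))) = (6 - tr u) / 4 := by
    simp only [smul_mul_smul_comm, mul_add, add_mul, mul_sub, sub_mul, one_mul, mul_one, map_add,
      map_sub, map_smul, h1, hv, huv, smul_eq_mul]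
    ring
  have n0 := idem_nat _ hP0
  have nx := idem_nat _ hPx
  set a := Module.finrank ℂ (LinearMap.range (((1 / 2 : ℂ) • (1 + u)) * ((1 / 2 : ℂ) • (1 + v))))
  set n := Module.finrank ℂ (LinearMap.range (((1 / 2 : ℂ) • (1 + u)) * ((1 / 2 : ℂ) • (1 - v))))
  rw [t0] at n0
  rw [tx] at nx
  have hsum : (a : ℂ) + 3 * n = 6 := by rw [← n0, ← nx]; ring
  have hsum' : a + 3 * n = 6 := by exact_mod_cast hsum
  have htau : tr u = 6 - 4 * n := by rw [← nx]; ring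
  have hn : n = 0 ∨ n = 1 ∨ n = 2 := by omega
  rcases hn with hn | hn | hn
  · exfalso
    rw [hn] at htau
    have := idem_zero _ (idem_half' uu) (by
      rw [map_smul, map_sub, h1, htau]; simp)
    apply u1
    have h2 : (1 : Module.End ℂ W) - u = 0 := by
      simpa using this
    exact (sub_eq_zero.1 h2).symm
  · rw [htau, hn]; norm_num
  · exfalso
    rw [hn] at htau
    have ha : a = 0 := by omega
    have hz := idem_zero _ hP0 (by rw [t0, n0, ha]; simp)
    have hk : tr k = 2 := by
      have hku : tr (k * u) = tr k := by
        have : k * u = v * (k * v) := by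
          rw [← mul_assoc, vk, mul_assoc, vv, mul_one]
        rw [this, LinearMap.trace_mul_comm, mul_assoc, vv, mul_one]
      have h2 : tr (k * (((1 / 2 : ℂ) • (1 + u)) * ((1 / 2 : ℂ) • (1 + v)))) = 0 := by
        rw [hz]; simp
      simp only [smul_mul_assoc, mul_add, add_mul, one_mul, mul_one, map_add, map_smul,
        mul_smul_comm, smul_add, hku, hkv, hkuv, htau, smul_eq_mul] at h2
      push_cast at h2
      linear_combination 2 * h2
    have hku : tr (k * u) = 2 := by
      have : k * u = v * (k * v) := by
        rw [← mul_assoc, vk, mul_assoc, vv, mul_one]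
      rw [this, LinearMap.trace_mul_comm, mul_assoc, vv, mul_one, hk]
    have uc : u * c = c ^ 4 * u := by
      rw [← kk, mul_assoc, kc, ← mul_assoc, pow_two, ← mul_assoc, kc, mul_assoc (c ^ 2), kc]
      simp only [← mul_assoc, ← pow_add]
    have kuc : (k * u) * c = c ^ 3 * (k * u) := by
      have e8 : c ^ 8 = c ^ 3 := by rw [show 8 = 5 + 3 from rfl, pow_add, hc, one_mul]
      have k2 : k * c ^ 2 = c ^ 4 * k := by
        rw [pow_two, ← mul_assoc, kc, mul_assoc, kc, ← mul_assoc, ← pow_add]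
      have k4 : k * c ^ 4 = c ^ 8 * k := by
        rw [show 4 = 2 + 2 from rfl, pow_add, ← mul_assoc, k2, mul_assoc, k2, ← mul_assoc,
          ← pow_add]
      rw [mul_assoc, uc, ← mul_assoc, k4, e8, mul_assoc]
    set P : Module.End ℂ W := (1 / 5 : ℂ) • (1 + c + c ^ 2 + c ^ 3 + c ^ 4) with hPd
    set K : Module.End ℂ W := (1 / 4 : ℂ) • (1 - k + u - k * u) with hKd
    have cP : c * P = P := by
      have : c * c ^ 4 = 1 := by rw [← pow_succ', hc]
      rw [hPd]; simp only [mul_smul_comm, mul_add, mul_one, this, ← pow_succ', ← pow_two]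
      congr 1; norm_num; abel
    have hP : P * P = P := by
      have c2 : c ^ 2 * P = P := by rw [pow_two, mul_assoc, cP, cP]
      have c3 : c ^ 3 * P = P := by rw [pow_succ, mul_assoc, cP, c2]
      have c4 : c ^ 4 * P = P := by rw [pow_succ, mul_assoc, cP, c3]
      nth_rewrite 1 [hPd]
      simp only [smul_mul_assoc, add_mul, one_mul, cP, c2, c3, c4]
      module
    have kP : k * P = P * k := by
      have k2 : k * c ^ 2 = c ^ 4 * k := by
        rw [pow_two, ← mul_assoc, kc, mul_assoc, kc, ← mul_assoc, ← pow_add]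
      have k3 : k * c ^ 3 = c * k := by
        rw [pow_succ, ← mul_assoc, k2, mul_assoc, kc, ← mul_assoc, ← pow_add,
          show 4 + 2 = 5 + 1 from rfl, pow_add, hc]; simp
      have k4 : k * c ^ 4 = c ^ 3 * k := by
        rw [show 4 = 2 + 2 from rfl, pow_add, ← mul_assoc, k2, mul_assoc, k2, ← mul_assoc,
          ← pow_add, show 4 + (2 + 2) = 5 + 3 from rfl, pow_add, hc]; simp
      rw [hPd]
      simp only [mul_smul_comm, smul_mul_assoc, mul_add, add_mul, one_mul, mul_one, kc, k2, k3, k4]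
      module
    have uP : u * P = P * u := by rw [← kk, mul_assoc, kP, ← mul_assoc, kP, mul_assoc]
    have hKP : P * K = K * P := by
      rw [hKd]
      simp only [mul_smul_comm, smul_mul_assoc, mul_add, add_mul, mul_sub, sub_mul, one_mul,
        mul_one, kP, uP, mul_assoc]
      rw [← mul_assoc k P, kP]; simp only [mul_assoc]
    have hK : K * K = K := by
      have r1 : u * (k * u) = k := by rw [ku, ← mul_assoc, uu, one_mul]
      have r2 : k * (k * u) = 1 := by rw [← mul_assoc, kk, uu]
      have r3 : k * u * k = 1 := by rw [mul_assoc, ← ku, r2]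
      have r4 : k * u * u = k := by rw [mul_assoc, uu, mul_one]
      have r5 : k * u * (k * u) = u := by rw [← mul_assoc, r3, one_mul]
      rw [hKd]
      simp only [mul_smul_comm, smul_mul_assoc, mul_add, add_mul, mul_sub, sub_mul, one_mul,
        mul_one, kk, uu, r1, r2, r3, r4, r5, ← ku]
      module
    have hN := idem_mul hP hK hKP
    have q1 := tr_twist c k 2 1 1 hc kc rfl
    have q2 := tr_twist c k 2 2 2 hc kc rfl
    have q3 := tr_twist c k 2 3 3 hc kc rfl
    have q4 := tr_twist c k 2 4 4 hc kc rfl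
    have w1 := tr_twist c u 4 2 1 hc uc rfl
    have w2 := tr_twist c u 4 4 2 hc uc rfl
    have w3 := tr_twist c u 4 1 3 hc uc rfl
    have w4 := tr_twist c u 4 3 4 hc uc rfl
    have x1 := tr_twist c (k * u) 3 3 1 hc kuc rfl
    have x2 := tr_twist c (k * u) 3 1 2 hc kuc rfl
    have x3 := tr_twist c (k * u) 3 4 3 hc kuc rfl
    have x4 := tr_twist c (k * u) 3 2 4 hc kuc rfl
    rw [pow_one] at q1 w1 x1
    have hm0 := idem_nat _ hP
    have hmN := idem_nat _ hN
    have hmC := idem_nat _ (idem_compl hP)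
    set m0 := Module.finrank ℂ (LinearMap.range P)
    set mN := Module.finrank ℂ (LinearMap.range (P * K))
    set mC := Module.finrank ℂ (LinearMap.range (1 - P))
    have htN : tr (P * K) = (tr P - 6) / 4 := by
      rw [hPd, hKd]
      simp only [smul_mul_smul_comm, mul_add, add_mul, mul_sub, sub_mul, one_mul, mul_one,
        map_add, map_sub, map_smul, q1, q2, q3, q4, w1, w2, w3, w4, x1, x2, x3, x4, hk, hku, htau,
        h1, smul_eq_mul]
      push_cast
      ring
    rw [map_sub, h1, hm0] at hmC
    rw [htN, hm0] at hmN
    have e1 : (m0 : ℂ) = 4 * mN + 6 := by rw [← hmN]; ring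
    have e2 : (6 : ℂ) = mC + m0 := by rw [← hmC]; ring
    have e1' : m0 = 4 * mN + 6 := by exact_mod_cast e1
    have e2' : 6 = mC + m0 := by exact_mod_cast e2
    have hC : 1 - P = 0 := idem_zero _ (idem_compl hP) (by
      rw [map_sub, h1, hm0, show m0 = 6 by omega]; simp)
    have hP1 : P = 1 := (sub_eq_zero.1 hC).symm
    rw [hP1, mul_one] at cP
    exact c1 cP

end opers


section opers

variable {W : Type} [AddCommGroup W] [Module ℂ W] [FiniteDimensional ℂ W]

local notation "tr" => LinearMap.trace ℂ W

/-- Operator data on a six-dimensional space. -/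
structure OD (ω : ℂ) (W : Type) [AddCommGroup W] [Module ℂ W] where
  (u v t s A B c : Module.End ℂ W)
  h6 : Module.finrank ℂ W = 6
  uu : u * u = 1
  vv : v * v = 1
  tt : t * t = 1
  ss : s * s = 1
  vu : v * u = u * v
  AAA : A * (A * A) = 1
  BBB : B * (B * B) = 1
  Au : A * u = u * v * A
  Av : A * v = u * A
  Bu : B * u = u * B
  Bv : B * v = v * B
  tu : t * u = u * t
  tv : t * v = u * v * t
  tA : t * A = A * A * t
  tB : t * B = B * B * t
  st : s * t = t * s
  su : s * u = u * t * s
  BA : B * A = ω • (A * B)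
  cc : c * c * c * c * c = 1
  kc : t * v * c = c * c * (t * v)
  cv : LinearMap.trace ℂ W v = LinearMap.trace ℂ W u
  cuv : LinearMap.trace ℂ W (u * v) = LinearMap.trace ℂ W u
  ct : LinearMap.trace ℂ W t = LinearMap.trace ℂ W u
  ctu : LinearMap.trace ℂ W (t * u) = LinearMap.trace ℂ W u
  cs : LinearMap.trace ℂ W s = LinearMap.trace ℂ W u
  cB : LinearMap.trace ℂ W A = 0 → LinearMap.trace ℂ W B = 0
  csv : LinearMap.trace ℂ W (A * B) = 0 → LinearMap.trace ℂ W (s * v) = 0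
  csAB : LinearMap.trace ℂ W (A * B) = 0 → LinearMap.trace ℂ W (s * (A * B)) = 0
  csABBt : LinearMap.trace ℂ W (A * B) = 0 →
    LinearMap.trace ℂ W (s * (A * (B * (B * t)))) = 0
  csAu : LinearMap.trace ℂ W (t * v) = 0 → LinearMap.trace ℂ W (s * (A * u)) = 0
  nu : u ≠ 1
  nc : c ≠ 1
  nB : B ≠ 1

theorem OD.tru {ω : ℂ} (D : OD ω W) : tr D.u = 2 := by
  have tvt : D.t * D.v * D.t = D.u * D.v := by
    rw [D.tv, mul_assoc, D.tt, mul_one]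
  have kk : D.t * D.v * (D.t * D.v) = D.u := by
    rw [← mul_assoc, tvt, mul_assoc, D.vv, mul_one]
  refine stepV D.h6 D.u D.v (D.t * D.v) D.c D.uu D.vv D.vu kk ?_ D.cv D.cuv ?_ ?_ ?_ ?_ D.nu D.nc
  · have h1 : D.v * D.t = D.t * (D.u * D.v) := by
      rw [← tvt]; simp only [← mul_assoc]; rw [D.tt, one_mul]
    rw [← mul_assoc, h1]
    simp only [mul_assoc, D.vv, D.vu]
  · rw [mul_assoc, D.vv, mul_one, D.ct]
  · rw [← D.vu, mul_assoc, ← mul_assoc D.v, D.vv, one_mul, D.ctu]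
  · rw [← D.cc]; simp only [pow_succ, pow_zero, one_mul]
  · rw [D.kc, pow_two]

section pointwise

variable {ω : ℂ} (D : OD ω W) (x : W)

theorem OD.puu : D.u (D.u x) = x := LinearMap.congr_fun D.uu x
theorem OD.pvv : D.v (D.v x) = x := LinearMap.congr_fun D.vv x
theorem OD.ptt : D.t (D.t x) = x := LinearMap.congr_fun D.tt x
theorem OD.pss : D.s (D.s x) = x := LinearMap.congr_fun D.ss x
theorem OD.pvu : D.v (D.u x) = D.u (D.v x) := LinearMap.congr_fun D.vu x
theorem OD.pAAA : D.A (D.A (D.A x)) = x := LinearMap.congr_fun D.AAA x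
theorem OD.pBBB : D.B (D.B (D.B x)) = x := LinearMap.congr_fun D.BBB x
theorem OD.pAu : D.A (D.u x) = D.u (D.v (D.A x)) := LinearMap.congr_fun D.Au x
theorem OD.pAv : D.A (D.v x) = D.u (D.A x) := LinearMap.congr_fun D.Av x
theorem OD.pBu : D.B (D.u x) = D.u (D.B x) := LinearMap.congr_fun D.Bu x
theorem OD.pBv : D.B (D.v x) = D.v (D.B x) := LinearMap.congr_fun D.Bv x
theorem OD.ptu : D.t (D.u x) = D.u (D.t x) := LinearMap.congr_fun D.tu x
theorem OD.ptv : D.t (D.v x) = D.u (D.v (D.t x)) := LinearMap.congr_fun D.tv x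
theorem OD.ptA : D.t (D.A x) = D.A (D.A (D.t x)) := LinearMap.congr_fun D.tA x
theorem OD.ptB : D.t (D.B x) = D.B (D.B (D.t x)) := LinearMap.congr_fun D.tB x
theorem OD.pst : D.s (D.t x) = D.t (D.s x) := LinearMap.congr_fun D.st x
theorem OD.psu : D.s (D.u x) = D.u (D.t (D.s x)) := LinearMap.congr_fun D.su x
theorem OD.pBA : D.B (D.A x) = ω • D.A (D.B x) := LinearMap.congr_fun D.BA x

end pointwise

theorem OD.pre_f {ω : ℂ} (D : OD ω W) : ∃ f : W, ∃ σ : ℂ, f ≠ 0 ∧ D.u f = f ∧ D.v f = - f ∧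
    (∀ x, D.u x = x → D.v x = - x → ∃ a : ℂ, x = a • f) ∧ D.t f = σ • f ∧ σ ^ 2 = 1 ∧
    D.B f = f := by
  have h1 : tr (1 : Module.End ℂ W) = 6 := by rw [LinearMap.trace_one, D.h6]; norm_num
  have hPx := idem_mul (idem_half D.uu) (idem_half' D.vv) (by
    simp only [smul_mul_smul_comm, mul_add, add_mul, mul_sub, sub_mul, one_mul, mul_one, D.vu]
    module)
  obtain ⟨f, f0, hf, huniq⟩ := idem_one _ hPx (by
    simp only [smul_mul_smul_comm, mul_add, add_mul, mul_sub, sub_mul, one_mul, mul_one, map_add,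
      map_sub, map_smul, h1, D.cv, D.cuv, smul_eq_mul, D.tru]
    norm_num)
  have huniq' : ∀ x, D.u x = x → D.v x = - x → ∃ a : ℂ, x = a • f := by
    intro x hu hv
    apply huniq
    simp [hu, hv]
    module
  have hu : D.u f = f := by
    rw [← hf]; simp [D.puu]; abel
  have hv : D.v f = - f := by
    rw [← hf]; simp [D.pvv, D.pvu]; module
  have hut : D.u (D.t f) = D.t f := by rw [← D.ptu, hu]
  have hvt : D.v (D.t f) = - D.t f := by
    have := D.ptv f
    rw [hv, map_neg, ← D.pvu, hut] at this
    exact this.symm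
  obtain ⟨σ, hσ⟩ := huniq' _ hut hvt
  obtain ⟨β, hβ⟩ := huniq' (D.B f) (by rw [← D.pBu, hu]) (by rw [← D.pBv, hv, map_neg])
  have hs2 : σ ^ 2 = 1 := by
    have := D.ptt f
    rw [hσ, map_smul, hσ, smul_smul] at this
    have h : (σ * σ - 1) • f = 0 := by rw [sub_smul, this]; simp
    rcases smul_eq_zero.1 h with h | h
    · linear_combination h
    · exact absurd h f0
  have hb : β = 1 := by
    have h3 := D.pBBB f
    simp only [hβ, map_smul, smul_smul] at h3
    have h3' : β * β * β = 1 := by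
      have h : (β * β * β - 1) • f = 0 := by rw [sub_smul, ← mul_assoc] at *; rw [h3]; simp
      rcases smul_eq_zero.1 h with h | h
      · linear_combination h
      · exact absurd h f0
    have h4 := D.ptB f
    simp only [hβ, hσ, map_smul, smul_smul] at h4
    have h5 : (β * σ - σ * (β * β)) • f = 0 := by
      rw [sub_smul, h4]; module
    have h6 : β * σ - σ * (β * β) = 0 := by
      rcases smul_eq_zero.1 h5 with h | h
      · exact h
      · exact absurd h f0
    have h7 : β - β * β = 0 := by linear_combination σ * h6 - (β - β * β) * hs2
    linear_combination - β ^ 2 * h7 - (β - 1) * h3'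
  refine ⟨f, σ, f0, hu, hv, huniq', hσ, hs2, ?_⟩
  rw [hβ, hb, one_smul]

/-- projection to the invariants of the four-group -/
noncomputable def OD.P0 {ω : ℂ} (D : OD ω W) : Module.End ℂ W :=
  ((1 / 2 : ℂ) • (1 + D.u)) * ((1 / 2 : ℂ) • (1 + D.v))

/-- projection to the `ξ`-eigenspace of `B` in the invariants -/
noncomputable def OD.E {ω : ℂ} (D : OD ω W) (ξ : ℂ) : Module.End ℂ W :=
  ((1 / 3 : ℂ) • (1 + ξ ^ 2 • D.B + ξ • (D.B * D.B))) * D.P0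

theorem OD.P0_idem {ω : ℂ} (D : OD ω W) : D.P0 * D.P0 = D.P0 :=
  idem_mul (idem_half D.uu) (idem_half D.vv) (by
    simp only [smul_mul_smul_comm, mul_add, add_mul, one_mul, mul_one, D.vu]; module)

theorem OD.P0_tr {ω : ℂ} (D : OD ω W) : tr D.P0 = 3 := by
  have h1 : tr (1 : Module.End ℂ W) = 6 := by rw [LinearMap.trace_one, D.h6]; norm_num
  simp only [OD.P0, smul_mul_smul_comm, mul_add, add_mul, one_mul, mul_one, map_add, map_smul, h1,
    D.cv, D.cuv, smul_eq_mul, D.tru]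
  norm_num

theorem OD.P0_apply {ω : ℂ} (D : OD ω W) (x : W) :
    D.P0 x = (1 / 4 : ℂ) • (x + D.u x + D.v x + D.u (D.v x)) := by
  simp [OD.P0]; module

theorem OD.P0_fix {ω : ℂ} (D : OD ω W) (x : W) : D.P0 x = x ↔ D.u x = x ∧ D.v x = x := by
  constructor
  · intro h
    rw [← h]
    constructor
    · rw [D.P0_apply]; simp [D.puu]; abel
    · rw [D.P0_apply]; simp [D.pvv, D.pvu]; abel
  · rintro ⟨h, h'⟩
    rw [D.P0_apply, h', h]; module

theorem OD.BP0 {ω : ℂ} (D : OD ω W) : D.B * D.P0 = D.P0 * D.B := by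
  ext x
  simp [D.P0_apply, D.pBu, D.pBv]

theorem OD.AP0 {ω : ℂ} (D : OD ω W) : D.A * D.P0 = D.P0 * D.A := by
  ext x
  have : D.A (D.u (D.v x)) = D.v (D.A x) := by rw [D.pAu, D.pAv, D.pvu, D.puu]
  simp [D.P0_apply, this, D.pAv, D.pAu]
  abel

theorem OD.tP0 {ω : ℂ} (D : OD ω W) : D.t * D.P0 = D.P0 * D.t := by
  ext x
  simp [D.P0_apply, D.ptu, D.ptv, D.puu]
  abel

theorem OD.E_idem {ω : ℂ} (D : OD ω W) (ξ : ℂ) (hξ : ξ ^ 3 = 1) : D.E ξ * D.E ξ = D.E ξ := by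
  refine idem_mul ?_ D.P0_idem ?_
  · have r1 : D.B * D.B * D.B = 1 := by rw [mul_assoc, D.BBB]
    have r2 : D.B * D.B * (D.B * D.B) = D.B := by rw [← mul_assoc, r1, one_mul]
    simp only [smul_mul_smul_comm, mul_add, add_mul, one_mul, mul_one, D.BBB, r1, r2,
      smul_mul_assoc, mul_smul_comm, smul_smul, smul_add]
    linear_combination (norm := module) hξ • (2 / 9 : ℂ) • (1 : Module.End ℂ W)
      + hξ • (ξ / 9) • (D.B * D.B)
  · simp only [smul_mul_assoc, mul_smul_comm, mul_add, add_mul, one_mul, mul_one, D.BP0, mul_assoc]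
    rw [← mul_assoc D.B D.P0, D.BP0, mul_assoc]

theorem OD.E_fix {ω : ℂ} (D : OD ω W) (ξ : ℂ) (hξ : ξ ^ 3 = 1) (x : W) :
    D.E ξ x = x ↔ D.u x = x ∧ D.v x = x ∧ D.B x = ξ • x := by
  have hE : D.E ξ = D.P0 * ((1 / 3 : ℂ) • (1 + ξ ^ 2 • D.B + ξ • (D.B * D.B))) := by
    rw [OD.E]
    simp only [smul_mul_assoc, mul_smul_comm, mul_add, add_mul, one_mul, mul_one, D.BP0, mul_assoc]
    rw [← mul_assoc D.B D.P0, D.BP0, mul_assoc]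
  constructor
  · intro h
    have h0 : D.P0 x = x := by
      rw [← h, hE]
      rw [Module.End.mul_apply, ← Module.End.mul_apply D.P0 D.P0, D.P0_idem]
    obtain ⟨h1, h2⟩ := (D.P0_fix x).1 h0
    refine ⟨h1, h2, ?_⟩
    rw [OD.E, Module.End.mul_apply, h0] at h
    have e3 : ξ * ξ ^ 2 = 1 := by linear_combination hξ
    rw [← h]
    simp [D.pBBB, smul_smul, e3]
    linear_combination (norm := module) -(hξ • (1 / 3 : ℂ) • D.B x)
  · rintro ⟨h1, h2, h3⟩
    rw [OD.E, Module.End.mul_apply, (D.P0_fix x).2 ⟨h1, h2⟩]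
    simp [h3, smul_smul, ]
    linear_combination (norm := module) hξ • (2 / 3 : ℂ) • x

theorem OD.E_tr {ω : ℂ} (D : OD ω W) (ξ : ℂ) :
    tr (D.E ξ) = (3 + ξ ^ 2 * tr (D.B * D.P0) + ξ * tr (D.B * D.B * D.P0)) / 3 := by
  simp only [OD.E, smul_mul_assoc, add_mul, one_mul, map_add, map_smul, smul_eq_mul, D.P0_tr]
  ring

theorem OD.E_one {ω : ℂ} (D : OD ω W) (ξ : ℂ) (hξ : ξ ^ 3 = 1) (h : tr (D.E ξ) = 1) :
    ∃ e : W, e ≠ 0 ∧ D.u e = e ∧ D.v e = e ∧ D.B e = ξ • e ∧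
      ∀ x, D.u x = x → D.v x = x → D.B x = ξ • x → ∃ a : ℂ, x = a • e := by
  obtain ⟨e, e0, he, hu⟩ := idem_one _ (D.E_idem ξ hξ) h
  obtain ⟨h1, h2, h3⟩ := (D.E_fix ξ hξ e).1 he
  exact ⟨e, e0, h1, h2, h3, fun x a b c => hu x ((D.E_fix ξ hξ x).2 ⟨a, b, c⟩)⟩

theorem OD.exists_basis {ω : ℂ} (D : OD ω W) {ζ : ℂ} (hζ : ζ ^ 2 + ζ + 1 = 0)
    (e0 e1 e2 f0 f1 f2 : W) (ne0 : e0 ≠ 0) (ne1 : e1 ≠ 0) (ne2 : e2 ≠ 0) (nf0 : f0 ≠ 0)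
    (nf1 : f1 ≠ 0) (nf2 : f2 ≠ 0)
    (u0 : D.u e0 = e0) (u1 : D.u e1 = e1) (u2 : D.u e2 = e2) (u3 : D.u f0 = f0)
    (u4 : D.u f1 = -f1) (u5 : D.u f2 = -f2)
    (v0 : D.v e0 = e0) (v1 : D.v e1 = e1) (v2 : D.v e2 = e2) (v3 : D.v f0 = -f0)
    (v4 : D.v f1 = -f1) (v5 : D.v f2 = f2)
    (B0 : D.B e0 = e0) (B1 : D.B e1 = ζ • e1) (B2 : D.B e2 = ζ ^ 2 • e2) :
    ∃ b : Module.Basis (Fin 6) ℂ W, b 0 = e0 ∧ b 1 = e1 ∧ b 2 = e2 ∧ b 3 = f0 ∧ b 4 = f1 ∧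
      b 5 = f2 := by
  have hli : LinearIndependent ℂ ![e0, e1, e2, f0, f1, f2] := by
    rw [Fintype.linearIndependent_iff]
    intro g hg
    rw [Fin.sum_univ_six] at hg
    have S : g 0 • e0 + g 1 • e1 + g 2 • e2 + g 3 • f0 + g 4 • f1 + g 5 • f2 = 0 := hg
    clear hg
    have uS := congrArg D.u S
    have vS := congrArg D.v S
    simp only [map_add, map_smul, map_zero, u0, u1, u2, u3, u4, u5, v0, v1, v2, v3, v4, v5]
      at uS vS
    have uvS := congrArg D.u vS
    simp only [map_add, map_neg, map_smul, map_zero, u0, u1, u2, u3, u4, u5] at uvS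
    have z3 : g 3 • f0 = 0 := by
      linear_combination (norm := module) (1 / 4 : ℂ) • S + (1 / 4 : ℂ) • uS - (1 / 4 : ℂ) • vS
        - (1 / 4 : ℂ) • uvS
    have z4 : g 4 • f1 = 0 := by
      linear_combination (norm := module) (1 / 4 : ℂ) • S - (1 / 4 : ℂ) • uS - (1 / 4 : ℂ) • vS
        + (1 / 4 : ℂ) • uvS
    have z5 : g 5 • f2 = 0 := by
      linear_combination (norm := module) (1 / 4 : ℂ) • S - (1 / 4 : ℂ) • uS + (1 / 4 : ℂ) • vS
        - (1 / 4 : ℂ) • uvS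
    have Y : g 0 • e0 + g 1 • e1 + g 2 • e2 = 0 := by
      linear_combination (norm := module) S - z3 - z4 - z5
    have BY := congrArg D.B Y
    simp only [map_add, map_smul, map_zero, B0, B1, B2] at BY
    have BBY := congrArg D.B BY
    simp only [map_add, map_smul, map_zero, B0, B1, B2] at BBY
    have c3 : ζ ^ 3 = 1 := by linear_combination (ζ - 1) * hζ
    have z0 : g 0 • e0 = 0 := by
      linear_combination (norm := module) (1 / 3 : ℂ) • Y + (1 / 3 : ℂ) • BY + (1 / 3 : ℂ) • BBY
        - hζ • (1 / 3 * g 1) • e1 - hζ • (1 / 3 * g 2 * (ζ ^ 2 - ζ + 1)) • e2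
    have z1 : g 1 • e1 = 0 := by
      linear_combination (norm := module) (1 / 3 : ℂ) • Y + (1 / 3 * ζ ^ 2 : ℂ) • BY
        + (1 / 3 * ζ : ℂ) • BBY - hζ • (1 / 3 * g 0) • e0
        - c3 • (2 / 3 * g 1) • e1 - hζ • (1 / 3 * g 2) • e2
        - c3 • (1 / 3 * g 2 * (ζ + ζ ^ 2)) • e2
    have z2 : g 2 • e2 = 0 := by
      linear_combination (norm := module) Y - z0 - z1
    intro i
    fin_cases i
    · exact (smul_eq_zero.1 z0).resolve_right ne0
    · exact (smul_eq_zero.1 z1).resolve_right ne1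
    · exact (smul_eq_zero.1 z2).resolve_right ne2
    · exact (smul_eq_zero.1 z3).resolve_right nf0
    · exact (smul_eq_zero.1 z4).resolve_right nf1
    · exact (smul_eq_zero.1 z5).resolve_right nf2
  refine ⟨basisOfLinearIndependentOfCardEqFinrank hli (by simp [D.h6]), ?_⟩
  simp

end opers


section opers

variable {W : Type} [AddCommGroup W] [Module ℂ W] [FiniteDimensional ℂ W]

local notation "tr" => LinearMap.trace ℂ W

theorem tr_six (b : Module.Basis (Fin 6) ℂ W) (T : Module.End ℂ W) :
    tr T = b.repr (T (b 0)) 0 + b.repr (T (b 1)) 1 + b.repr (T (b 2)) 2 + b.repr (T (b 3)) 3 +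
      b.repr (T (b 4)) 4 + b.repr (T (b 5)) 5 := by
  rw [LinearMap.trace_eq_matrix_trace ℂ b, Matrix.trace, Fin.sum_univ_six]
  simp [LinearMap.toMatrix_apply]

/-- basis adapted to the operators -/
structure Pre {ω : ℂ} (ζ : ℂ) (D : OD ω W) (b : Module.Basis (Fin 6) ℂ W) : Prop where
  u0 : D.u (b 0) = b 0
  u1 : D.u (b 1) = b 1
  u2 : D.u (b 2) = b 2
  u3 : D.u (b 3) = b 3
  u4 : D.u (b 4) = - b 4
  u5 : D.u (b 5) = - b 5
  v0 : D.v (b 0) = b 0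
  v1 : D.v (b 1) = b 1
  v2 : D.v (b 2) = b 2
  v3 : D.v (b 3) = - b 3
  v4 : D.v (b 4) = - b 4
  v5 : D.v (b 5) = b 5
  t0 : D.t (b 0) = b 0
  t1 : D.t (b 1) = b 2
  t2 : D.t (b 2) = b 1
  t3 : D.t (b 3) = b 3
  t4 : D.t (b 4) = b 5
  t5 : D.t (b 5) = b 4
  A3 : D.A (b 3) = b 4
  A4 : D.A (b 4) = b 5
  A5 : D.A (b 5) = b 3
  B0 : D.B (b 0) = b 0
  B1 : D.B (b 1) = ζ • b 1
  B2 : D.B (b 2) = ζ ^ 2 • b 2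

/-- nonsplit case -/
structure CaseN {ω : ℂ} (ζ : ℂ) (D : OD ω W) (b : Module.Basis (Fin 6) ℂ W) : Prop where
  A0 : D.A (b 0) = b 1
  A1 : D.A (b 1) = b 2
  A2 : D.A (b 2) = b 0
  B3 : D.B (b 3) = b 3
  B4 : D.B (b 4) = ζ • b 4
  B5 : D.B (b 5) = ζ ^ 2 • b 5

/-- split case -/
structure CaseT {ω : ℂ} (D : OD ω W) (b : Module.Basis (Fin 6) ℂ W) : Prop where
  A0 : D.A (b 0) = b 0
  A1 : D.A (b 1) = b 1
  A2 : D.A (b 2) = b 2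
  B3 : D.B (b 3) = b 3
  B4 : D.B (b 4) = b 4
  B5 : D.B (b 5) = b 5

theorem smul_cancel {f : W} (hf : f ≠ 0) {a b : ℂ} (h : a • f = b • f) : a = b :=
  smul_left_injective ℂ hf h

theorem OD.A_inj {ω : ℂ} (D : OD ω W) {x : W} (h : x ≠ 0) : D.A x ≠ 0 := by
  intro h0; apply h; rw [← D.pAAA x, h0]; simp

theorem OD.t_inj {ω : ℂ} (D : OD ω W) {x : W} (h : x ≠ 0) : D.t x ≠ 0 := by
  intro h0; apply h; rw [← D.ptt x, h0]; simp

theorem OD.tb {ω : ℂ} (D : OD ω W) (x : W) : D.B (D.t x) = D.t (D.B (D.B x)) := by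
  rw [D.ptB, D.ptB, D.pBBB]

theorem OD.ta {ω : ℂ} (D : OD ω W) (x : W) : D.A (D.t x) = D.t (D.A (D.A x)) := by
  rw [D.ptA, D.ptA, D.pAAA]

theorem OD.vt {ω : ℂ} (D : OD ω W) (x : W) : D.v (D.t x) = D.t (D.u (D.v x)) := by
  rw [D.ptu, D.ptv, D.puu]

theorem OD.vA {ω : ℂ} (D : OD ω W) (x : W) : D.v (D.A x) = D.A (D.u (D.v x)) := by
  rw [D.pAu, D.pAv, D.pvu, D.puu]

theorem OD.fpart {ω : ℂ} (D : OD ω W) : ∃ f0 f1 f2 : W, ∃ σ : ℂ, f0 ≠ 0 ∧ f1 ≠ 0 ∧ f2 ≠ 0 ∧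
    σ ^ 2 = 1 ∧
    (∀ x, D.u x = x → D.v x = - x → ∃ a : ℂ, x = a • f0) ∧
    D.A f0 = f1 ∧ D.A f1 = f2 ∧ D.A f2 = f0 ∧
    D.u f0 = f0 ∧ D.u f1 = - f1 ∧ D.u f2 = - f2 ∧ D.v f0 = - f0 ∧ D.v f1 = - f1 ∧ D.v f2 = f2 ∧
    D.t f0 = σ • f0 ∧ D.t f1 = σ • f2 ∧ D.t f2 = σ • f1 ∧
    D.B f0 = f0 ∧ D.B f1 = ω • f1 ∧ D.B f2 = ω ^ 2 • f2 := by
  obtain ⟨f, σ, f0, hu, hv, huniq, ht, hσ, hB⟩ := D.pre_f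
  have hu1 : D.u (D.A f) = - D.A f := by rw [← D.pAv, hv, map_neg]
  have hv1 : D.v (D.A f) = - D.A f := by rw [D.vA, hv, map_neg, hu, map_neg]
  have hu2 : D.u (D.A (D.A f)) = - D.A (D.A f) := by rw [← D.pAv, hv1, map_neg]
  have hv2 : D.v (D.A (D.A f)) = D.A (D.A f) := by rw [D.vA, hv1, map_neg, hu1, neg_neg]
  refine ⟨f, D.A f, D.A (D.A f), σ, f0, D.A_inj f0, D.A_inj (D.A_inj f0), hσ, huniq, rfl, rfl,
    D.pAAA f, hu, hu1, hu2, hv, hv1, hv2, ht, ?_, ?_, hB, ?_, ?_⟩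
  · rw [D.ptA, ht]; simp
  · rw [D.ptA, D.ptA, ht]; simp [D.pAAA]
  · rw [D.pBA, hB]
  · rw [D.pBA, D.pBA, hB, map_smul, smul_smul]; ring_nf

/-- collecting the data -/
theorem OD.finish {ω : ℂ} (D : OD ω W) {ζ : ℂ} (hζ : ζ ^ 2 + ζ + 1 = 0)
    (e0 e1 e2 f0 f1 f2 : W) (ne0 : e0 ≠ 0) (ne1 : e1 ≠ 0) (ne2 : e2 ≠ 0) (nf0 : f0 ≠ 0)
    (nf1 : f1 ≠ 0) (nf2 : f2 ≠ 0)
    (u0 : D.u e0 = e0) (u1 : D.u e1 = e1) (u2 : D.u e2 = e2) (u3 : D.u f0 = f0)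
    (u4 : D.u f1 = -f1) (u5 : D.u f2 = -f2)
    (v0 : D.v e0 = e0) (v1 : D.v e1 = e1) (v2 : D.v e2 = e2) (v3 : D.v f0 = -f0)
    (v4 : D.v f1 = -f1) (v5 : D.v f2 = f2)
    (B0 : D.B e0 = e0) (B1 : D.B e1 = ζ • e1) (B2 : D.B e2 = ζ ^ 2 • e2)
    (A3 : D.A f0 = f1) (A4 : D.A f1 = f2) (A5 : D.A f2 = f0) (σ σ' κ : ℂ)
    (hσ : σ ^ 2 = 1) (hσ' : σ' ^ 2 = 1) (hκ : κ = 1 ∨ κ = σ')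
    (t0 : D.t e0 = σ' • e0) (t1 : D.t e1 = κ • e2) (t2 : D.t e2 = κ • e1)
    (t3 : D.t f0 = σ • f0) (t4 : D.t f1 = σ • f2) (t5 : D.t f2 = σ • f1) :
    ∃ b : Module.Basis (Fin 6) ℂ W, Pre ζ D b ∧ b 0 = e0 ∧ b 1 = e1 ∧ b 2 = e2 ∧ b 3 = f0 ∧
      b 4 = f1 ∧ b 5 = f2 := by
  obtain ⟨b, b0, b1, b2, b3, b4, b5⟩ := D.exists_basis hζ e0 e1 e2 f0 f1 f2 ne0 ne1 ne2 nf0 nf1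
    nf2 u0 u1 u2 u3 u4 u5 v0 v1 v2 v3 v4 v5 B0 B1 B2
  subst b0 b1 b2 b3 b4 b5
  have ht := D.ct
  rw [D.tru, tr_six b, t0, t1, t2, t3, t4, t5] at ht
  simp [Finsupp.single_apply] at ht
  have e1 : σ = 1 := by linear_combination (1 / 4) * (hσ - hσ') + (1 / 4 * (2 - σ + σ')) * ht
  have e2 : σ' = 1 := by linear_combination ht - e1
  have e3 : κ = 1 := by rcases hκ with h | h <;> rw [h]; exact e2
  rw [e1, one_smul] at t3 t4 t5
  rw [e2, one_smul] at t0
  rw [e3, one_smul] at t1 t2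
  exact ⟨b, ⟨u0, u1, u2, u3, u4, u5, v0, v1, v2, v3, v4, v5, t0, t1, t2, t3, t4, t5, A3, A4, A5,
    B0, B1, B2⟩, rfl, rfl, rfl, rfl, rfl, rfl⟩

theorem OD.t_e0 {ω : ℂ} (D : OD ω W) {e : W} (e0 : e ≠ 0) (hu : D.u e = e) (hv : D.v e = e)
    (hB : D.B e = (1 : ℂ) • e)
    (huniq : ∀ x, D.u x = x → D.v x = x → D.B x = (1 : ℂ) • x → ∃ a : ℂ, x = a • e) :
    ∃ σ : ℂ, σ ^ 2 = 1 ∧ D.t e = σ • e := by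
  obtain ⟨σ, hσ⟩ := huniq (D.t e) (by rw [← D.ptu, hu]) (by rw [D.vt, hv, hu])
    (by rw [D.tb, hB]; simp only [one_smul, hB])
  refine ⟨σ, ?_, hσ⟩
  have h := D.ptt e
  rw [hσ, map_smul, hσ, smul_smul] at h
  have := smul_cancel e0 (h.trans (one_smul ℂ e).symm)
  linear_combination this

theorem existsN {ζ : ℂ} (hζ : ζ ^ 2 + ζ + 1 = 0) (D : OD ζ W) :
    ∃ b, Pre ζ D b ∧ CaseN ζ D b := by
  have c3 : ζ ^ 3 = 1 := by linear_combination (ζ - 1) * hζ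
  have hz1 : ζ - 1 ≠ 0 := by
    intro h
    have : (3 : ℂ) = 0 := by linear_combination hζ - (ζ + 2) * h
    norm_num at this
  have hz2 : ζ ^ 2 - 1 ≠ 0 := by
    intro h
    have : (3 : ℂ) = 0 := by linear_combination h - (ζ - 2) * (hζ - h)
    norm_num at this
  have h1 : tr (D.B * D.P0) = 0 := by
    have e : D.B * D.P0 * D.A = ζ • (D.A * (D.B * D.P0)) := by
      rw [mul_assoc, ← D.AP0, ← mul_assoc, D.BA, smul_mul_assoc, mul_assoc]
    have e2 : tr (D.A * D.A * (D.B * D.P0 * D.A)) = ζ * tr (D.B * D.P0) := by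
      rw [e, mul_smul_comm, map_smul, ← mul_assoc, mul_assoc D.A D.A D.A, D.AAA, one_mul,
        smul_eq_mul]
    rw [LinearMap.trace_mul_comm, mul_assoc, D.AAA, mul_one] at e2
    have : (ζ - 1) * tr (D.B * D.P0) = 0 := by linear_combination -e2
    exact (mul_eq_zero.1 this).resolve_left hz1
  have h2 : tr (D.B * D.B * D.P0) = 0 := by
    have e : D.B * D.B * D.P0 * D.A = ζ ^ 2 • (D.A * (D.B * D.B * D.P0)) := by
      rw [mul_assoc, ← D.AP0, mul_assoc, ← mul_assoc D.B D.A, D.BA, smul_mul_assoc, mul_smul_comm,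
        mul_assoc, ← mul_assoc D.B D.A, D.BA, smul_mul_assoc, smul_smul, pow_two]
      simp only [mul_assoc]
    have e2 : tr (D.A * D.A * (D.B * D.B * D.P0 * D.A)) = ζ ^ 2 * tr (D.B * D.B * D.P0) := by
      rw [e, mul_smul_comm, map_smul, ← mul_assoc, mul_assoc D.A D.A D.A, D.AAA, one_mul,
        smul_eq_mul]
    rw [LinearMap.trace_mul_comm, mul_assoc, D.AAA, mul_one] at e2
    have : (ζ ^ 2 - 1) * tr (D.B * D.B * D.P0) = 0 := by linear_combination -e2
    exact (mul_eq_zero.1 this).resolve_left hz2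
  obtain ⟨e, ne, hu, hv, hB, huniq⟩ := D.E_one 1 (by norm_num) (by rw [D.E_tr, h1, h2]; norm_num)
  obtain ⟨σ', hσ', ht⟩ := D.t_e0 ne hu hv hB huniq
  rw [one_smul] at hB
  obtain ⟨f0, f1, f2, σ, nf0, nf1, nf2, hσ, -, A3, A4, A5, u3, u4, u5, v3, v4, v5, t3, t4, t5,
    B3, B4, B5⟩ := D.fpart
  have hu1 : D.u (D.A e) = D.A e := by rw [← D.pAv, hv]
  have hv1 : D.v (D.A e) = D.A e := by rw [D.vA, hv, hu]
  have hB1 : D.B (D.A e) = ζ • D.A e := by rw [D.pBA, hB]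
  obtain ⟨b, hb, b0, b1, b2, b3, b4, b5⟩ := D.finish hζ e (D.A e) (D.A (D.A e)) f0 f1 f2 ne
    (D.A_inj ne) (D.A_inj (D.A_inj ne)) nf0 nf1 nf2 hu hu1 (by rw [← D.pAv, hv1])
    u3 u4 u5 hv hv1 (by rw [D.vA, hv1, hu1]) v3 v4 v5 hB hB1
    (by rw [D.pBA, hB1, map_smul, smul_smul, pow_two]) A3 A4 A5 σ σ' σ' hσ hσ' (Or.inr rfl) ht
    (by rw [D.ptA, ht]; simp) (by rw [D.ptA, D.ptA, ht]; simp [D.pAAA]) t3 t4 t5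
  refine ⟨b, hb, ?_⟩
  constructor <;> simp only [b0, b1, b2, b3, b4, b5, D.pAAA, B3, B4, B5]

theorem existsT {ζ : ℂ} (hζ : ζ ^ 2 + ζ + 1 = 0) (D : OD 1 W) :
    ∃ b, Pre ζ D b ∧ CaseT D b := by
  have c3 : ζ ^ 3 = 1 := by linear_combination (ζ - 1) * hζ
  have c6 : (ζ ^ 2) ^ 3 = 1 := by linear_combination (ζ ^ 3 + 1) * c3
  obtain ⟨f0, f1, f2, σ, nf0, nf1, nf2, hσ, huf, A3, A4, A5, u3, u4, u5, v3, v4, v5, t3, t4, t5,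
    B3, B4, B5⟩ := D.fpart
  rw [one_smul] at B4
  rw [one_pow, one_smul] at B5
  have hAB : ∀ x, D.B (D.A x) = D.A (D.B x) := fun x => by rw [D.pBA, one_smul]
  have h2 : tr (D.B * D.B * D.P0) = tr (D.B * D.P0) := by
    have : D.B * D.B = D.t * D.B * D.t := by rw [D.tB, mul_assoc, D.tt, mul_one]
    rw [this, mul_assoc, D.tP0, LinearMap.trace_mul_comm]
    congr 1
    rw [mul_assoc, ← mul_assoc D.t, D.tt, one_mul, D.BP0]
  have k0 := D.E_tr 1
  have k1 := D.E_tr ζ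
  have k2 := D.E_tr (ζ ^ 2)
  have hsum : D.E 1 + D.E ζ + D.E (ζ ^ 2) = D.P0 := by
    simp only [OD.E, smul_mul_assoc, add_mul, one_mul]
    linear_combination (norm := module) hζ • (1 / 3 : ℂ) • (D.B * D.P0) +
      hζ • (1 / 3 : ℂ) • (D.B * D.B * D.P0) + c3 • (ζ / 3 : ℂ) • (D.B * D.P0)
  rw [h2] at k0 k1 k2
  have n0 := idem_nat _ (D.E_idem 1 (by norm_num))
  have n1 := idem_nat _ (D.E_idem ζ c3)
  rw [n0] at k0
  rw [n1] at k1
  set a0 := Module.finrank ℂ (LinearMap.range (D.E 1))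
  set a1 := Module.finrank ℂ (LinearMap.range (D.E ζ))
  have hs : (a0 : ℂ) + 2 * a1 = 3 := by
    linear_combination k0 + 2 * k1 + (2 / 3) * tr (D.B * D.P0) * hζ
  have hs' : a0 + 2 * a1 = 3 := by exact_mod_cast hs
  have h12 : tr (D.E (ζ ^ 2)) = tr (D.E ζ) := by
    rw [k2, n1, k1]; linear_combination (1 / 3) * tr (D.B * D.P0) * ζ * c3
  have ha1 : a1 = 1 := by
    have : a1 = 0 ∨ a1 = 1 := by omega
    rcases this with h | h
    · exfalso
      have z1 : D.E ζ = 0 := idem_zero _ (D.E_idem ζ c3) (by rw [n1, h]; simp)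
      have z2 : D.E (ζ ^ 2) = 0 := idem_zero _ (D.E_idem _ c6) (by rw [h12, n1, h]; simp)
      rw [z1, z2, add_zero, add_zero] at hsum
      apply D.nB
      have hf : ∀ y, D.u y = y → D.v y = - y → D.B y = y := by
        intro y hu hv
        obtain ⟨a, rfl⟩ := huf y hu hv
        rw [map_smul, B3]
      have hcan : ∀ y, D.B (D.A y) = D.A y → D.B y = y := by
        intro y hy
        rw [hAB] at hy
        rw [← D.pAAA (D.B y), hy, D.pAAA]
      ext x
      have x0 : D.B (D.P0 x) = D.P0 x := by
        have : D.E 1 (D.P0 x) = D.P0 x := by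
          rw [hsum, ← Module.End.mul_apply, D.P0_idem]
        have := ((D.E_fix 1 (by norm_num) _).1 this).2.2
        rwa [one_smul] at this
      set y1 := (1 / 4 : ℂ) • (x + D.u x - D.v x - D.u (D.v x)) with hy1
      set y2 := (1 / 4 : ℂ) • (x - D.u x - D.v x + D.u (D.v x)) with hy2
      set y3 := (1 / 4 : ℂ) • (x - D.u x + D.v x - D.u (D.v x)) with hy3
      have hx : x = D.P0 x + y1 + y2 + y3 := by
        rw [D.P0_apply, hy1, hy2, hy3]; module
      have b1 : D.B y1 = y1 := by
        apply hf
        · rw [hy1]; simp [D.puu]; module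
        · rw [hy1]; simp [D.pvv, D.pvu]; module
      have vy2 : D.v y2 = - y2 := by rw [hy2]; simp [D.pvv, D.pvu]; module
      have uy2 : D.u y2 = - y2 := by rw [hy2]; simp [D.puu]; module
      have vy3 : D.v y3 = y3 := by rw [hy3]; simp [D.pvv, D.pvu]; module
      have uy3 : D.u y3 = - y3 := by rw [hy3]; simp [D.puu]; module
      have b3 : D.B y3 = y3 := by
        apply hcan
        apply hf
        · rw [← D.pAv, vy3]
        · rw [D.vA, vy3, uy3, map_neg]
      have b2 : D.B y2 = y2 := by
        apply hcan
        apply hcan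
        apply hf
        · rw [← D.pAv, D.vA, vy2, map_neg, uy2, neg_neg]
        · rw [D.vA, D.vA, vy2, map_neg, uy2, neg_neg, ← D.pAv, vy2, map_neg, map_neg]
      rw [Module.End.one_apply]
      conv_lhs => rw [hx]
      rw [map_add, map_add, map_add, x0, b1, b2, b3, ← hx]
    · exact h
  have ha0 : a0 = 1 := by omega
  obtain ⟨e, ne, hu, hv, hB, huniq⟩ := D.E_one 1 (by norm_num) (by rw [n0, ha0]; norm_num)
  obtain ⟨e1, ne1, hu1, hv1, hB1, huniq1⟩ := D.E_one ζ c3 (by rw [n1, ha1]; norm_num)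
  obtain ⟨σ', hσ', ht⟩ := D.t_e0 ne hu hv hB huniq
  -- action of A
  obtain ⟨α, hα⟩ := huniq (D.A e) (by rw [← D.pAv, hv]) (by rw [D.vA, hv, hu])
    (by rw [hAB, hB, map_smul])
  obtain ⟨γ, hγ⟩ := huniq1 (D.A e1) (by rw [← D.pAv, hv1]) (by rw [D.vA, hv1, hu1])
    (by rw [hAB, hB1, map_smul])
  rw [one_smul] at hB
  have hA2 : D.A (D.t e1) = γ ^ 2 • D.t e1 := by
    rw [D.ta, hγ, map_smul, hγ, smul_smul, map_smul, pow_two]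
  have hα3 : α ^ 3 = 1 := by
    have h := D.pAAA e
    simp only [hα, map_smul, smul_smul] at h
    have := smul_cancel ne (h.trans (one_smul ℂ e).symm)
    linear_combination this
  have hγ3 : γ ^ 3 = 1 := by
    have h := D.pAAA e1
    simp only [hγ, map_smul, smul_smul] at h
    have := smul_cancel ne1 (h.trans (one_smul ℂ e1).symm)
    linear_combination this
  have hα1 : α = 1 := by
    have h := D.ptA e
    simp only [hα, ht, map_smul, smul_smul] at h
    have := smul_cancel ne h
    have h7 : α - α * α = 0 := by linear_combination σ' * this - (α - α * α) * hσ'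
    linear_combination - α ^ 2 * h7 - (α - 1) * hα3
  obtain ⟨b, hb, b0, b1, b2, b3, b4, b5⟩ := D.finish hζ e e1 (D.t e1) f0 f1 f2 ne
    ne1 (D.t_inj ne1) nf0 nf1 nf2 hu hu1 (by rw [← D.ptu, hu1])
    u3 u4 u5 hv hv1 (by rw [D.vt, hv1, hu1]) v3 v4 v5 hB hB1
    (by rw [D.tb, hB1, map_smul, hB1, smul_smul, map_smul, pow_two]) A3 A4 A5 σ σ' 1 hσ hσ'
    (Or.inl rfl) ht (by rw [one_smul]) (by rw [D.ptt, one_smul]) t3 t4 t5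
  have hγ1 : γ = 1 := by
    by_contra hne
    have hne' : γ - 1 ≠ 0 := sub_ne_zero.2 hne
    have hg : γ ^ 2 + γ + 1 = 0 := by
      have : (γ - 1) * (γ ^ 2 + γ + 1) = 0 := by linear_combination hγ3
      exact (mul_eq_zero.1 this).resolve_left hne'
    have hA : tr D.A = 0 := by
      rw [tr_six b, b0, b1, b2, b3, b4, b5, hα, hγ, hA2, A3, A4, A5, ← b0, ← b2, ← b1, ← b3, ← b4,
        ← b5]
      simp [Finsupp.single_apply]
      linear_combination hg + hα1
    have hBt := D.cB hA
    rw [tr_six b, hb.B0, hb.B1, hb.B2, b3, b4, b5, B3, B4, B5, ← b3, ← b4, ← b5] at hBt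
    simp [Finsupp.single_apply] at hBt
    have : (3 : ℂ) = 0 := by linear_combination hBt - hζ
    norm_num at this
  refine ⟨b, hb, ?_⟩
  rw [hα1, one_smul] at hα
  rw [hγ1, one_smul] at hγ
  rw [hγ1, one_pow, one_smul] at hA2
  constructor <;> simp only [b0, b1, b2, b3, b4, b5, B3, B4, B5, hα, hγ, hA2]

end opers


section opers

variable {W : Type} [AddCommGroup W] [Module ℂ W] [FiniteDimensional ℂ W]

local notation "tr" => LinearMap.trace ℂ W

theorem expand6 (b : Module.Basis (Fin 6) ℂ W) (x : W) : ∃ y0 y1 y2 w0 w1 w2 : ℂ,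
    x = y0 • b 0 + y1 • b 1 + y2 • b 2 + w0 • b 3 + w1 • b 4 + w2 • b 5 := by
  refine ⟨b.repr x 0, b.repr x 1, b.repr x 2, b.repr x 3, b.repr x 4, b.repr x 5, ?_⟩
  conv_lhs => rw [← b.sum_repr x, Fin.sum_univ_six]

theorem Pre.sD_raw {ω ζ : ℂ} {D : OD ω W} {b} (hb : Pre ζ D b) :
    ∃ l : ℂ, l ≠ 0 ∧ D.s (b 1 - b 2) = l • (b 4 - b 5) := by
  obtain ⟨y0, y1, y2, w0, w1, w2, hx⟩ := expand6 b (D.s (b 1 - b 2))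
  have ht : D.t (D.s (b 1 - b 2)) = - D.s (b 1 - b 2) := by
    rw [← D.pst, map_sub, hb.t1, hb.t2, ← map_neg]; congr 1; abel
  have hu : D.u (D.s (b 1 - b 2)) = - D.s (b 1 - b 2) := by
    have := D.psu (b 1 - b 2)
    rw [ht, map_neg, map_sub D.u, hb.u1, hb.u2] at this
    exact (neg_eq_iff_eq_neg.2 this).symm
  have hx' : D.s (b 1 - b 2) = ((w1 - w2) / 2) • (b 4 - b 5) := by
    have h1 := hu
    rw [hx] at h1
    simp only [map_add, map_smul, hb.u0, hb.u1, hb.u2, hb.u3, hb.u4, hb.u5] at h1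
    have h2 := ht
    rw [hx] at h2
    simp only [map_add, map_smul, hb.t0, hb.t1, hb.t2, hb.t3, hb.t4, hb.t5] at h2
    have h3 := congrArg D.t h1
    simp only [map_add, map_neg, map_smul, hb.t0, hb.t1, hb.t2, hb.t3, hb.t4, hb.t5] at h3
    rw [hx]
    linear_combination (norm := module) (1 / 4 : ℂ) • h1 + (1 / 2 : ℂ) • h2 - (1 / 4 : ℂ) • h3
  refine ⟨_, ?_, hx'⟩
  intro h0
  rw [h0, zero_smul] at hx'
  have := D.pss (b 1 - b 2)
  rw [hx', map_zero] at this
  have h := congrArg (fun x => b.repr x 1) this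
  simp [Finsupp.single_apply] at h

theorem Pre.scaleF {ω ζ : ℂ} {D : OD ω W} {b} (hb : Pre ζ D b) :
    ∃ b', Pre ζ D b' ∧ D.s (b' 1 - b' 2) = b' 4 - b' 5 ∧ (CaseN ζ D b → CaseN ζ D b') ∧
      (CaseT D b → CaseT D b') := by
  obtain ⟨l, hl, hs⟩ := hb.sD_raw
  have hw : ∀ i, IsUnit ((![1, 1, 1, l, l, l] : Fin 6 → ℂ) i) := by
    intro i; fin_cases i <;> simp [hl]
  have hbi : ∀ i, b.isUnitSMul hw i = (![1, 1, 1, l, l, l] : Fin 6 → ℂ) i • b i :=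
    fun i => b.isUnitSMul_apply hw i
  have b0 : b.isUnitSMul hw 0 = b 0 := by rw [hbi]; simp
  have b1 : b.isUnitSMul hw 1 = b 1 := by rw [hbi]; simp
  have b2 : b.isUnitSMul hw 2 = b 2 := by rw [hbi]; simp
  have b3 : b.isUnitSMul hw 3 = l • b 3 := by rw [hbi]; simp
  have b4 : b.isUnitSMul hw 4 = l • b 4 := by rw [hbi]; simp
  have b5 : b.isUnitSMul hw 5 = l • b 5 := by rw [hbi]; simp
  refine ⟨b.isUnitSMul hw, ?_, ?_, ?_, ?_⟩
  · constructor <;> simp only [b0, b1, b2, b3, b4, b5, map_smul, hb.u0, hb.u1, hb.u2, hb.u3, hb.u4,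
      hb.u5, hb.v0, hb.v1, hb.v2, hb.v3, hb.v4, hb.v5, hb.t0, hb.t1, hb.t2, hb.t3, hb.t4, hb.t5,
      hb.A3, hb.A4, hb.A5, hb.B0, hb.B1, hb.B2, smul_neg]
  · rw [b1, b2, b4, b5, hs, smul_sub]
  · intro h
    constructor <;> simp only [b0, b1, b2, b3, b4, b5, map_smul, h.A0, h.A1, h.A2, h.B3, h.B4, h.B5]
    · rw [smul_comm]
    · rw [smul_comm]
  · intro h
    constructor <;> simp only [b0, b1, b2, b3, b4, b5, map_smul, h.A0, h.A1, h.A2, h.B3, h.B4, h.B5]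

theorem Pre.scaleE {ω ζ : ℂ} {D : OD ω W} {b} (hb : Pre ζ D b) (hT : CaseT D b) (l : ℂ)
    (hl : l ≠ 0) : ∃ b', Pre ζ D b' ∧ CaseT D b' ∧ b' 0 = l • b 0 ∧ b' 1 = b 1 ∧ b' 2 = b 2 ∧
      b' 3 = b 3 ∧ b' 4 = b 4 ∧ b' 5 = b 5 := by
  have hw : ∀ i, IsUnit ((![l, 1, 1, 1, 1, 1] : Fin 6 → ℂ) i) := by
    intro i; fin_cases i <;> simp [hl]
  have hbi : ∀ i, b.isUnitSMul hw i = (![l, 1, 1, 1, 1, 1] : Fin 6 → ℂ) i • b i :=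
    fun i => b.isUnitSMul_apply hw i
  have b0 : b.isUnitSMul hw 0 = l • b 0 := by rw [hbi]; simp
  have b1 : b.isUnitSMul hw 1 = b 1 := by rw [hbi]; simp
  have b2 : b.isUnitSMul hw 2 = b 2 := by rw [hbi]; simp
  have b3 : b.isUnitSMul hw 3 = b 3 := by rw [hbi]; simp
  have b4 : b.isUnitSMul hw 4 = b 4 := by rw [hbi]; simp
  have b5 : b.isUnitSMul hw 5 = b 5 := by rw [hbi]; simp
  refine ⟨b.isUnitSMul hw, ?_, ?_, b0, b1, b2, b3, b4, b5⟩
  · constructor <;> simp only [b0, b1, b2, b3, b4, b5, map_smul, hb.u0, hb.u1, hb.u2, hb.u3, hb.u4,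
      hb.u5, hb.v0, hb.v1, hb.v2, hb.v3, hb.v4, hb.v5, hb.t0, hb.t1, hb.t2, hb.t3, hb.t4, hb.t5,
      hb.A3, hb.A4, hb.A5, hb.B0, hb.B1, hb.B2, smul_neg]
  · constructor <;> simp only [b0, b1, b2, b3, b4, b5, map_smul, hT.A0, hT.A1, hT.A2, hT.B3, hT.B4,
      hT.B5]

/-- the matrix of `s` -/
structure SM {ω : ℂ} (D : OD ω W) (b : Module.Basis (Fin 6) ℂ W)
    (p00 p01 p02 p10 p11 p12 p20 p21 p22 : ℂ) : Prop where
  s0 : D.s (b 0) = p00 • b 0 + p01 • (b 1 + b 2) + p02 • b 3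
  sY : D.s (b 1 + b 2) = p10 • b 0 + p11 • (b 1 + b 2) + p12 • b 3
  s3 : D.s (b 3) = p20 • b 0 + p21 • (b 1 + b 2) + p22 • b 3
  sD : D.s (b 1 - b 2) = b 4 - b 5
  sF : D.s (b 4 - b 5) = b 1 - b 2

theorem SM.s1 {ω : ℂ} {D : OD ω W} {b} {p00 p01 p02 p10 p11 p12 p20 p21 p22 : ℂ}
    (h : SM D b p00 p01 p02 p10 p11 p12 p20 p21 p22) : D.s (b 1) =
    (p10 / 2) • b 0 + (p11 / 2) • (b 1 + b 2) + (p12 / 2) • b 3 + (1 / 2 : ℂ) • (b 4 - b 5) := by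
  have h1 := h.sY
  have h2 := h.sD
  rw [map_add] at h1
  rw [map_sub] at h2
  linear_combination (norm := module) (1 / 2 : ℂ) • h1 + (1 / 2 : ℂ) • h2

theorem SM.s2 {ω : ℂ} {D : OD ω W} {b} {p00 p01 p02 p10 p11 p12 p20 p21 p22 : ℂ}
    (h : SM D b p00 p01 p02 p10 p11 p12 p20 p21 p22) : D.s (b 2) =
    (p10 / 2) • b 0 + (p11 / 2) • (b 1 + b 2) + (p12 / 2) • b 3 - (1 / 2 : ℂ) • (b 4 - b 5) := by
  have h1 := h.sY
  have h2 := h.sD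
  rw [map_add] at h1
  rw [map_sub] at h2
  linear_combination (norm := module) (1 / 2 : ℂ) • h1 - (1 / 2 : ℂ) • h2

theorem SM.s4 {ω ε : ℂ} {D : OD ω W} {b} {p00 p01 p02 p10 p11 p12 p20 p21 p22 : ℂ}
    (h : SM D b p00 p01 p02 p10 p11 p12 p20 p21 p22) (hP : D.s (b 4 + b 5) = ε • (b 4 + b 5)) :
    D.s (b 4) = (ε / 2) • (b 4 + b 5) + (1 / 2 : ℂ) • (b 1 - b 2) := by
  have h1 := hP
  have h2 := h.sF
  rw [map_add] at h1
  rw [map_sub] at h2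
  linear_combination (norm := module) (1 / 2 : ℂ) • h1 + (1 / 2 : ℂ) • h2

theorem SM.s5 {ω ε : ℂ} {D : OD ω W} {b} {p00 p01 p02 p10 p11 p12 p20 p21 p22 : ℂ}
    (h : SM D b p00 p01 p02 p10 p11 p12 p20 p21 p22) (hP : D.s (b 4 + b 5) = ε • (b 4 + b 5)) :
    D.s (b 5) = (ε / 2) • (b 4 + b 5) - (1 / 2 : ℂ) • (b 1 - b 2) := by
  have h1 := hP
  have h2 := h.sF
  rw [map_add] at h1
  rw [map_sub] at h2
  linear_combination (norm := module) (1 / 2 : ℂ) • h1 - (1 / 2 : ℂ) • h2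

theorem Pre.sR {ω ζ : ℂ} {D : OD ω W} {b} (hb : Pre ζ D b) (x : W) (hu : D.u x = x)
    (ht : D.t x = x) : ∃ p q r : ℂ, D.s x = p • b 0 + q • (b 1 + b 2) + r • b 3 := by
  obtain ⟨y0, y1, y2, w0, w1, w2, hx⟩ := expand6 b (D.s x)
  have ht' : D.t (D.s x) = D.s x := by rw [← D.pst, ht]
  have hu' : D.u (D.s x) = D.s x := by
    have := D.psu x
    rw [ht', hu] at this
    exact this.symm
  refine ⟨y0, (y1 + y2) / 2, w0, ?_⟩
  have h1 := hu'
  rw [hx] at h1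
  simp only [map_add, map_smul, hb.u0, hb.u1, hb.u2, hb.u3, hb.u4, hb.u5] at h1
  have h2 := ht'
  rw [hx] at h2
  simp only [map_add, map_smul, hb.t0, hb.t1, hb.t2, hb.t3, hb.t4, hb.t5] at h2
  have h3 := congrArg D.t h1
  simp only [map_add, map_neg, map_smul, hb.t0, hb.t1, hb.t2, hb.t3, hb.t4, hb.t5] at h3
  rw [hx]
  linear_combination (norm := module) -(1 / 4 : ℂ) • h1 - (1 / 2 : ℂ) • h2 - (1 / 4 : ℂ) • h3

theorem Pre.sP {ω ζ : ℂ} {D : OD ω W} {b} (hb : Pre ζ D b) :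
    ∃ ε : ℂ, D.s (b 4 + b 5) = ε • (b 4 + b 5) ∧ ε ^ 2 = 1 := by
  obtain ⟨y0, y1, y2, w0, w1, w2, hx⟩ := expand6 b (D.s (b 4 + b 5))
  have ht : D.t (D.s (b 4 + b 5)) = D.s (b 4 + b 5) := by
    rw [← D.pst, map_add, hb.t4, hb.t5, add_comm]
  have hu : D.u (D.s (b 4 + b 5)) = - D.s (b 4 + b 5) := by
    have := D.psu (b 4 + b 5)
    rw [ht, map_add D.u, hb.u4, hb.u5, ← neg_add, map_neg] at this
    rw [this]
  have hx' : D.s (b 4 + b 5) = ((w1 + w2) / 2) • (b 4 + b 5) := by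
    have h1 := hu
    rw [hx] at h1
    simp only [map_add, map_smul, hb.u0, hb.u1, hb.u2, hb.u3, hb.u4, hb.u5] at h1
    have h2 := ht
    rw [hx] at h2
    simp only [map_add, map_smul, hb.t0, hb.t1, hb.t2, hb.t3, hb.t4, hb.t5] at h2
    have h3 := congrArg D.t h1
    simp only [map_add, map_neg, map_smul, hb.t0, hb.t1, hb.t2, hb.t3, hb.t4, hb.t5] at h3
    rw [hx]
    linear_combination (norm := module) (1 / 4 : ℂ) • h1 - (1 / 2 : ℂ) • h2 + (1 / 4 : ℂ) • h3
  refine ⟨_, hx', ?_⟩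
  have := D.pss (b 4 + b 5)
  rw [hx', map_smul, hx', smul_smul] at this
  have h := congrArg (fun x => b.repr x 4) this
  simp [Finsupp.single_apply] at h
  linear_combination h

theorem mat3 (p00 p01 p02 p10 p11 p12 p20 p21 p22 : ℂ)
    (h : (!![p00, p01, p02; p10, p11, p12; p20, p21, p22] : Matrix (Fin 3) (Fin 3) ℂ) *
      !![p00, p01, p02; p10, p11, p12; p20, p21, p22] = 1) (ht : p00 + p11 + p22 = 3) :
    p22 = 1 := by
  set X : Matrix (Fin 3) (Fin 3) ℂ := !![p00, p01, p02; p10, p11, p12; p20, p21, p22] with hX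
  have hi : ((1 / 2 : ℂ) • (1 - Matrix.toLin' X)) * ((1 / 2 : ℂ) • (1 - Matrix.toLin' X)) =
      (1 / 2 : ℂ) • (1 - Matrix.toLin' X) := by
    apply idem_half'
    rw [Module.End.mul_eq_comp, ← Matrix.toLin'_mul, h, Matrix.toLin'_one]; rfl
  have h0 := idem_zero _ hi (by
    rw [map_smul, map_sub, LinearMap.trace_one, Matrix.trace_toLin'_eq, hX, Matrix.trace_fin_three]
    simp; rw [ht]; norm_num)
  have h1 : (1 : Module.End ℂ (Fin 3 → ℂ)) - Matrix.toLin' X = 0 := by simpa using h0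
  have h2 := congrFun (LinearMap.congr_fun h1 (Pi.single 2 1)) 2
  simp [hX, Matrix.toLin'_apply, Matrix.mulVec, dotProduct, Fin.sum_univ_three] at h2
  linear_combination -h2

theorem Pre.SM0 {ω ζ : ℂ} {D : OD ω W} {b} (hb : Pre ζ D b) (hD : D.s (b 1 - b 2) = b 4 - b 5)
    (hsv : tr (D.s * D.v) = 0) :
    ∃ p00 p01 p02 p10 p11 p12 p20 p21 p22 : ℂ, SM D b p00 p01 p02 p10 p11 p12 p20 p21 p22 ∧
      D.s (b 4 + b 5) = (1 : ℂ) • (b 4 + b 5) ∧ p22 = 1 / 2 ∧ p00 + p11 = 1 / 2 ∧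
      p00 * p00 + 2 * p01 * (p10 / 2) + p02 * p20 = 1 ∧
      p10 * p01 + p11 * p11 + p12 * p21 = 1 ∧
      p20 * p02 + p21 * p12 + p22 * p22 = 1 ∧
      p00 * p02 + p01 * p12 + p02 * p22 = 0 ∧
      p20 * p00 + p21 * p10 + p22 * p20 = 0 ∧
      p20 * p01 + p21 * p11 + p22 * p21 = 0 := by
  obtain ⟨p00, p01, p02, h0⟩ := hb.sR (b 0) hb.u0 hb.t0
  obtain ⟨p10, p11, p12, hY⟩ := hb.sR (b 1 + b 2) (by rw [map_add, hb.u1, hb.u2])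
    (by rw [map_add, hb.t1, hb.t2, add_comm])
  obtain ⟨p20, p21, p22, h3⟩ := hb.sR (b 3) hb.u3 hb.t3
  have hF : D.s (b 4 - b 5) = b 1 - b 2 := by rw [← hD, D.pss]
  have hS : SM D b p00 p01 p02 p10 p11 p12 p20 p21 p22 := ⟨h0, hY, h3, hD, hF⟩
  obtain ⟨ε, hP, hε⟩ := hb.sP
  have h1 := hS.s1
  have h2 := hS.s2
  have h4 := hS.s4 hP
  have h5 := hS.s5 hP
  have ts := D.cs
  rw [D.tru, tr_six b, h0, h1, h2, h3, h4, h5] at ts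
  simp [Finsupp.single_apply] at ts
  rw [tr_six b] at hsv
  simp only [Module.End.mul_apply, hb.v0, hb.v1, hb.v2, hb.v3, hb.v4, hb.v5, map_neg, h0, h1, h2,
    h3, h4, h5] at hsv
  simp [Finsupp.single_apply] at hsv
  have q0 := D.pss (b 0)
  have q1 := D.pss (b 1 + b 2)
  have q3 := D.pss (b 3)
  rw [h0] at q0
  rw [hY] at q1
  rw [h3] at q3
  rw [map_add, map_add, map_smul, map_smul, map_smul, h0, hY, h3] at q0 q1 q3
  have r00 := congrArg (fun x => b.repr x 0) q0
  have r01 := congrArg (fun x => b.repr x 1) q0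
  have r02 := congrArg (fun x => b.repr x 3) q0
  have r10 := congrArg (fun x => b.repr x 0) q1
  have r11 := congrArg (fun x => b.repr x 1) q1
  have r12 := congrArg (fun x => b.repr x 3) q1
  have r20 := congrArg (fun x => b.repr x 0) q3
  have r21 := congrArg (fun x => b.repr x 1) q3
  have r22 := congrArg (fun x => b.repr x 3) q3
  simp [Finsupp.single_apply] at r00 r01 r02 r10 r11 r12 r20 r21 r22
  have hne : ε ≠ -1 := by
    intro hε1
    have e22 : p22 = 3 / 2 := by linear_combination (ts - hsv - hε1) / 2
    have := mat3 p00 p01 p02 p10 p11 p12 p20 p21 p22 (by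
      ext i j
      fin_cases i <;> fin_cases j <;>
        simp [Matrix.mul_apply, Fin.sum_univ_three] <;> assumption) (by
      linear_combination ts - hε1)
    rw [this] at e22
    norm_num at e22
  have hε1 : ε = 1 := by
    have : (ε - 1) * (ε + 1) = 0 := by linear_combination hε
    rcases mul_eq_zero.1 this with h | h
    · linear_combination h
    · exact absurd (by linear_combination h) hne
  subst hε1
  refine ⟨p00, p01, p02, p10, p11, p12, p20, p21, p22, hS, hP, ?_, ?_, ?_, ?_, ?_, ?_, ?_, ?_⟩
  · linear_combination (ts - hsv) / 2
  · linear_combination (ts + hsv) / 2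
  · linear_combination r00
  · linear_combination r11
  · linear_combination r22
  · linear_combination r02
  · linear_combination r20
  · linear_combination r21

end opers


section opers

variable {W : Type} [AddCommGroup W] [Module ℂ W] [FiniteDimensional ℂ W]

local notation "tr" => LinearMap.trace ℂ W

theorem Pre.ttv {ω ζ : ℂ} {D : OD ω W} {b} (hb : Pre ζ D b) : tr (D.t * D.v) = 0 := by
  rw [tr_six b]
  simp only [Module.End.mul_apply, hb.v0, hb.v1, hb.v2, hb.v3, hb.v4, hb.v5, map_neg, hb.t0, hb.t1,
    hb.t2, hb.t3, hb.t4, hb.t5]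
  simp [Finsupp.single_apply]

theorem finalN {ζ : ℂ} (hζ : ζ ^ 2 + ζ + 1 = 0) (D : OD ζ W) :
    ∃ b : Module.Basis (Fin 6) ℂ W, ∃ m n : ℂ, Pre ζ D b ∧ CaseN ζ D b ∧
      SM D b (5 / 6) (1 / 3) m (2 / 3) (-1 / 3) (-4 * m) n (-2 * n) (1 / 2) ∧
      D.s (b 4 + b 5) = (1 : ℂ) • (b 4 + b 5) ∧ m * n = 1 / 12 := by
  obtain ⟨b1, hb1, hN1⟩ := existsN hζ D
  obtain ⟨b, hb, hD, hN', -⟩ := hb1.scaleF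
  have hN := hN' hN1
  have hAB : tr (D.A * D.B) = 0 := by
    rw [tr_six b]
    simp only [Module.End.mul_apply, hb.B0, hb.B1, hb.B2, hN.B3, hN.B4, hN.B5, map_smul, hN.A0,
      hN.A1, hN.A2, hb.A3, hb.A4, hb.A5]
    simp [Finsupp.single_apply]
  obtain ⟨p00, p01, p02, p10, p11, p12, p20, p21, p22, hS, hP, e22, e1, q1, q2, q3, q4, q5, q6⟩ :=
    hb.SM0 hD (D.csv hAB)
  have h0 := hS.s0
  have h1 := hS.s1
  have h2 := hS.s2
  have h3 := hS.s3
  have h4 := hS.s4 hP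
  have h5 := hS.s5 hP
  have t1 := D.csAB hAB
  have t2 := D.csABBt hAB
  have t3 := D.csAu hb.ttv
  rw [tr_six b] at t1 t2 t3
  simp only [Module.End.mul_apply, hb.B0, hb.B1, hb.B2, hN.B3, hN.B4, hN.B5, map_smul, hN.A0,
      hN.A1, hN.A2, hb.A3, hb.A4, hb.A5, hb.t0, hb.t1, hb.t2, hb.t3, hb.t4, hb.t5, hb.u0, hb.u1,
      hb.u2, hb.u3, hb.u4, hb.u5, map_neg, h0, h1, h2, h3, h4, h5] at t1 t2 t3
  simp [Finsupp.single_apply] at t1 t2 t3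
  have hz : ζ ≠ 0 := by rintro rfl; norm_num at hζ
  have hz1 : ζ - 1 ≠ 0 := by
    intro h
    have : ζ = 1 := by linear_combination h
    rw [this] at hζ; norm_num at hζ
  have hX : (ζ * (ζ - 1)) * ((p11 + 1) / 2 - p01) = 0 := by
    linear_combination t2 - t1 - (ζ ^ 2 - ζ) * p01 * hζ
  have e01 : p01 = (p11 + 1) / 2 := by
    rcases mul_eq_zero.1 hX with h | h
    · exact absurd h (mul_ne_zero hz hz1)
    · linear_combination -h
  have e10 : p10 = p11 + 1 := by
    linear_combination 2 * t1 - 2 * ζ ^ 2 * e01 - (p11 + 1) * hζ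
  have e11 : p11 = -1 / 3 := by
    linear_combination (2 / 3 : ℂ) * t3 - (1 / 3 : ℂ) * e10 - (2 / 3 : ℂ) * e01
  have e00 : p00 = 5 / 6 := by linear_combination e1 - e11
  rw [e11] at e01 e10
  have e01' : p01 = 1 / 3 := by rw [e01]; norm_num
  have e10' : p10 = 2 / 3 := by rw [e10]; norm_num
  subst e22 e11 e00 e01' e10'
  have e12 : p12 = -4 * p02 := by linear_combination 3 * q4
  have e21 : p21 = -2 * p20 := by linear_combination (3 / 2) * q5
  subst e12 e21
  exact ⟨b, p02, p20, hb, hN, hS, hP, by linear_combination q1⟩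

theorem finalT {ζ : ℂ} (hζ : ζ ^ 2 + ζ + 1 = 0) (D : OD 1 W) :
    ∃ b : Module.Basis (Fin 6) ℂ W, ∃ m n : ℂ, Pre ζ D b ∧ CaseT D b ∧
      SM D b (-1 / 6) (7 / 18) m 1 (2 / 3) (-6 / 7 * m) n (-1 / 3 * n) (1 / 2) ∧
      D.s (b 4 + b 5) = (1 : ℂ) • (b 4 + b 5) ∧ m * n = 7 / 12 := by
  obtain ⟨b1, hb1, hT1⟩ := existsT hζ D
  obtain ⟨b, hb, hD, -, hT'⟩ := hb1.scaleF
  have hT := hT' hT1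
  have hAB : tr (D.A * D.B) = 0 := by
    rw [tr_six b]
    simp only [Module.End.mul_apply, hb.B0, hb.B1, hb.B2, hT.B3, hT.B4, hT.B5, map_smul, hT.A0,
      hT.A1, hT.A2, hb.A3, hb.A4, hb.A5]
    simp [Finsupp.single_apply]
    linear_combination hζ
  obtain ⟨p00, p01, p02, p10, p11, p12, p20, p21, p22, hS, hP, e22, e1, q1, q2, q3, q4, q5, q6⟩ :=
    hb.SM0 hD (D.csv hAB)
  have h0 := hS.s0
  have h1 := hS.s1
  have h2 := hS.s2
  have h3 := hS.s3
  have h4 := hS.s4 hP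
  have h5 := hS.s5 hP
  have t1 := D.csAB hAB
  rw [tr_six b] at t1
  simp only [Module.End.mul_apply, hb.B0, hb.B1, hb.B2, hT.B3, hT.B4, hT.B5, map_smul, hT.A0,
      hT.A1, hT.A2, hb.A3, hb.A4, hb.A5, hb.t0, hb.t1, hb.t2, hb.t3, hb.t4, hb.t5, hb.u0, hb.u1,
      hb.u2, hb.u3, hb.u4, hb.u5, map_neg, h0, h1, h2, h3, h4, h5] at t1
  simp [Finsupp.single_apply] at t1
  have e11 : p11 = 2 / 3 := by linear_combination (2 / 3) * e1 - (2 / 3) * t1 + p11 / 3 * hζ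
  have e00 : p00 = -1 / 6 := by linear_combination e1 - e11
  subst e11 e00 e22
  have hk : p01 * p10 = 7 / 18 := by linear_combination (q1 + q2 - q3) / 2
  have hl : p10 ≠ 0 := by rintro rfl; norm_num at hk
  obtain ⟨b', hb', hT2, c0, c1, c2, c3, c4, c5⟩ := hb.scaleE hT p10 hl
  obtain ⟨n, hn⟩ : ∃ n, p20 = n * p10 := ⟨p20 / p10, by field_simp⟩
  subst hn
  have e12 : p12 = -6 / 7 * (p10 * p02) := by
    linear_combination (18 / 7) * p10 * q4 - (18 / 7) * p12 * hk
  have e21 : p21 = -1 / 3 * n := by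
    apply mul_right_cancel₀ hl
    linear_combination q5
  subst e12 e21
  refine ⟨b', p10 * p02, n, hb', hT2, ?_, ?_, ?_⟩
  · constructor
    · rw [c0, c1, c2, c3, map_smul, h0]
      linear_combination (norm := module) hk • (b 1 + b 2)
    · rw [c0, c1, c2, c3, hS.sY]
      module
    · rw [c0, c1, c2, c3, h3]
      module
    · rw [c1, c2, c4, c5, hD]
    · rw [c1, c2, c4, c5, hS.sF]
  · rw [c4, c5, hP]
  · linear_combination q1 - hk

end opers


section opers

variable {W : Type} [AddCommGroup W] [Module ℂ W] [FiniteDimensional ℂ W]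
variable {G : Type} [Group G]

local notation "tr" => LinearMap.trace ℂ W

theorem tr_conj (ρ : G →* Module.End ℂ W) (g x y : G) (h : g * x * g⁻¹ = y) :
    tr (ρ y) = tr (ρ x) := by
  rw [← h, map_mul, LinearMap.trace_mul_comm, ← map_mul]
  congr 2
  group

theorem tr_conj0 (ρ : G →* Module.End ℂ W)
    (hc : ∀ y ∈ Subgroup.center G, ∃ a : ℂ, a ≠ 0 ∧ ρ y = a • 1) (x y : G)
    (h : ∃ g, ∃ z ∈ Subgroup.center G, g * x * g⁻¹ = z * y) (h0 : tr (ρ x) = 0) :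
    tr (ρ y) = 0 := by
  obtain ⟨g, z, hz, hg⟩ := h
  obtain ⟨a, ha, hza⟩ := hc z hz
  rw [← tr_conj ρ g x _ hg, map_mul, hza, smul_mul_assoc, one_mul, map_smul, smul_eq_mul] at h0
  exact (mul_eq_zero.1 h0).resolve_left ha

/-- operator data of a representation -/
noncomputable def odOf (d : GD G) (ρ : G →* Module.End ℂ W) (ω : ℂ)
    (h6 : Module.finrank ℂ W = 6) (hz : ρ d.z = ω • 1)
    (hc : ∀ y ∈ Subgroup.center G, ∃ a : ℂ, a ≠ 0 ∧ ρ y = a • 1)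
    (hnt : ∃ g, ρ g ≠ 1) : OD ω W where
  u := ρ d.u
  v := ρ d.v
  t := ρ d.t
  s := ρ d.s
  A := ρ d.A
  B := ρ d.B
  c := ρ d.c
  h6 := h6
  uu := by rw [← map_mul, d.uu, map_one]
  vv := by rw [← map_mul, d.vv, map_one]
  tt := by rw [← map_mul, d.tt, map_one]
  ss := by rw [← map_mul, d.ss, map_one]
  vu := by rw [← map_mul, d.vu, map_mul]
  AAA := by rw [← map_mul, ← map_mul, d.AAA, map_one]
  BBB := by rw [← map_mul, ← map_mul, d.BBB, map_one]
  Au := by rw [← map_mul, d.Au, map_mul, map_mul]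
  Av := by rw [← map_mul, d.Av, map_mul]
  Bu := by rw [← map_mul, d.Bu, map_mul]
  Bv := by rw [← map_mul, d.Bv, map_mul]
  tu := by rw [← map_mul, d.tu, map_mul]
  tv := by rw [← map_mul, d.tv, map_mul, map_mul]
  tA := by rw [← map_mul, d.tA, map_mul, map_mul]
  tB := by rw [← map_mul, d.tB, map_mul, map_mul]
  st := by rw [← map_mul, d.st, map_mul]
  su := by rw [← map_mul, d.su, map_mul, map_mul]
  BA := by rw [← map_mul, d.BA, map_mul, hz, smul_mul_assoc, one_mul, map_mul]
  cc := by simp only [← map_mul]; rw [d.cc, map_one]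
  kc := by simp only [← map_mul]; rw [d.kc]
  cv := by obtain ⟨g, hg⟩ := d.cv; exact tr_conj ρ g _ _ hg
  cuv := by obtain ⟨g, hg⟩ := d.cuv; rw [← map_mul]; exact tr_conj ρ g _ _ hg
  ct := by obtain ⟨g, hg⟩ := d.ct; exact tr_conj ρ g _ _ hg
  ctu := by obtain ⟨g, hg⟩ := d.ctu; rw [← map_mul]; exact tr_conj ρ g _ _ hg
  cs := by obtain ⟨g, hg⟩ := d.cs; exact tr_conj ρ g _ _ hg
  cB := tr_conj0 ρ hc _ _ d.cB
  csv := by simp only [← map_mul]; exact tr_conj0 ρ hc _ _ d.csv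
  csAB := by simp only [← map_mul]; exact tr_conj0 ρ hc _ _ d.csAB
  csABBt := by simp only [← map_mul]; exact tr_conj0 ρ hc _ _ d.csABBt
  csAu := by simp only [← map_mul]; exact tr_conj0 ρ hc _ _ d.csAu
  nu := by
    intro h
    obtain ⟨g, hg⟩ := hnt
    exact hg (by
      have := d.nu ρ.ker inferInstance h
      exact (this ▸ Subgroup.mem_top g : g ∈ ρ.ker))
  nc := by
    intro h
    obtain ⟨g, hg⟩ := hnt
    exact hg (by
      have := d.nc ρ.ker inferInstance h
      exact (this ▸ Subgroup.mem_top g : g ∈ ρ.ker))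
  nB := by
    intro h
    obtain ⟨g, hg⟩ := hnt
    exact hg (by
      have := d.nB ρ.ker inferInstance h
      exact (this ▸ Subgroup.mem_top g : g ∈ ρ.ker))

theorem rep_center (ρ : G →* Module.End ℂ W) (h6 : Module.finrank ℂ W = 6)
    (hirr : ∀ V : Submodule ℂ W, (∀ g : G, ∀ v ∈ V, ρ g v ∈ V) → V = ⊥ ∨ V = ⊤)
    (y : G) (hy : y ∈ Subgroup.center G) : ∃ a : ℂ, a ≠ 0 ∧ ρ y = a • 1 := by
  have : Nontrivial W := Module.nontrivial_of_finrank_pos (R := ℂ) (by rw [h6]; norm_num)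
  obtain ⟨a, ha⟩ := Module.End.exists_eigenvalue (ρ y)
  have hE : ∀ x, ρ y x = a • x := by
    intro x
    have hinv := hirr (Module.End.eigenspace (ρ y) a) (by
      intro g v hv
      rw [Module.End.mem_eigenspace_iff] at hv ⊢
      have h1 : ρ y (ρ g v) = ρ g (ρ y v) := by
        rw [← Module.End.mul_apply, ← Module.End.mul_apply, ← map_mul, ← map_mul,
          Subgroup.mem_center_iff.1 hy g]
      rw [h1, hv, map_smul])
    rcases hinv with h | h
    · exact absurd h ha
    · rw [← Module.End.mem_eigenspace_iff, h]; trivial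
  refine ⟨a, ?_, ?_⟩
  · rintro rfl
    obtain ⟨x, hx⟩ := exists_ne (0 : W)
    apply hx
    have : ρ (y⁻¹ * y) x = x := by simp
    rw [map_mul, Module.End.mul_apply, hE, zero_smul, map_zero] at this
    exact this.symm
  · ext x; simp [hE]

theorem rep_nontriv (ρ : G →* Module.End ℂ W) (h6 : Module.finrank ℂ W = 6)
    (hirr : ∀ V : Submodule ℂ W, (∀ g : G, ∀ v ∈ V, ρ g v ∈ V) → V = ⊥ ∨ V = ⊤) :
    ∃ g, ρ g ≠ 1 := by
  by_contra! hcon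
  have : Nontrivial W := Module.nontrivial_of_finrank_pos (R := ℂ) (by rw [h6]; norm_num)
  obtain ⟨x, hx⟩ := exists_ne (0 : W)
  rcases hirr (ℂ ∙ x) (by intro g v hv; rw [hcon g]; exact hv) with h | h
  · exact hx (Submodule.span_singleton_eq_bot.1 h)
  · have h1 := finrank_span_singleton (K := ℂ) hx
    rw [h, finrank_top, h6] at h1
    norm_num at h1

/-- the representation on an invariant space of quadratic forms -/
noncomputable def repQ (ρ : G →* Module.End ℂ W) (Q : Submodule ℂ (QuadraticForm ℂ W))
    (hQ : ∀ g : G, ∀ q ∈ Q, q.comp (ρ g : W →ₗ[ℂ] W) ∈ Q) : G →* Module.End ℂ Q where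
  toFun g :=
    { toFun := fun q => ⟨q.1.comp (ρ g⁻¹), hQ _ _ q.2⟩
      map_add' := by intro q r; ext x; simp
      map_smul' := by intro a q; ext x; simp }
  map_one' := by ext q x; simp
  map_mul' := by intro g h; ext q x; simp

theorem repQ_apply (ρ : G →* Module.End ℂ W) (Q : Submodule ℂ (QuadraticForm ℂ W))
    (hQ : ∀ g : G, ∀ q ∈ Q, q.comp (ρ g : W →ₗ[ℂ] W) ∈ Q) (g : G) (q : Q) (x : W) :
    (repQ ρ Q hQ g q).1 (ρ g x) = q.1 x := by
  have : ρ g⁻¹ (ρ g x) = x := by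
    rw [← Module.End.mul_apply, ← map_mul]; simp
  change q.1 (ρ g⁻¹ (ρ g x)) = _
  rw [this]

theorem repQ_center (ρ : G →* Module.End ℂ W) (Q : Submodule ℂ (QuadraticForm ℂ W))
    (hQ : ∀ g : G, ∀ q ∈ Q, q.comp (ρ g : W →ₗ[ℂ] W) ∈ Q) (g : G) (a : ℂ) (ha : a ≠ 0)
    (h : ρ g = a • 1) : repQ ρ Q hQ g = (a⁻¹ ^ 2) • 1 := by
  ext q x
  have h1 := repQ_apply ρ Q hQ g q (a⁻¹ • x)
  rw [h] at h1
  simp [ha] at h1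
  rw [h1]
  simp [QuadraticMap.map_smul, pow_two]

end opers


section opers

variable {W : Type} [AddCommGroup W] [Module ℂ W] [FiniteDimensional ℂ W]

/-- vector with given coordinates -/
noncomputable def vec (b : Module.Basis (Fin 6) ℂ W) (y0 y1 y2 f0 f1 f2 : ℂ) : W :=
  y0 • b 0 + y1 • b 1 + y2 • b 2 + f0 • b 3 + f1 • b 4 + f2 • b 5

theorem expandQ (q : QuadraticForm ℂ W) (b : Module.Basis (Fin 6) ℂ W) (y0 y1 y2 f0 f1 f2 : ℂ) :
    q (vec b y0 y1 y2 f0 f1 f2) = y0 ^ 2 * q (b 0) + y1 ^ 2 * q (b 1) + y2 ^ 2 * q (b 2) +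
      f0 ^ 2 * q (b 3) + f1 ^ 2 * q (b 4) + f2 ^ 2 * q (b 5) +
      y0 * y1 * QuadraticMap.polar q (b 0) (b 1) + y0 * y2 * QuadraticMap.polar q (b 0) (b 2) +
      y1 * y2 * QuadraticMap.polar q (b 1) (b 2) +
      y0 * f0 * QuadraticMap.polar q (b 0) (b 3) + y1 * f0 * QuadraticMap.polar q (b 1) (b 3) +
      y2 * f0 * QuadraticMap.polar q (b 2) (b 3) +
      y0 * f1 * QuadraticMap.polar q (b 0) (b 4) + y1 * f1 * QuadraticMap.polar q (b 1) (b 4) +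
      y2 * f1 * QuadraticMap.polar q (b 2) (b 4) +
      y0 * f2 * QuadraticMap.polar q (b 0) (b 5) + y1 * f2 * QuadraticMap.polar q (b 1) (b 5) +
      y2 * f2 * QuadraticMap.polar q (b 2) (b 5) +
      f0 * f1 * QuadraticMap.polar q (b 3) (b 4) + f0 * f2 * QuadraticMap.polar q (b 3) (b 5) +
      f1 * f2 * QuadraticMap.polar q (b 4) (b 5) := by
  unfold vec
  have ma := QuadraticMap.map_add q
  rw [ma, ma, ma, ma, ma]
  simp only [QuadraticMap.polar_add_left, QuadraticMap.polar_smul_left,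
    QuadraticMap.polar_smul_right, QuadraticMap.map_smul, smul_eq_mul]
  ring

theorem killq {q : QuadraticForm ℂ W} {T : Module.End ℂ W} {μ α ξ : ℂ} {x : W}
    (h : ∀ x, μ * q (T x) = q x) (hx : T x = α • x) (hξ : ξ ≠ 1) (hk : μ * α * α = ξ) :
    q x = 0 := by
  have h1 := h x
  rw [hx, QuadraticMap.map_smul, smul_eq_mul] at h1
  have : (ξ - 1) * q x = 0 := by linear_combination h1 - q x * hk
  exact (mul_eq_zero.1 this).resolve_left (sub_ne_zero.2 hξ)

theorem killp {q : QuadraticForm ℂ W} {T : Module.End ℂ W} {μ α β ξ : ℂ} {x y : W}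
    (h : ∀ x, μ * q (T x) = q x) (hx : T x = α • x) (hy : T y = β • y) (hξ : ξ ≠ 1)
    (hk : μ * α * β = ξ) :
    QuadraticMap.polar q x y = 0 := by
  have h1 : μ * QuadraticMap.polar q (T x) (T y) = QuadraticMap.polar q x y := by
    simp only [QuadraticMap.polar, ← map_add]
    rw [mul_sub, mul_sub, h, h, h]
  rw [hx, hy, QuadraticMap.polar_smul_left, QuadraticMap.polar_smul_right, smul_eq_mul,
    smul_eq_mul] at h1
  have : (ξ - 1) * QuadraticMap.polar q x y = 0 := by
    linear_combination h1 - QuadraticMap.polar q x y * hk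
  exact (mul_eq_zero.1 this).resolve_left (sub_ne_zero.2 hξ)

theorem eq1 {T : Module.End ℂ W} {x : W} (h : T x = x) : T x = (1 : ℂ) • x := by rw [h, one_smul]
theorem eqm {T : Module.End ℂ W} {x : W} (h : T x = - x) : T x = (-1 : ℂ) • x := by
  rw [h, neg_one_smul]

theorem m1 : (-1 : ℂ) ≠ 1 := by norm_num

theorem Pre.shapeE {ω ζ : ℂ} {D : OD ω W} {b} (hb : Pre ζ D b) {q : QuadraticForm ℂ W}
    (hu : ∀ x, 1 * q (D.u x) = q x) (hv : ∀ x, 1 * q (D.v x) = q x) (y0 y1 y2 f0 f1 f2 : ℂ) :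
    q (vec b y0 y1 y2 f0 f1 f2) = y0 ^ 2 * q (b 0) + y1 ^ 2 * q (b 1) + y2 ^ 2 * q (b 2) +
      f0 ^ 2 * q (b 3) + f1 ^ 2 * q (b 4) + f2 ^ 2 * q (b 5) +
      y0 * y1 * QuadraticMap.polar q (b 0) (b 1) + y0 * y2 * QuadraticMap.polar q (b 0) (b 2) +
      y1 * y2 * QuadraticMap.polar q (b 1) (b 2) := by
  rw [expandQ, killp hv (eq1 hb.v0) (eqm hb.v3) m1 (by ring),
    killp hv (eq1 hb.v1) (eqm hb.v3) m1 (by ring), killp hv (eq1 hb.v2) (eqm hb.v3) m1 (by ring),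
    killp hu (eq1 hb.u0) (eqm hb.u4) m1 (by ring), killp hu (eq1 hb.u1) (eqm hb.u4) m1 (by ring),
    killp hu (eq1 hb.u2) (eqm hb.u4) m1 (by ring), killp hu (eq1 hb.u0) (eqm hb.u5) m1 (by ring),
    killp hu (eq1 hb.u1) (eqm hb.u5) m1 (by ring), killp hu (eq1 hb.u2) (eqm hb.u5) m1 (by ring),
    killp hu (eq1 hb.u3) (eqm hb.u4) m1 (by ring), killp hu (eq1 hb.u3) (eqm hb.u5) m1 (by ring),
    killp hv (eqm hb.v4) (eq1 hb.v5) m1 (by ring)]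
  ring

theorem Pre.shapeF {ω ζ : ℂ} {D : OD ω W} {b} (hb : Pre ζ D b) {q : QuadraticForm ℂ W}
    (hu : ∀ x, 1 * q (D.u x) = q x) (hv : ∀ x, (-1) * q (D.v x) = q x) (y0 y1 y2 f0 f1 f2 : ℂ) :
    q (vec b y0 y1 y2 f0 f1 f2) =
      y0 * f0 * QuadraticMap.polar q (b 0) (b 3) + y1 * f0 * QuadraticMap.polar q (b 1) (b 3) +
      y2 * f0 * QuadraticMap.polar q (b 2) (b 3) +
      f1 * f2 * QuadraticMap.polar q (b 4) (b 5) := by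
  rw [expandQ, killq hv (eq1 hb.v0) m1 (by ring), killq hv (eq1 hb.v1) m1 (by ring),
    killq hv (eq1 hb.v2) m1 (by ring), killq hv (eqm hb.v3) m1 (by ring),
    killq hv (eqm hb.v4) m1 (by ring), killq hv (eq1 hb.v5) m1 (by ring),
    killp hv (eq1 hb.v0) (eq1 hb.v1) m1 (by ring), killp hv (eq1 hb.v0) (eq1 hb.v2) m1 (by ring),
    killp hv (eq1 hb.v1) (eq1 hb.v2) m1 (by ring),
    killp hu (eq1 hb.u0) (eqm hb.u4) m1 (by ring), killp hu (eq1 hb.u1) (eqm hb.u4) m1 (by ring),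
    killp hu (eq1 hb.u2) (eqm hb.u4) m1 (by ring), killp hu (eq1 hb.u0) (eqm hb.u5) m1 (by ring),
    killp hu (eq1 hb.u1) (eqm hb.u5) m1 (by ring), killp hu (eq1 hb.u2) (eqm hb.u5) m1 (by ring),
    killp hu (eq1 hb.u3) (eqm hb.u4) m1 (by ring), killp hu (eq1 hb.u3) (eqm hb.u5) m1 (by ring)]
  ring

theorem SM.svec {ω : ℂ} {D : OD ω W} {b} {p00 p01 p02 p10 p11 p12 p20 p21 p22 : ℂ}
    (h : SM D b p00 p01 p02 p10 p11 p12 p20 p21 p22) (hP : D.s (b 4 + b 5) = (1 : ℂ) • (b 4 + b 5))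
    (y0 y1 y2 f0 f1 f2 : ℂ) : D.s (vec b y0 y1 y2 f0 f1 f2) =
      vec b (p00 * y0 + p10 / 2 * (y1 + y2) + p20 * f0)
        (p01 * y0 + p11 / 2 * (y1 + y2) + p21 * f0 + (f1 - f2) / 2)
        (p01 * y0 + p11 / 2 * (y1 + y2) + p21 * f0 - (f1 - f2) / 2)
        (p02 * y0 + p12 / 2 * (y1 + y2) + p22 * f0)
        ((f1 + f2) / 2 + (y1 - y2) / 2) ((f1 + f2) / 2 - (y1 - y2) / 2) := by
  simp only [vec, map_add, map_smul, h.s0, h.s1, h.s2, h.s3, h.s4 hP, h.s5 hP]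
  module

theorem algN (n y0 y1 y2 f0 f1 f2 : ℂ) (hn : n ^ 2 = -1 / 12)
    (e0 : 5 * y0 ^ 2 + 4 * (y1 * y2) - 3 * f0 ^ 2 = 0)
    (e1 : 5 * y1 ^ 2 + 4 * (y2 * y0) - 3 * f1 ^ 2 = 0)
    (e2 : 5 * y2 ^ 2 + 4 * (y0 * y1) - 3 * f2 ^ 2 = 0)
    (g0 : y0 * f0 - 4 * n * (f1 * f2) = 0)
    (g1 : y1 * f1 - 4 * n * (f2 * f0) = 0)
    (g2 : y2 * f2 - 4 * n * (f0 * f1) = 0) :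
    y0 = 0 ∧ y1 = 0 ∧ y2 = 0 ∧ f0 = 0 ∧ f1 = 0 ∧ f2 = 0 := by
  have hn0 : n ≠ 0 := by rintro rfl; norm_num at hn
  -- two of the f vanish => all do
  have key2 : ∀ y0 y1 y2 f2 : ℂ, 5 * y0 ^ 2 + 4 * (y1 * y2) = 0 →
      5 * y2 ^ 2 + 4 * (y0 * y1) - 3 * f2 ^ 2 = 0 → y2 * f2 = 0 → f2 = 0 := by
    intro y0 y1 y2 f2 h0 h2 h
    by_contra hf
    have hy : y2 = 0 := (mul_eq_zero.1 h).resolve_right hf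
    subst hy
    have : y0 = 0 := by
      have : y0 ^ 2 = 0 := by linear_combination h0 / 5
      exact pow_eq_zero_iff (two_ne_zero) |>.1 this
    subst this
    apply hf
    have : f2 ^ 2 = 0 := by linear_combination -h2 / 3
    exact pow_eq_zero_iff (two_ne_zero) |>.1 this
  have key1 : ∀ y0 y1 y2 f0 f1 f2 : ℂ, 5 * y0 ^ 2 + 4 * (y1 * y2) - 3 * f0 ^ 2 = 0 →
      5 * y1 ^ 2 + 4 * (y2 * y0) - 3 * f1 ^ 2 = 0 →
      5 * y2 ^ 2 + 4 * (y0 * y1) - 3 * f2 ^ 2 = 0 → y0 * f0 - 4 * n * (f1 * f2) = 0 →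
      y1 * f1 - 4 * n * (f2 * f0) = 0 → y2 * f2 - 4 * n * (f0 * f1) = 0 → f0 = 0 →
      f0 = 0 ∧ f1 = 0 ∧ f2 = 0 := by
    intro y0 y1 y2 f0 f1 f2 e0 e1 e2 g0 g1 g2 h
    subst h
    have h12 : n * (f1 * f2) = 0 := by linear_combination -g0 / 4
    have h12 := (mul_eq_zero.1 h12).resolve_left hn0
    have a1 : f1 = 0 := key2 y0 y2 y1 f1 (by linear_combination e0) (by linear_combination e1)
      (by linear_combination g1)
    have a2 : f2 = 0 := key2 y0 y1 y2 f2 (by linear_combination e0) (by linear_combination e2)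
      (by linear_combination g2)
    exact ⟨rfl, a1, a2⟩
  have hf : f0 = 0 ∧ f1 = 0 ∧ f2 = 0 := by
    by_cases z0 : f0 = 0
    · exact key1 y0 y1 y2 f0 f1 f2 e0 e1 e2 g0 g1 g2 z0
    by_cases z1 : f1 = 0
    · obtain ⟨a, b, c⟩ := key1 y1 y2 y0 f1 f2 f0 e1 e2 e0 g1 g2 g0 z1
      exact ⟨c, a, b⟩
    by_cases z2 : f2 = 0
    · obtain ⟨a, b, c⟩ := key1 y2 y0 y1 f2 f0 f1 e2 e0 e1 g2 g0 g1 z2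
      exact ⟨b, c, a⟩
    exfalso
    have key3 : ∀ y0 y1 y2 f0 f1 f2 : ℂ, f0 ≠ 0 → f1 ≠ 0 → f2 ≠ 0 →
        5 * y0 ^ 2 + 4 * (y1 * y2) - 3 * f0 ^ 2 = 0 → y0 * f0 - 4 * n * (f1 * f2) = 0 →
        y1 * f1 - 4 * n * (f2 * f0) = 0 → y2 * f2 - 4 * n * (f0 * f1) = 0 →
        5 * f0 ^ 4 = -4 * (f1 ^ 2 * f2 ^ 2) := by
      intro y0 y1 y2 f0 f1 f2 z0 z1 z2 e0 g0 g1 g2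
      have h : y1 * y2 = -4 / 3 * f0 ^ 2 := by
        apply mul_right_cancel₀ (mul_ne_zero z1 z2)
        linear_combination y2 * f2 * g1 + 4 * n * (f2 * f0) * g2 + 16 * f0 ^ 2 * f1 * f2 * hn
      linear_combination (-3 / 5) * f0 ^ 2 * e0 + (12 / 5) * f0 ^ 2 * h +
        3 * (y0 * f0 + 4 * n * (f1 * f2)) * g0 + 48 * (f1 * f2) ^ 2 * hn
    have k0 := key3 y0 y1 y2 f0 f1 f2 z0 z1 z2 e0 g0 g1 g2
    have k1 := key3 y1 y2 y0 f1 f2 f0 z1 z2 z0 e1 g1 g2 g0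
    have k2 := key3 y2 y0 y1 f2 f0 f1 z2 z0 z1 e2 g2 g0 g1
    have hp : (f0 * f1 * f2) ^ 4 = 0 := by
      linear_combination (25 * f1 ^ 4 * f2 ^ 4 * k0 - 20 * f1 ^ 2 * f2 ^ 2 * f2 ^ 4 * k1 +
        16 * (f1 ^ 2 * f2 ^ 2) * (f2 ^ 2 * f0 ^ 2) * k2) / 189
    have := pow_eq_zero_iff (four_ne_zero) |>.1 hp
    exact mul_ne_zero (mul_ne_zero z0 z1) z2 this
  obtain ⟨rfl, rfl, rfl⟩ := hf
  have hp : (y0 * y1 * y2) ^ 3 = 0 := by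
    linear_combination (25 * y1 ^ 3 * y2 ^ 3 * y0 * e0 - 20 * y0 * y1 * y2 * y2 ^ 3 * y1 * e1 +
        16 * (y0 * y1 * y2) ^ 2 * y2 * e2) / 189
  have hp := pow_eq_zero_iff (three_ne_zero) |>.1 hp
  have c0 : y0 ^ 3 = 0 := by linear_combination (y0 * e0 - 4 * hp) / 5
  have c1 : y1 ^ 3 = 0 := by linear_combination (y1 * e1 - 4 * hp) / 5
  have c2 : y2 ^ 3 = 0 := by linear_combination (y2 * e2 - 4 * hp) / 5
  exact ⟨pow_eq_zero_iff (three_ne_zero) |>.1 c0, pow_eq_zero_iff (three_ne_zero) |>.1 c1,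
    pow_eq_zero_iff (three_ne_zero) |>.1 c2, rfl, rfl, rfl⟩

theorem algT (n y0 y1 y2 f0 f1 f2 : ℂ) (hn : n ^ 2 = -3 / 4)
    (e0 : 7 / 18 * y0 ^ 2 + 4 * (y1 * y2) + 3 / 2 * (f0 ^ 2 + f1 ^ 2 + f2 ^ 2) = 0)
    (e1 : 3 * y1 ^ 2 + 4 * (y0 * y2) = 0)
    (e2 : 3 * y2 ^ 2 + 4 * (y0 * y1) = 0)
    (g0 : y0 * f0 + 2 * n * (f1 * f2) = 0)
    (g1 : y0 * f1 + 2 * n * (f2 * f0) = 0)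
    (g2 : y0 * f2 + 2 * n * (f0 * f1) = 0) :
    y0 = 0 ∧ y1 = 0 ∧ y2 = 0 ∧ f0 = 0 ∧ f1 = 0 ∧ f2 = 0 := by
  have hn0 : n ≠ 0 := by rintro rfl; norm_num at hn
  have sq0 : ∀ x : ℂ, x ^ 2 = 0 → x = 0 := fun x h => pow_eq_zero_iff (two_ne_zero) |>.1 h
  by_cases z : y0 = 0
  · subst z
    have a1 : y1 = 0 := sq0 _ (by linear_combination e1 / 3)
    have a2 : y2 = 0 := sq0 _ (by linear_combination e2 / 3)
    subst a1 a2
    have h0 : f1 * f2 = 0 := (mul_eq_zero.1 (show n * (f1 * f2) = 0 by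
      linear_combination g0 / 2)).resolve_left hn0
    have h1 : f2 * f0 = 0 := (mul_eq_zero.1 (show n * (f2 * f0) = 0 by
      linear_combination g1 / 2)).resolve_left hn0
    have h2 : f0 * f1 = 0 := (mul_eq_zero.1 (show n * (f0 * f1) = 0 by
      linear_combination g2 / 2)).resolve_left hn0
    have hs : f0 + f1 + f2 = 0 := sq0 _ (by
      linear_combination (2 / 3) * e0 + 2 * h0 + 2 * h1 + 2 * h2)
    refine ⟨rfl, rfl, rfl, sq0 _ ?_, sq0 _ ?_, sq0 _ ?_⟩
    · linear_combination f0 * hs - h1 - h2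
    · linear_combination f1 * hs - h0 - h2
    · linear_combination f2 * hs - h0 - h1
  · exfalso
    have hk : y1 * y2 * (9 * (y1 * y2) - 16 * y0 ^ 2) = 0 := by
      linear_combination 3 * y2 ^ 2 * e1 - 4 * y0 * y2 * e2
    have hf : f0 ^ 2 + f1 ^ 2 + f2 ^ 2 = 0 ∨ f0 ^ 2 + f1 ^ 2 + f2 ^ 2 = - y0 ^ 2 := by
      have k0 : (f1 * f2) * (y0 ^ 2 + 3 * f0 ^ 2) = 0 := by
        linear_combination y0 * f2 * g1 - 2 * n * (f2 * f0) * g2 + 4 * f0 ^ 2 * f1 * f2 * hn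
      have k1 : (f2 * f0) * (y0 ^ 2 + 3 * f1 ^ 2) = 0 := by
        linear_combination y0 * f0 * g2 - 2 * n * (f0 * f1) * g0 + 4 * f1 ^ 2 * f2 * f0 * hn
      have k2 : (f0 * f1) * (y0 ^ 2 + 3 * f2 ^ 2) = 0 := by
        linear_combination y0 * f1 * g0 - 2 * n * (f1 * f2) * g1 + 4 * f2 ^ 2 * f0 * f1 * hn
      by_cases z0 : f0 = 0
      · subst z0
        left
        have a1 : f1 = 0 := (mul_eq_zero.1 (show y0 * f1 = 0 by linear_combination g1)).resolve_left z
        have a2 : f2 = 0 := (mul_eq_zero.1 (show y0 * f2 = 0 by linear_combination g2)).resolve_left z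
        subst a1 a2
        ring
      · have z1 : f1 ≠ 0 := by
          rintro rfl
          exact z0 ((mul_eq_zero.1 (show y0 * f0 = 0 by linear_combination g0)).resolve_left z)
        have z2 : f2 ≠ 0 := by
          rintro rfl
          exact z0 ((mul_eq_zero.1 (show y0 * f0 = 0 by linear_combination g0)).resolve_left z)
        right
        have k0 := (mul_eq_zero.1 k0).resolve_left (mul_ne_zero z1 z2)
        have k1 := (mul_eq_zero.1 k1).resolve_left (mul_ne_zero z2 z0)
        have k2 := (mul_eq_zero.1 k2).resolve_left (mul_ne_zero z0 z1)
        linear_combination (k0 + k1 + k2) / 3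
    apply z
    apply sq0
    rcases mul_eq_zero.1 hk with h | h <;> rcases hf with h' | h'
    · linear_combination (18 / 7) * (e0 - 4 * h - 3 / 2 * h')
    · linear_combination (-18 / 20) * (e0 - 4 * h - 3 / 2 * h')
    · linear_combination (18 / 135) * (e0 - 4 / 9 * h - 3 / 2 * h')
    · linear_combination (18 / 108) * (e0 - 4 / 9 * h - 3 / 2 * h')

end opers


section opers

variable {W : Type} [AddCommGroup W] [Module ℂ W] [FiniteDimensional ℂ W]

/-- compatibility of operators on vectors and on forms -/
structure Compat {ω : ℂ} (D : OD ω W) {Q : Submodule ℂ (QuadraticForm ℂ W)} (D' : OD ω Q) : Prop where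
  ku : ∀ (q : Q) x, (D'.u q).1 (D.u x) = q.1 x
  kv : ∀ (q : Q) x, (D'.v q).1 (D.v x) = q.1 x
  kt : ∀ (q : Q) x, (D'.t q).1 (D.t x) = q.1 x
  ks : ∀ (q : Q) x, (D'.s q).1 (D.s x) = q.1 x
  kA : ∀ (q : Q) x, (D'.A q).1 (D.A x) = q.1 x
  kB : ∀ (q : Q) x, (D'.B q).1 (D.B x) = q.1 x

theorem inv1 {Q : Submodule ℂ (QuadraticForm ℂ W)} {T : Module.End ℂ W} {T' : Module.End ℂ Q}
    (h : ∀ (q : Q) x, (T' q).1 (T x) = q.1 x) {q : Q} (hq : T' q = q) (x : W) :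
    1 * q.1 (T x) = q.1 x := by
  have := h q x
  rw [hq] at this
  rw [this, one_mul]

theorem invm {Q : Submodule ℂ (QuadraticForm ℂ W)} {T : Module.End ℂ W} {T' : Module.End ℂ Q}
    (h : ∀ (q : Q) x, (T' q).1 (T x) = q.1 x) {q : Q} (hq : T' q = - q) (x : W) :
    (-1) * q.1 (T x) = q.1 x := by
  have := h q x
  rw [hq] at this
  rw [← this]; simp

theorem invs {Q : Submodule ℂ (QuadraticForm ℂ W)} {T : Module.End ℂ W} {T' : Module.End ℂ Q}
    (h : ∀ (q : Q) x, (T' q).1 (T x) = q.1 x) {q : Q} {a : ℂ} (hq : T' q = a • q) (x : W) :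
    a * q.1 (T x) = q.1 x := by
  have := h q x
  rw [hq] at this
  rw [← this]; simp

theorem invq {Q : Submodule ℂ (QuadraticForm ℂ W)} {T : Module.End ℂ W} {T' : Module.End ℂ Q}
    (h : ∀ (q : Q) x, (T' q).1 (T x) = q.1 x) {q r : Q} (hq : T' q = r) {x y : W} (hx : T x = y) :
    r.1 y = q.1 x := by
  rw [← hq, ← hx, h]

theorem form_zero {q : QuadraticForm ℂ W} (b : Module.Basis (Fin 6) ℂ W)
    (h : ∀ y0 y1 y2 f0 f1 f2, q (vec b y0 y1 y2 f0 f1 f2) = 0) : q = 0 := by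
  ext x
  obtain ⟨y0, y1, y2, w0, w1, w2, hx⟩ := expand6 b x
  rw [hx]; exact h y0 y1 y2 w0 w1 w2

theorem zpow {ζ : ℂ} (hζ : ζ ^ 2 + ζ + 1 = 0) : ζ ≠ 1 ∧ ζ ^ 2 ≠ 1 ∧ ζ ^ 3 = 1 := by
  have h3 : ζ ^ 3 = 1 := by linear_combination (ζ - 1) * hζ
  have h1 : ζ ≠ 1 := by rintro rfl; norm_num at hζ
  refine ⟨h1, ?_, h3⟩
  intro h
  apply h1
  linear_combination h3 - ζ * h

theorem mainN {ζ : ℂ} (hζ : ζ ^ 2 + ζ + 1 = 0) (D : OD ζ W)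
    (Q : Submodule ℂ (QuadraticForm ℂ W)) (D' : OD ζ Q) (K : Compat D D') (x : W)
    (hx : ∀ q ∈ Q, q x = 0) : x = 0 := by
  have : FiniteDimensional ℂ Q := FiniteDimensional.of_finrank_pos (by rw [D'.h6]; norm_num)
  obtain ⟨z1, z2, z3⟩ := zpow hζ
  obtain ⟨b, m, n, hb, hN, hS, hP, hmn⟩ := finalN hζ D
  obtain ⟨E, m', n', hE, hNE, hSE, hPE, hmn'⟩ := finalN hζ D'
  -- shape of the forms
  have hB0 := inv1 K.kB hE.B0
  have sE0 : ∀ y0 y1 y2 f0 f1 f2, (E 0).1 (vec b y0 y1 y2 f0 f1 f2) =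
      (E 0).1 (b 0) * y0 ^ 2 + QuadraticMap.polar (E 0).1 (b 1) (b 2) * (y1 * y2) +
        (E 0).1 (b 3) * f0 ^ 2 := by
    intro y0 y1 y2 f0 f1 f2
    rw [hb.shapeE (inv1 K.ku hE.u0) (inv1 K.kv hE.v0)]
    rw [killq hB0 hb.B1 z2 (by ring), killq hB0 hb.B2 z1 (by linear_combination ζ * z3),
      killq hB0 hN.B4 z2 (by ring), killq hB0 hN.B5 z1 (by linear_combination ζ * z3),
      killp hB0 (eq1 hb.B0) hb.B1 z1 (by ring), killp hB0 (eq1 hb.B0) hb.B2 z2 (by ring)]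
    ring
  have hB3 := inv1 K.kB hNE.B3
  have sF0 : ∀ y0 y1 y2 f0 f1 f2, (E 3).1 (vec b y0 y1 y2 f0 f1 f2) =
      QuadraticMap.polar (E 3).1 (b 0) (b 3) * (y0 * f0) +
        QuadraticMap.polar (E 3).1 (b 4) (b 5) * (f1 * f2) := by
    intro y0 y1 y2 f0 f1 f2
    rw [hb.shapeF (inv1 K.ku hE.u3) (invm K.kv hE.v3)]
    rw [killp hB3 hb.B1 (eq1 hN.B3) z1 (by ring), killp hB3 hb.B2 (eq1 hN.B3) z2 (by ring)]
    ring
  generalize (E 0).1 (b 0) = a at sE0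
  generalize QuadraticMap.polar (E 0).1 (b 1) (b 2) = β at sE0
  generalize (E 0).1 (b 3) = c at sE0
  generalize QuadraticMap.polar (E 3).1 (b 0) (b 3) = d at sF0
  generalize QuadraticMap.polar (E 3).1 (b 4) (b 5) = e at sF0
  have hA : ∀ y0 y1 y2 f0 f1 f2, D.A (vec b y0 y1 y2 f0 f1 f2) = vec b y2 y0 y1 f2 f0 f1 := by
    intro y0 y1 y2 f0 f1 f2
    simp only [vec, map_add, map_smul, hN.A0, hN.A1, hN.A2, hb.A3, hb.A4, hb.A5]
    abel
  have sE1 : ∀ y0 y1 y2 f0 f1 f2, (E 1).1 (vec b y0 y1 y2 f0 f1 f2) =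
      a * y1 ^ 2 + β * (y2 * y0) + c * f1 ^ 2 := by
    intro y0 y1 y2 f0 f1 f2
    rw [invq K.kA hNE.A0 (hA y1 y2 y0 f1 f2 f0), sE0]
  have sE2 : ∀ y0 y1 y2 f0 f1 f2, (E 2).1 (vec b y0 y1 y2 f0 f1 f2) =
      a * y2 ^ 2 + β * (y0 * y1) + c * f2 ^ 2 := by
    intro y0 y1 y2 f0 f1 f2
    rw [invq K.kA hNE.A1 (hA y1 y2 y0 f1 f2 f0), sE1]
  have sF1 : ∀ y0 y1 y2 f0 f1 f2, (E 4).1 (vec b y0 y1 y2 f0 f1 f2) =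
      d * (y1 * f1) + e * (f2 * f0) := by
    intro y0 y1 y2 f0 f1 f2
    rw [invq K.kA hE.A3 (hA y1 y2 y0 f1 f2 f0), sF0]
  have sF2 : ∀ y0 y1 y2 f0 f1 f2, (E 5).1 (vec b y0 y1 y2 f0 f1 f2) =
      d * (y2 * f2) + e * (f0 * f1) := by
    intro y0 y1 y2 f0 f1 f2
    rw [invq K.kA hE.A4 (hA y1 y2 y0 f1 f2 f0), sF1]
  -- first relation
  have R1 : ∀ y0 y1 y2 f0 f1 f2, (E 4 - E 5).1 (D.s (vec b y0 y1 y2 f0 f1 f2)) =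
      (E 1 - E 2).1 (vec b y0 y1 y2 f0 f1 f2) := fun _ _ _ _ _ _ => invq K.ks hSE.sD rfl
  have R2 := invq K.ks hSE.s0 (D.pss (vec b 1 0 0 0 0 0))
  simp only [hS.svec hP, Submodule.coe_sub, QuadraticMap.sub_apply, sE1, sE2, sF1, sF2] at R1
  simp only [hS.svec hP, Submodule.coe_add, Submodule.coe_smul, QuadraticMap.add_apply, QuadraticMap.smul_apply,
    sE0, sE1, sE2, sF0, smul_eq_mul] at R2
  have r1 := R1 0 0 0 0 1 0
  have r2 := R1 1 1 0 0 0 0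
  have r3 := R1 0 1 0 0 0 0
  have r4 := R1 0 1 0 1 0 0
  ring_nf at r1 r2 r3 r4 R2
  have he : e = -4 * n * d := by linear_combination 2 * r3 - 2 * r4
  have hem : e * m = - d / 3 := by rw [he]; linear_combination -4 * d * hmn
  have ha : a = -5 / 6 * d := by linear_combination -r3 + 2 * hem
  have hβ : β = -2 / 3 * d := by linear_combination r2 - r3 + hem
  have hd : d ≠ 0 := by
    intro h
    have hz : (E 0).1 = 0 := form_zero b (by
      intro y0 y1 y2 f0 f1 f2
      rw [sE0, ha, hβ, ← r1, h]; ring)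
    exact E.ne_zero 0 (Subtype.ext hz)
  have hm : m ^ 2 = -1 / 12 := by
    apply mul_left_cancel₀ hd
    linear_combination -2 * R2 + 2 * m ^ 2 * r1 + (5 / 18) * ha - 2 / 9 * hβ
  have hn : n ^ 2 = -1 / 12 := by
    linear_combination 12 * n ^ 2 * hm - 12 * (m * n + 1 / 12) * hmn
  obtain ⟨y0, y1, y2, f0, f1, f2, hx'⟩ := expand6 b x
  have hx2 : x = vec b y0 y1 y2 f0 f1 f2 := hx'
  have H : ∀ i, (E i).1 (vec b y0 y1 y2 f0 f1 f2) = 0 := by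
    intro i; rw [← hx2]; exact hx _ (E i).2
  have g0 := H 0
  have g1 := H 1
  have g2 := H 2
  have g3 := H 3
  have g4 := H 4
  have g5 := H 5
  rw [sE0] at g0
  rw [sE1] at g1
  rw [sE2] at g2
  rw [sF0] at g3
  rw [sF1] at g4
  rw [sF2] at g5
  rw [ha, hβ, ← r1] at g0 g1 g2
  rw [he] at g3 g4 g5
  obtain ⟨c0, c1, c2, c3, c4, c5⟩ := algN n y0 y1 y2 f0 f1 f2 hn
    (mul_left_cancel₀ hd (by linear_combination -6 * g0))
    (mul_left_cancel₀ hd (by linear_combination -6 * g1))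
    (mul_left_cancel₀ hd (by linear_combination -6 * g2))
    (mul_left_cancel₀ hd (by linear_combination g3))
    (mul_left_cancel₀ hd (by linear_combination g4))
    (mul_left_cancel₀ hd (by linear_combination g5))
  rw [hx2, c0, c1, c2, c3, c4, c5]
  simp [vec]

end opers


section opers

variable {W : Type} [AddCommGroup W] [Module ℂ W] [FiniteDimensional ℂ W]

theorem Pre.shapeT {ζ : ℂ} (hζ : ζ ^ 2 + ζ + 1 = 0) {D : OD 1 W} {b} (hb : Pre ζ D b)
    (hT : CaseT D b) {q : QuadraticForm ℂ W}
    (hu : ∀ x, 1 * q (D.u x) = q x) (hv : ∀ x, 1 * q (D.v x) = q x)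
    (hA : ∀ x, 1 * q (D.A x) = q x) (hB : ∀ x, 1 * q (D.B x) = q x) (y0 y1 y2 f0 f1 f2 : ℂ) :
    q (vec b y0 y1 y2 f0 f1 f2) = q (b 0) * y0 ^ 2 + QuadraticMap.polar q (b 1) (b 2) * (y1 * y2) +
      q (b 3) * (f0 ^ 2 + f1 ^ 2 + f2 ^ 2) := by
  obtain ⟨z1, z2, z3⟩ := zpow hζ
  have h4 := hA (b 3)
  have h5 := hA (b 4)
  rw [hb.A3, one_mul] at h4
  rw [hb.A4, one_mul] at h5
  rw [hb.shapeE hu hv, h5, h4]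
  rw [killq hB hb.B1 z2 (by ring), killq hB hb.B2 z1 (by linear_combination ζ * z3),
    killp hB (eq1 hb.B0) hb.B1 z1 (by ring), killp hB (eq1 hb.B0) hb.B2 z2 (by ring)]
  ring

theorem mainT {ζ : ℂ} (hζ : ζ ^ 2 + ζ + 1 = 0) (D : OD 1 W)
    (Q : Submodule ℂ (QuadraticForm ℂ W)) (D' : OD 1 Q) (K : Compat D D') (x : W)
    (hx : ∀ q ∈ Q, q x = 0) : x = 0 := by
  have : FiniteDimensional ℂ Q := FiniteDimensional.of_finrank_pos (by rw [D'.h6]; norm_num)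
  obtain ⟨z1, z2, z3⟩ := zpow hζ
  obtain ⟨b, m, n, hb, hT, hS, hP, hmn⟩ := finalT hζ D
  obtain ⟨E, m', n', hE, hTE, hSE, hPE, hmn'⟩ := finalT hζ D'
  have sE0 := hb.shapeT hζ hT (inv1 K.ku hE.u0) (inv1 K.kv hE.v0) (inv1 K.kA hTE.A0)
    (inv1 K.kB hE.B0)
  have hB1 := invs K.kB hE.B1
  have sE1 : ∀ y0 y1 y2 f0 f1 f2, (E 1).1 (vec b y0 y1 y2 f0 f1 f2) =
      (E 1).1 (b 1) * y1 ^ 2 + QuadraticMap.polar (E 1).1 (b 0) (b 2) * (y0 * y2) := by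
    intro y0 y1 y2 f0 f1 f2
    rw [hb.shapeE (inv1 K.ku hE.u1) (inv1 K.kv hE.v1)]
    rw [killq hB1 (eq1 hb.B0) z1 (by ring), killq hB1 hb.B2 z2 (by linear_combination ζ ^ 2 * z3),
      killq hB1 (eq1 hT.B3) z1 (by ring), killq hB1 (eq1 hT.B4) z1 (by ring),
      killq hB1 (eq1 hT.B5) z1 (by ring),
      killp hB1 (eq1 hb.B0) hb.B1 z2 (by ring),
      killp hB1 hb.B1 hb.B2 z1 (by linear_combination ζ * z3)]
    ring
  have hB3 := inv1 K.kB hTE.B3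
  have sF0 : ∀ y0 y1 y2 f0 f1 f2, (E 3).1 (vec b y0 y1 y2 f0 f1 f2) =
      QuadraticMap.polar (E 3).1 (b 0) (b 3) * (y0 * f0) +
        QuadraticMap.polar (E 3).1 (b 4) (b 5) * (f1 * f2) := by
    intro y0 y1 y2 f0 f1 f2
    rw [hb.shapeF (inv1 K.ku hE.u3) (invm K.kv hE.v3)]
    rw [killp hB3 hb.B1 (eq1 hT.B3) z1 (by ring), killp hB3 hb.B2 (eq1 hT.B3) z2 (by ring)]
    ring
  generalize (E 0).1 (b 0) = a at sE0
  generalize QuadraticMap.polar (E 0).1 (b 1) (b 2) = β at sE0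
  generalize (E 0).1 (b 3) = c at sE0
  generalize (E 1).1 (b 1) = a2 at sE1
  generalize QuadraticMap.polar (E 1).1 (b 0) (b 2) = b2 at sE1
  generalize QuadraticMap.polar (E 3).1 (b 0) (b 3) = d at sF0
  generalize QuadraticMap.polar (E 3).1 (b 4) (b 5) = e at sF0
  have hA : ∀ y0 y1 y2 f0 f1 f2, D.A (vec b y0 y1 y2 f0 f1 f2) = vec b y0 y1 y2 f2 f0 f1 := by
    intro y0 y1 y2 f0 f1 f2
    simp only [vec, map_add, map_smul, hT.A0, hT.A1, hT.A2, hb.A3, hb.A4, hb.A5]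
    abel
  have ht : ∀ y0 y1 y2 f0 f1 f2, D.t (vec b y0 y1 y2 f0 f1 f2) = vec b y0 y2 y1 f0 f2 f1 := by
    intro y0 y1 y2 f0 f1 f2
    simp only [vec, map_add, map_smul, hb.t0, hb.t1, hb.t2, hb.t3, hb.t4, hb.t5]
    abel
  have sE2 : ∀ y0 y1 y2 f0 f1 f2, (E 2).1 (vec b y0 y1 y2 f0 f1 f2) =
      a2 * y2 ^ 2 + b2 * (y0 * y1) := by
    intro y0 y1 y2 f0 f1 f2
    rw [invq K.kt hE.t1 (ht y0 y2 y1 f0 f2 f1), sE1]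
  have sF1 : ∀ y0 y1 y2 f0 f1 f2, (E 4).1 (vec b y0 y1 y2 f0 f1 f2) =
      d * (y0 * f1) + e * (f2 * f0) := by
    intro y0 y1 y2 f0 f1 f2
    rw [invq K.kA hE.A3 (hA y0 y1 y2 f1 f2 f0), sF0]
  have sF2 : ∀ y0 y1 y2 f0 f1 f2, (E 5).1 (vec b y0 y1 y2 f0 f1 f2) =
      d * (y0 * f2) + e * (f0 * f1) := by
    intro y0 y1 y2 f0 f1 f2
    rw [invq K.kA hE.A4 (hA y0 y1 y2 f1 f2 f0), sF1]
  have R1 : ∀ y0 y1 y2 f0 f1 f2, (E 4 - E 5).1 (D.s (vec b y0 y1 y2 f0 f1 f2)) =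
      (E 1 - E 2).1 (vec b y0 y1 y2 f0 f1 f2) := fun _ _ _ _ _ _ => invq K.ks hSE.sD rfl
  have R2 : ∀ y0 y1 y2 f0 f1 f2, _ = (E 1 + E 2).1 (D.s (vec b y0 y1 y2 f0 f1 f2)) :=
    fun y0 y1 y2 f0 f1 f2 => invq K.ks hSE.sY (D.pss (vec b y0 y1 y2 f0 f1 f2))
  simp only [hS.svec hP, Submodule.coe_sub, QuadraticMap.sub_apply, sE1, sE2, sF1, sF2] at R1
  simp only [hS.svec hP, Submodule.coe_add, Submodule.coe_smul, QuadraticMap.add_apply,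
    QuadraticMap.smul_apply, sE0, sE1, sE2, sF0, smul_eq_mul] at R2
  have r2 := R1 1 1 0 0 0 0
  have r3 := R1 0 1 0 0 0 0
  have r4 := R1 0 1 0 1 0 0
  have q1 := R2 0 0 0 0 1 0
  have q2 := R2 0 0 0 1 0 0
  have q3 := R2 0 1 1 0 0 0
  have q4 := R2 1 0 0 0 0 0
  ring_nf at r2 r3 r4 q1 q2 q3 q4
  have he : e = 2 * n * d := by linear_combination 2 * r3 - 2 * r4
  have hem : e * m = 7 / 6 * d := by rw [he]; linear_combination 2 * d * hmn
  have ha2 : a2 = d := by linear_combination -r3 + 3 / 7 * hem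
  have hb2 : b2 = 4 / 3 * d := by linear_combination r2 - r3 + hem
  rw [ha2] at q1
  rw [ha2, hb2] at q2 q3 q4
  have hβ : β = 4 / 3 * d := by linear_combination q3
  have ha : a = 7 / 54 * d := by linear_combination q4
  have hd : d ≠ 0 := by
    intro h
    have hz : (E 1).1 = 0 := form_zero b (by
      intro y0 y1 y2 f0 f1 f2
      rw [sE1, ha2, hb2, h]; ring)
    exact E.ne_zero 1 (Subtype.ext hz)
  have hn : n ^ 2 = -3 / 4 := by
    apply mul_left_cancel₀ hd
    linear_combination (3 / 2) * q2 - (3 / 2) * q1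
  obtain ⟨y0, y1, y2, f0, f1, f2, hx'⟩ := expand6 b x
  have hx2 : x = vec b y0 y1 y2 f0 f1 f2 := hx'
  have H : ∀ i, (E i).1 (vec b y0 y1 y2 f0 f1 f2) = 0 := by
    intro i; rw [← hx2]; exact hx _ (E i).2
  have g0 := H 0
  have g1 := H 1
  have g2 := H 2
  have g3 := H 3
  have g4 := H 4
  have g5 := H 5
  rw [sE0, ha, hβ, q1] at g0
  rw [sE1, ha2, hb2] at g1
  rw [sE2, ha2, hb2] at g2
  rw [sF0, he] at g3
  rw [sF1, he] at g4
  rw [sF2, he] at g5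
  obtain ⟨c0, c1, c2, c3, c4, c5⟩ := algT n y0 y1 y2 f0 f1 f2 hn
    (mul_left_cancel₀ hd (by linear_combination 3 * g0))
    (mul_left_cancel₀ hd (by linear_combination 3 * g1))
    (mul_left_cancel₀ hd (by linear_combination 3 * g2))
    (mul_left_cancel₀ hd (by linear_combination g3))
    (mul_left_cancel₀ hd (by linear_combination g4))
    (mul_left_cancel₀ hd (by linear_combination g5))
  rw [hx2, c0, c1, c2, c3, c4, c5]
  simp [vec]

theorem nontrivT {ζ : ℂ} (hζ : ζ ^ 2 + ζ + 1 = 0) (D : OD 1 W)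
    (Q : Submodule ℂ (QuadraticForm ℂ W)) (h6 : Module.finrank ℂ Q = 6)
    (hu : ∀ q ∈ Q, ∀ x, q (D.u x) = q x) (hv : ∀ q ∈ Q, ∀ x, q (D.v x) = q x)
    (hA : ∀ q ∈ Q, ∀ x, q (D.A x) = q x) (hB : ∀ q ∈ Q, ∀ x, q (D.B x) = q x) : False := by
  obtain ⟨b, m, n, hb, hT, -⟩ := finalT hζ D
  let L : Q →ₗ[ℂ] (Fin 3 → ℂ) :=
    { toFun := fun q => ![q.1 (b 0), QuadraticMap.polar q.1 (b 1) (b 2), q.1 (b 3)]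
      map_add' := by
        intro q r
        ext i
        fin_cases i <;> simp [QuadraticMap.polar]
        ring
      map_smul' := by
        intro k q
        ext i
        fin_cases i <;> simp [QuadraticMap.polar]
        ring }
  have hL : Function.Injective L := by
    rw [← LinearMap.ker_eq_bot, LinearMap.ker_eq_bot']
    intro q hq
    have h0 : q.1 (b 0) = 0 := congrFun hq 0
    have h1 : QuadraticMap.polar q.1 (b 1) (b 2) = 0 := congrFun hq 1
    have h2 : q.1 (b 3) = 0 := congrFun hq 2
    apply Subtype.ext
    apply form_zero b
    intro y0 y1 y2 f0 f1 f2
    rw [hb.shapeT hζ hT (fun x => by rw [hu _ q.2, one_mul]) (fun x => by rw [hv _ q.2, one_mul])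
      (fun x => by rw [hA _ q.2, one_mul]) (fun x => by rw [hB _ q.2, one_mul]), h0, h1, h2]
    ring
  have := LinearMap.finrank_le_finrank_of_injective hL
  rw [h6, Module.finrank_fin_fun] at this
  norm_num at this

theorem main_result (G : Type) [Group G] (hG : IsTripleCoverA7 G) (ρ : G →* Module.End ℂ W)
    (hdim : Module.finrank ℂ W = 6)
    (hirr : ∀ V : Submodule ℂ W, (∀ g : G, ∀ v ∈ V, ρ g v ∈ V) → V = ⊥ ∨ V = ⊤)
    (Q : Submodule ℂ (QuadraticForm ℂ W))
    (hQdim : Module.finrank ℂ Q = 6)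
    (hQsub : ∀ g : G, ∀ q ∈ Q, q.comp (ρ g : W →ₗ[ℂ] W) ∈ Q) (x : W)
    (hx : ∀ q ∈ Q, q x = 0) : x = 0 := by
  obtain ⟨d⟩ := exists_GD G hG
  have hc := rep_center ρ hdim hirr
  have hnt := rep_nontriv ρ hdim hirr
  have hW : Nontrivial W := Module.nontrivial_of_finrank_pos (R := ℂ) (by rw [hdim]; norm_num)
  have hQn : Nontrivial Q := Module.nontrivial_of_finrank_pos (R := ℂ) (by rw [hQdim]; norm_num)
  have hQf : FiniteDimensional ℂ Q := FiniteDimensional.of_finrank_pos (by rw [hQdim]; norm_num)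
  obtain ⟨ω, hω, hz⟩ := hc d.z d.hz
  have hcQ : ∀ y ∈ Subgroup.center G, ∃ a : ℂ, a ≠ 0 ∧ repQ ρ Q hQsub y = a • 1 := by
    intro y hy
    obtain ⟨a, ha, h⟩ := hc y hy
    exact ⟨_, pow_ne_zero 2 (inv_ne_zero ha), repQ_center ρ Q hQsub y a ha h⟩
  have hω3 : ω ^ 3 = 1 := by
    have h1 : ρ (d.z * d.z * d.z) = 1 := by rw [d.z3, map_one]
    obtain ⟨w, hw⟩ := exists_ne (0 : W)
    have h2 := LinearMap.congr_fun h1 w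
    rw [map_mul, map_mul, hz] at h2
    simp [smul_smul] at h2
    have h3 : (ω ^ 3) • w = (1 : ℂ) • w := by rw [one_smul, ← h2]; congr 1; ring
    exact smul_left_injective ℂ hw h3
  have hzQ : repQ ρ Q hQsub d.z = ω • 1 := by
    rw [repQ_center ρ Q hQsub d.z ω hω hz]
    congr 1
    field_simp
    exact hω3.symm
  by_cases h1 : ω = 1
  · subst h1
    obtain ⟨ζ, hζ⟩ : ∃ ζ : ℂ, ζ ^ 2 + ζ + 1 = 0 := by
      obtain ⟨r, hr⟩ := IsAlgClosed.exists_pow_nat_eq (-3 : ℂ) (n := 2) (by norm_num)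
      exact ⟨(-1 + r) / 2, by linear_combination hr / 4⟩
    have hntQ : ∃ g, repQ ρ Q hQsub g ≠ 1 := by
      by_contra! hcon
      have key : ∀ g, ∀ q ∈ Q, ∀ x, q (ρ g x) = q x := by
        intro g q hq x
        have := repQ_apply ρ Q hQsub g ⟨q, hq⟩ x
        rw [hcon g] at this
        exact this
      exact nontrivT hζ (odOf d ρ 1 hdim hz hc hnt) Q hQdim (key d.u) (key d.v) (key d.A) (key d.B)
    exact mainT hζ (odOf d ρ 1 hdim hz hc hnt) Q (odOf d (repQ ρ Q hQsub) 1 hQdim hzQ hcQ hntQ)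
      ⟨repQ_apply ρ Q hQsub d.u, repQ_apply ρ Q hQsub d.v, repQ_apply ρ Q hQsub d.t,
        repQ_apply ρ Q hQsub d.s, repQ_apply ρ Q hQsub d.A, repQ_apply ρ Q hQsub d.B⟩ x hx
  · have hζ : ω ^ 2 + ω + 1 = 0 := by
      have : (ω - 1) * (ω ^ 2 + ω + 1) = 0 := by linear_combination hω3
      exact (mul_eq_zero.1 this).resolve_left (sub_ne_zero.2 h1)
    have hntQ : ∃ g, repQ ρ Q hQsub g ≠ 1 := by
      refine ⟨d.z, ?_⟩
      intro h
      rw [hzQ] at h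
      obtain ⟨w, hw⟩ := exists_ne (0 : Q)
      have h2 : ω • w = (1 : ℂ) • w := by
        rw [one_smul]; exact LinearMap.congr_fun h w
      exact h1 (smul_left_injective ℂ hw h2)
    exact mainN hζ (odOf d ρ ω hdim hz hc hnt) Q (odOf d (repQ ρ Q hQsub) ω hQdim hzQ hcQ hntQ)
      ⟨repQ_apply ρ Q hQsub d.u, repQ_apply ρ Q hQsub d.v, repQ_apply ρ Q hQsub d.t,
        repQ_apply ρ Q hQsub d.s, repQ_apply ρ Q hQsub d.A, repQ_apply ρ Q hQsub d.B⟩ x hx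

end opers

end TripleA7

/-- Let `U` be an irreducible six-dimensional complex representation of the quasi-simple group
`3.A₇`, and let `Q ⊆ S²U∨` be a six-dimensional subrepresentation of the induced representation
on quadratic forms on `U` (with action `q ↦ q ∘ g⁻¹`).  Then the base locus of `Q` on `ℙ(U)` is
empty: for every nonzero `u ∈ U` there is a quadratic form `q ∈ Q` with `q(u) ≠ 0`. -/
theorem baseLocus_of_six_dim_quadrics_3A7
    (G : Type) [Group G] [Finite G] (hG : IsTripleCoverA7 G)
    (U : Type) [AddCommGroup U] [Module ℂ U] [FiniteDimensional ℂ U]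
    (ρ : Representation ℂ G U)
    (hdim : Module.finrank ℂ U = 6)
    (hirr : ∀ W : Submodule ℂ U, (∀ g : G, ∀ v ∈ W, ρ g v ∈ W) → W = ⊥ ∨ W = ⊤)
    (Q : Submodule ℂ (QuadraticForm ℂ U))
    (hQdim : Module.finrank ℂ Q = 6)
    (hQsub : ∀ g : G, ∀ q ∈ Q, q.comp (ρ g : U →ₗ[ℂ] U) ∈ Q) :
    ∀ u : U, u ≠ 0 → ∃ q ∈ Q, q u ≠ 0 := by
  intro u hu
  by_contra! hcon
  exact hu (TripleA7.main_result G hG ρ hdim hirr Q hQdim hQsub u hcon)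
end

section
/- Let G be isomorphic to one of the quasi-simple groups SL2(F5) (≅ 2.A5), SL2(F7), or 2.A6. Then every extension of G by a group of order 2 splits: if E is a finite group with a normal subgroup N of order 2 such that E/N ≅ G, then N is central in E and E ≅ (ℤ/2ℤ) × G. -/
/-- `G` is isomorphic to `2.A₆`: a perfect group whose center is cyclic of order `2` and whose
quotient by the center is the alternating group `A₆`.  Such a group is unique up to isomorphism
(it is isomorphic to `SL₂(F₉)`). -/
def IsDoubleCoverA6 (G : Type*) [Group G] : Prop :=
  commutator G = ⊤ ∧ IsCyclic (Subgroup.center G) ∧ Nat.card (Subgroup.center G) = 2 ∧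
    Nonempty (G ⧸ Subgroup.center G ≃* alternatingGroup (Fin 6))

theorem aux_gen {P : Type*} [Group P] (A B z w : P) (hgen : Subgroup.closure {A, B, z} = ⊤)
    (hz : ∀ g, g * z = z * g) (hz2 : z * z = 1) (hw : w = 1 ∨ w = z)
    (hBA : B * A * B⁻¹ = A⁻¹ * w) (hC : z ∉ Subgroup.zpowers (A * A * w)) :
    z ∉ commutator P := by
  have hwc : ∀ g, g * w = w * g := by
    rcases hw with rfl | rfl
    · simp
    · exact hz
  have hw2 : w * w = 1 := by
    rcases hw with rfl | rfl
    · simp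
    · exact hz2
  have hwi : w⁻¹ = w := inv_eq_of_mul_eq_one_left hw2
  set C := A * A * w with hCdef
  have hAC : A * C * A⁻¹ = C := by
    rw [hCdef, hwc (A * A), ← mul_assoc, hwc A]; group
  have hBC : B * C * B⁻¹ = C⁻¹ := by
    have : B * C * B⁻¹ = (B * A * B⁻¹) * (B * A * B⁻¹) * w := by
      rw [hCdef, hwc (A * A), hwc (B * A * B⁻¹ * (B * A * B⁻¹)), ← mul_assoc, hwc B]; group
    rw [this, hBA, hCdef]
    simp only [mul_inv_rev, hwi]
    calc A⁻¹ * w * (A⁻¹ * w) * w = A⁻¹ * (w * A⁻¹) * (w * w) := by group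
      _ = w * (A⁻¹ * A⁻¹) := by rw [hw2, ← hwc A⁻¹, ← hwc (A⁻¹ * A⁻¹)]; group
  have hzC : z * C * z⁻¹ = C := by rw [← hz]; group
  set K := Subgroup.zpowers C with hK
  have hAi : ∀ g, (g * C * g⁻¹ = C ∨ g * C * g⁻¹ = C⁻¹) → g ∈ Subgroup.normalizer (K : Set P) := by
    intro g hg
    have h1 : K.map (MulAut.conj g).toMonoidHom = K := by
      rw [hK, MonoidHom.map_zpowers]
      rcases hg with h | h <;> simp [h]
    rw [Subgroup.mem_normalizer_iff]
    intro h
    constructor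
    · intro hh
      rw [← h1]
      exact ⟨h, hh, by simp⟩
    · intro hh
      rw [← h1] at hh
      obtain ⟨k, hk, hk2⟩ := hh
      simp at hk2
      exact hk2 ▸ hk
  have hnorm : K.Normal := by
    rw [← Subgroup.normalizer_eq_top_iff, eq_top_iff, ← hgen, Subgroup.closure_le]
    rintro x (rfl | rfl | rfl)
    · exact hAi _ (Or.inl hAC)
    · exact hAi _ (Or.inr hBC)
    · exact hAi _ (Or.inl hzC)
  let q := QuotientGroup.mk' K
  have hqC : q C = 1 := (QuotientGroup.eq_one_iff C).2 (Subgroup.mem_zpowers C)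
  have hAB : q B * q A = q A * q B := by
    have h1 : q (B * A * B⁻¹) = q A := by
      have : B * A * B⁻¹ = C⁻¹ * A := by
        rw [hBA, hCdef, mul_inv_rev, mul_inv_rev, hwi, mul_assoc w, ← hwc]; group
      rw [this]; simp [hqC]
    simp only [map_mul, map_inv] at h1
    exact mul_inv_eq_iff_eq_mul.1 h1
  have hqz : ∀ g, q g * q z = q z * q g := by
    intro g; rw [← map_mul, hz, map_mul]
  have key : ∀ H : Subgroup (P ⧸ K), q A ∈ H → q B ∈ H → q z ∈ H → ∀ x, q x ∈ H := by
    intro H h1 h2 h3 x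
    have : Subgroup.closure {A, B, z} ≤ H.comap q := by
      rw [Subgroup.closure_le]
      rintro x (rfl | rfl | rfl) <;> assumption
    rw [hgen] at this
    exact this (Subgroup.mem_top x)
  have hcA : ∀ x, q x * q A = q A * q x := fun x => by
    have := key (Subgroup.centralizer {q A}) (by simp [Subgroup.mem_centralizer_iff])
      (by simp [Subgroup.mem_centralizer_iff, hAB]) 
      (by simp [Subgroup.mem_centralizer_iff, hqz]) x
    simp only [Subgroup.mem_centralizer_iff, Set.mem_singleton_iff, forall_eq] at this
    exact this.symm
  have hcB : ∀ x, q x * q B = q B * q x := fun x => by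
    have := key (Subgroup.centralizer {q B}) (by simp [Subgroup.mem_centralizer_iff, hAB])
      (by simp [Subgroup.mem_centralizer_iff]) 
      (by simp [Subgroup.mem_centralizer_iff, hqz]) x
    simp only [Subgroup.mem_centralizer_iff, Set.mem_singleton_iff, forall_eq] at this
    exact this.symm
  have hall : ∀ x y, q x * q y = q y * q x := fun x y => by
    have := key (Subgroup.centralizer {q x}) 
      (by simp [Subgroup.mem_centralizer_iff, hcA]) (by simp [Subgroup.mem_centralizer_iff, hcB])
      (by simp [Subgroup.mem_centralizer_iff, hqz]) y
    simp only [Subgroup.mem_centralizer_iff, Set.mem_singleton_iff, forall_eq] at this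
    exact this
  have hle : commutator P ≤ K := by
    rw [commutator_def, Subgroup.commutator_le]
    intro x _ y _
    rw [← QuotientGroup.ker_mk' K, MonoidHom.mem_ker, map_commutatorElement,
      commutatorElement_eq_one_iff_mul_comm]
    exact hall x y
  exact fun h => hC (hle h)

theorem aux_transfer {E : Type*} [Group E] [Finite E] (A B z w : E)
    (hz : ∀ g, g * z = z * g) (hz2 : z * z = 1) (hw : w = 1 ∨ w = z)
    (hBA : B * A * B⁻¹ = A⁻¹ * w) (hC : z ∉ Subgroup.zpowers (A * A * w))
    (hodd : Odd (Subgroup.closure {A, B, z}).index) : z ∉ commutator E := by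
  set P := Subgroup.closure {A, B, z} with hP
  have hAP : A ∈ P := Subgroup.subset_closure (by simp)
  have hBP : B ∈ P := Subgroup.subset_closure (by simp)
  have hzP : z ∈ P := Subgroup.subset_closure (by simp)
  have hwP : w ∈ P := by
    rcases hw with rfl | rfl
    · exact one_mem _
    · exact hzP
  have h1 : (⟨z, hzP⟩ : P) ∉ commutator P := by
    apply aux_gen (⟨A, hAP⟩ : P) ⟨B, hBP⟩ ⟨z, hzP⟩ ⟨w, hwP⟩
    · have := Subgroup.closure_closure_coe_preimage (k := ({A, B, z} : Set E))
      rw [← this]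
      congr 1
      ext ⟨x, hx⟩
      simp
    · intro g; ext; exact hz g
    · ext; exact hz2
    · simpa [Subtype.ext_iff] using hw
    · ext; exact hBA
    · rintro ⟨k, hk⟩
      exact hC ⟨k, by simpa [Subtype.ext_iff] using hk⟩
  intro h
  let T : E →* Abelianization P := MonoidHom.transfer (Abelianization.of (G := P))
  have hT : T z = 1 := by
    have := Abelianization.commutator_subset_ker T h
    exact this
  have hzk : ∀ (k : ℕ) (g : E), g⁻¹ * z ^ k * g = z ^ k := by
    intro k g
    have : Commute g (z ^ k) := Commute.pow_right (hz g) k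
    rw [mul_assoc, ← this.eq]; group
  have h2 := MonoidHom.transfer_eq_pow (Abelianization.of (G := P)) z (fun k g _ => hzk k g)
  have h3 : z ^ P.index = z := by
    obtain ⟨k, hk⟩ := hodd
    rw [hk, pow_succ, pow_mul, pow_two, hz2]; simp
  have h4 : Abelianization.of (G := P) ⟨z, hzP⟩ = 1 := by
    rw [← hT]; change _ = (MonoidHom.transfer _) z
    rw [h2]
    congr 1
    ext
    exact h3.symm
  apply h1
  rw [← Abelianization.ker_of]
  exact h4

theorem aux_comap {E G : Type*} [Group E] [Group G] (π : E →* G) (z : E)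
    (hker : ∀ x, π x = 1 ↔ x = 1 ∨ x = z) (A B : E) :
    Subgroup.closure {A, B, z} = (Subgroup.closure {π A, π B}).comap π := by
  have hpz : π z = 1 := (hker z).2 (Or.inr rfl)
  have e : Subgroup.closure {π A, π B} = (Subgroup.closure {A, B, z}).map π := by
    rw [MonoidHom.map_closure]
    apply le_antisymm
    · apply Subgroup.closure_mono
      rintro x (rfl | rfl)
      · exact ⟨A, by simp, rfl⟩
      · exact ⟨B, by simp, rfl⟩
    · rw [Subgroup.closure_le]
      rintro _ ⟨x, (rfl | rfl | rfl), rfl⟩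
      · exact Subgroup.subset_closure (by simp)
      · exact Subgroup.subset_closure (by simp)
      · rw [hpz]; exact one_mem _
  rw [e, Subgroup.comap_map_eq_self]
  intro x hx
  rcases (hker x).1 hx with rfl | rfl
  · exact one_mem _
  · exact Subgroup.subset_closure (by simp)

theorem aux_quat {E G : Type*} [Group E] [Finite E] [Group G] (π : E →* G)
    (hπ : Function.Surjective π) (z : E)
    (hz : ∀ g, g * z = z * g) (hz2 : z * z = 1) (hz1 : z ≠ 1) 
    (hker : ∀ x, π x = 1 ↔ x = 1 ∨ x = z) (a b : G) (m : ℕ) (hm : Even m)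
    (ha : orderOf a = 2 * m) (hb : b * b = a ^ m) (hba : b * a * b⁻¹ = a⁻¹)
    (hodd : Odd (Subgroup.closure {a, b}).index) : z ∉ commutator E := by
  obtain ⟨A, rfl⟩ := hπ a
  obtain ⟨B, rfl⟩ := hπ b
  obtain ⟨w, hw⟩ : ∃ w, w = A * (B * A * B⁻¹) := ⟨_, rfl⟩
  have hBA : B * A * B⁻¹ = A⁻¹ * w := by rw [hw]; group
  have hw' : w = 1 ∨ w = z := by
    rw [← hker, hw]; simp [hba]
  have hwc : ∀ g, g * w = w * g := by
    rcases hw' with rfl | rfl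
    · simp
    · exact hz
  have hw2 : w * w = 1 := by
    rcases hw' with rfl | rfl
    · simp
    · exact hz2
  have hpz : π z = 1 := (hker z).2 (Or.inr rfl)
  have hA2 : A ^ (2 * m) = 1 := by
    obtain ⟨v, hv⟩ : ∃ v, v = B * B * (A ^ m)⁻¹ := ⟨_, rfl⟩
    have hv' : v = 1 ∨ v = z := by
      rw [← hker, hv]; simp [hb]
    have hvc : ∀ g, g * v = v * g := by
      rcases hv' with rfl | rfl
      · simp
      · exact hz
    have e1 : A ^ m = v⁻¹ * (B * B) := by rw [hv]; group
    have e2 : B * A ^ m * B⁻¹ = A ^ m := by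
      rw [e1, ← mul_assoc, show B * v⁻¹ = v⁻¹ * B from ((show Commute B v from hvc B).inv_right)]
      group
    have e3 : B * A ^ m * B⁻¹ = (A ^ m)⁻¹ := by
      rw [← conj_pow, hBA, (show Commute A⁻¹ w from hwc _).mul_pow]
      obtain ⟨k, rfl⟩ := hm
      rw [← two_mul, pow_mul w, pow_two w, hw2]; simp
    rw [two_mul, pow_add]
    nth_rewrite 1 [← e2]
    rw [e3]; simp
  refine aux_transfer A B z w hz hz2 hw' hBA ?_ ?_
  · rintro ⟨k, hk⟩
    have hk : (A * A * w) ^ k = z := hk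
    have h0 : π w = 1 := by
      rcases hw' with rfl | rfl
      · simp
      · exact hpz
    have h1 := congrArg π hk
    simp only [map_zpow, map_mul, h0, mul_one, hpz] at h1
    rw [← zpow_two, ← zpow_mul] at h1
    have h2 := orderOf_dvd_iff_zpow_eq_one.2 h1
    rw [ha] at h2
    push_cast at h2
    have h3 : (m : ℤ) ∣ k := (mul_dvd_mul_iff_left (by norm_num)).1 h2
    obtain ⟨l, rfl⟩ := h3
    obtain ⟨n, rfl⟩ := hm
    apply hz1
    rw [← hk, (show Commute (A * A) w from hwc _).mul_zpow, ← zpow_two, ← zpow_mul]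
    have : w ^ (((n + n : ℕ) : ℤ) * l) = 1 := by
      rw [zpow_mul, zpow_natCast, ← two_mul, pow_mul, pow_two, hw2]; simp
    rw [this, mul_one, ← mul_assoc, zpow_mul]
    have e : A ^ ((2 : ℤ) * ((n + n : ℕ) : ℤ)) = 1 := by
      exact_mod_cast hA2
    rw [e, one_zpow]
  · rw [aux_comap π z hker, Subgroup.index_comap_of_surjective _ hπ]
    exact hodd

theorem aux_card {G : Type*} [Group G] [Finite G] (a b : G) (hb : b * b ∈ Subgroup.zpowers a)
    (hba : b * a * b⁻¹ = a⁻¹) (ha : a ^ 2 ≠ 1) :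
    2 * orderOf a ∣ Nat.card (Subgroup.closure {a, b}) := by
  set P := Subgroup.closure {a, b} with hP
  have haP : a ∈ P := Subgroup.subset_closure (by simp)
  have hbP : b ∈ P := Subgroup.subset_closure (by simp)
  have hbn : b ∉ Subgroup.zpowers a := by
    rintro ⟨k, rfl⟩
    apply ha
    have : a ^ k * a * (a ^ k)⁻¹ = a := by group
    simp only [this] at hba
    rw [pow_two]
    nth_rewrite 1 [hba]
    simp
  -- H = zpowers a, normal in P
  have hle : Subgroup.zpowers a ≤ P := by simpa using haP
  have hnorm : ((Subgroup.zpowers a).subgroupOf P).Normal := by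
    rw [Subgroup.normal_subgroupOf_iff_le_normalizer hle, hP, Subgroup.closure_le]
    have hg : ∀ g, (g * a * g⁻¹ = a ∨ g * a * g⁻¹ = a⁻¹) →
        g ∈ Subgroup.normalizer (Subgroup.zpowers a : Set G) := by
      intro g hg
      have h1 : (Subgroup.zpowers a).map (MulAut.conj g).toMonoidHom = Subgroup.zpowers a := by
        rw [MonoidHom.map_zpowers]
        rcases hg with h | h <;> simp [h]
      rw [Subgroup.mem_normalizer_iff]
      intro h
      constructor
      · intro hh
        rw [← h1]
        exact ⟨h, hh, by simp⟩
      · intro hh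
        rw [← h1] at hh
        obtain ⟨k, hk, hk2⟩ := hh
        simp at hk2
        exact hk2 ▸ hk
    rintro x (rfl | rfl)
    · exact hg _ (Or.inl (by group))
    · exact hg _ (Or.inr hba)
  set H := (Subgroup.zpowers a).subgroupOf P
  have hcH : Nat.card H = orderOf a := by
    rw [← Nat.card_zpowers]
    exact Nat.card_congr (Subgroup.subgroupOfEquivOfLe hle).toEquiv
  have h2 : 2 ∣ H.index := by
    have : orderOf (QuotientGroup.mk' H ⟨b, hbP⟩) = 2 := by
      apply orderOf_eq_prime
      · rw [← map_pow]
        apply (QuotientGroup.eq_one_iff _).2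
        rw [Subgroup.mem_subgroupOf]
        simpa [pow_two] using hb
      · intro h
        exact hbn (Subgroup.mem_subgroupOf.1 ((QuotientGroup.eq_one_iff (N := H) ⟨b, hbP⟩).1 h))
    rw [← this, Subgroup.index]
    exact orderOf_dvd_natCard _
  rw [← H.card_mul_index, hcH, mul_comm]
  exact mul_dvd_mul_left _ h2

theorem aux_odd {G : Type*} [Group G] [Finite G] (H : Subgroup G) (n k : ℕ) (hn : 0 < n)
    (hk : Odd k) (hG : Nat.card G = n * k) (hH : n ∣ Nat.card H) : Odd H.index := by
  obtain ⟨c, hc⟩ := hH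
  have := H.card_mul_index
  rw [hG, hc, mul_assoc] at this
  have := Nat.eq_of_mul_eq_mul_left hn this
  rw [← this] at hk
  exact (Nat.odd_mul.1 hk).2

theorem aux_split {E G : Type} [Group E] [Finite E] [Group G] [Finite G] (π : E →* G)
    (hπ : Function.Surjective π) (hperf : commutator G = ⊤) (hc : Nat.card π.ker = 2)
    (z : E) (hzc : ∀ g, g * z = z * g)
    (hker : ∀ x, π x = 1 ↔ x = 1 ∨ x = z)
    (hz : z ∉ commutator E) : Nonempty (E ≃* Multiplicative (ZMod 2) × G) := by
  have hsurj : ∀ g : G, ∃ x ∈ commutator E, π x = g := by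
    intro g
    have : (commutator E).map π = ⊤ := by
      rw [commutator_def, Subgroup.map_commutator, ← MonoidHom.range_eq_map,
        MonoidHom.range_eq_top.2 hπ, ← commutator_def, hperf]
    have hg : g ∈ (commutator E).map π := this ▸ Subgroup.mem_top g
    exact hg
  let φ : commutator E →* G := π.comp (commutator E).subtype
  have hφ : Function.Bijective φ := by
    constructor
    · rw [injective_iff_map_eq_one]
      rintro ⟨x, hx⟩ h
      rcases (hker x).1 h with rfl | rfl
      · rfl
      · exact absurd hx hz
    · intro g
      obtain ⟨x, hx, h⟩ := hsurj g
      exact ⟨⟨x, hx⟩, h⟩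
  let Φ := MulEquiv.ofBijective φ hφ
  have : Fact (Nat.Prime 2) := ⟨Nat.prime_two⟩
  let e : Multiplicative (ZMod 2) ≃* π.ker := mulEquivOfPrimeCardEq (p := 2) (by simp) hc
  let f : Multiplicative (ZMod 2) →* E := π.ker.subtype.comp e.toMonoidHom
  let g : G →* E := (commutator E).subtype.comp Φ.symm.toMonoidHom
  have hf : ∀ t, π (f t) = 1 := fun t => (e t).2
  have hg : ∀ t, π (g t) = t := fun t => Φ.apply_symm_apply t
  have hcomm : ∀ m n, Commute (f m) (g n) := by
    intro m n
    rcases (hker _).1 (hf m) with h | h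
    · rw [h]; exact Commute.one_left _
    · rw [h]; exact (hzc _).symm
  let F := MonoidHom.noncommCoprod f g hcomm
  have hF : Function.Bijective F := by
    constructor
    · rw [injective_iff_map_eq_one]
      rintro ⟨t, x⟩ h
      have h : f t * g x = 1 := h
      have hx := congrArg π h
      rw [map_mul, hf, hg, one_mul, map_one] at hx
      subst hx
      rw [map_one, mul_one] at h
      have : e t = 1 := Subtype.ext h
      have : t = 1 := by simpa using this
      rw [this]; rfl
    · intro x
      have hk : x * (g (π x))⁻¹ ∈ π.ker := by
        rw [MonoidHom.mem_ker, map_mul, map_inv, hg]; simp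
      refine ⟨(e.symm ⟨_, hk⟩, π x), ?_⟩
      change f _ * g _ = _
      have : f (e.symm ⟨_, hk⟩) = x * (g (π x))⁻¹ := by
        change ((e (e.symm ⟨_, hk⟩) : π.ker) : E) = _
        rw [MulEquiv.apply_symm_apply]
      rw [this]; simp
  exact ⟨(MulEquiv.ofBijective F hF).symm⟩

theorem aux_two {E : Type*} [Group E] (N : Subgroup E) (hN : N.Normal)
    (hNcard : Nat.card N = 2) : ∃ z, z ≠ 1 ∧ z * z = 1 ∧ (∀ g, g * z = z * g) ∧
      ∀ x, x ∈ N ↔ x = 1 ∨ x = z := by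
  obtain ⟨⟨z, hz⟩, hz1, huniq⟩ := (Nat.card_eq_two_iff' (1 : N)).1 hNcard
  have hu : ∀ x ∈ N, x ≠ 1 → x = z := by
    intro x hx h
    have := huniq ⟨x, hx⟩ (by simpa [Subtype.ext_iff] using h)
    simpa [Subtype.ext_iff] using this
  have hz1 : z ≠ 1 := by simpa [Subtype.ext_iff] using hz1
  refine ⟨z, hz1, ?_, ?_, ?_⟩
  · by_contra h
    have := hu _ (mul_mem hz hz) h
    simp at this
    exact hz1 this
  · intro g
    have := hu _ (hN.conj_mem z hz g) (by simpa using hz1)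
    exact mul_inv_eq_iff_eq_mul.1 this
  · intro x
    constructor
    · intro hx
      by_cases h : x = 1
      · exact Or.inl h
      · exact Or.inr (hu x hx h)
    · rintro (rfl | rfl)
      · exact one_mem _
      · exact hz

theorem aux_main (G : Type) [Group G] [Finite G] (hperf : commutator G = ⊤)
    (a b : G) (m : ℕ) (hm : Even m) (hm0 : 0 < m)
    (ha : orderOf a = 2 * m) (hb : b * b = a ^ m) (hba : b * a * b⁻¹ = a⁻¹)
    (k : ℕ) (hk : Odd k) (hcard : Nat.card G = 4 * m * k)
    (E : Type) [Group E] [Finite E] (N : Subgroup E) (hN : N.Normal)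
    (hNcard : Nat.card N = 2) (hquot : Nonempty (E ⧸ N ≃* G)) :
    N ≤ Subgroup.center E ∧ Nonempty (E ≃* Multiplicative (ZMod 2) × G) := by
  obtain ⟨z, hz1, hz2, hzc, hzN⟩ := aux_two N hN hNcard
  obtain ⟨e⟩ := hquot
  let π : E →* G := e.toMonoidHom.comp (QuotientGroup.mk' N)
  have hπ : Function.Surjective π := e.surjective.comp (QuotientGroup.mk'_surjective N)
  have hk1 : ∀ x, π x = 1 ↔ x ∈ N := by
    intro x
    rw [← QuotientGroup.eq_one_iff]
    exact e.map_eq_one_iff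
  have hker : ∀ x, π x = 1 ↔ x = 1 ∨ x = z := fun x => (hk1 x).trans (hzN x)
  have hkN : π.ker = N := by ext x; exact hk1 x
  have ha2 : a ^ 2 ≠ 1 := by
    intro h
    have := Nat.le_of_dvd (by norm_num) (orderOf_dvd_of_pow_eq_one h)
    obtain ⟨n, rfl⟩ := hm
    omega
  have hodd : Odd (Subgroup.closure {a, b}).index := by
    refine aux_odd _ (4 * m) k (by omega) hk hcard ?_
    have := aux_card a b (hb ▸ Subgroup.npow_mem_zpowers a m) hba ha2
    rw [ha] at this
    rwa [show 2 * (2 * m) = 4 * m by ring] at this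
  refine ⟨?_, ?_⟩
  · intro x hx
    rw [Subgroup.mem_center_iff]
    rcases (hzN x).1 hx with rfl | rfl
    · simp
    · exact hzc
  · exact aux_split π hπ hperf (hkN ▸ hNcard) z hzc hker
      (aux_quat π hπ z hzc hz2 hz1 hker a b m hm ha hb hba hodd)

theorem aux_card_sl (p : ℕ) [NeZero p] : Nat.card (Matrix.SpecialLinearGroup (Fin 2) (ZMod p)) =
    Fintype.card {x : (ZMod p × ZMod p) × (ZMod p × ZMod p) // x.1.1 * x.2.2 - x.1.2 * x.2.1 = 1} := by
  rw [← Nat.card_eq_fintype_card]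
  refine Nat.card_congr
    { toFun := fun M => ⟨((M.1 0 0, M.1 0 1), (M.1 1 0, M.1 1 1)), by
        have := M.2; rwa [Matrix.det_fin_two] at this⟩
      invFun := fun x => ⟨!![x.1.1.1, x.1.1.2; x.1.2.1, x.1.2.2], by
        rw [Matrix.det_fin_two_of]; exact x.2⟩
      left_inv := fun M => by
        ext i j; fin_cases i <;> fin_cases j <;> rfl
      right_inv := fun x => by rfl }

theorem aux_card5 : Nat.card (Matrix.SpecialLinearGroup (Fin 2) (ZMod 5)) = 120 := by
  rw [aux_card_sl]; decide +kernel

theorem aux_card7 : Nat.card (Matrix.SpecialLinearGroup (Fin 2) (ZMod 7)) = 336 := by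
  rw [aux_card_sl]; decide +kernel

theorem aux_sq {G H : Type*} [Group G] [Group H] (φ : G →* H) (hφ : Function.Surjective φ)
    (ζ : G) (hζ2 : ζ * ζ = 1) (hζ : ∀ g, g * ζ = ζ * g) (hker : ∀ x, φ x = 1 ↔ x = 1 ∨ x = ζ)
    (x y : G) (c : H) (hx : φ x * φ x = 1) (hc : c * φ x * c⁻¹ = φ y) : y * y = x * x := by
  obtain ⟨g, rfl⟩ := hφ c
  have hcent : ∀ t, φ t = 1 → t * t = 1 ∧ ∀ g, g * t = t * g := by
    intro t ht
    rcases (hker t).1 ht with rfl | rfl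
    · simp
    · exact ⟨hζ2, hζ⟩
  obtain ⟨t, ht⟩ : ∃ t, t = y * (g * x * g⁻¹)⁻¹ := ⟨_, rfl⟩
  have ht1 : φ t = 1 := by rw [ht]; simp [← hc]
  obtain ⟨t2, tc⟩ := hcent t ht1
  have hy : y = t * (g * x * g⁻¹) := by rw [ht]; group
  have hxx := (hcent (x * x) (by simpa using hx)).2
  calc y * y = (t * (g * x * g⁻¹)) * (t * (g * x * g⁻¹)) := by rw [← hy]
    _ = t * ((g * x * g⁻¹) * t) * (g * x * g⁻¹) := by group
    _ = (t * t) * (g * (x * x)) * g⁻¹ := by rw [tc]; group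
    _ = x * x := by rw [t2, hxx]; group

theorem aux_A6 (G : Type) [Group G] [Finite G] (h : IsDoubleCoverA6 G) :
    commutator G = ⊤ ∧ Nat.card G = 4 * 4 * 45 ∧ ∃ a b : G, orderOf a = 2 * 4 ∧ b * b = a ^ 4 ∧
      b * a * b⁻¹ = a⁻¹ := by
  obtain ⟨hperf, -, hc, ⟨e⟩⟩ := h
  have cA6 : Nat.card (alternatingGroup (Fin 6)) = 360 := by
    rw [nat_card_alternatingGroup]; simp [Nat.factorial]
  have hcard : Nat.card G = 4 * 4 * 45 := by
    rw [Subgroup.card_eq_card_quotient_mul_card_subgroup (Subgroup.center G), hc,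
      Nat.card_congr e.toEquiv, cA6]
  refine ⟨hperf, hcard, ?_⟩
  obtain ⟨ζ, hζ1, hζ2, hζc, hζN⟩ := aux_two (Subgroup.center G) inferInstance hc
  let φ : G →* alternatingGroup (Fin 6) := e.toMonoidHom.comp (QuotientGroup.mk' _)
  have hφ : Function.Surjective φ := e.surjective.comp (QuotientGroup.mk'_surjective _)
  have hker : ∀ x, φ x = 1 ↔ x = 1 ∨ x = ζ := by
    intro x
    rw [← hζN, ← QuotientGroup.eq_one_iff]
    exact e.map_eq_one_iff
  let a : alternatingGroup (Fin 6) := ⟨c[0, 1, 2, 3] * c[4, 5], Equiv.Perm.mem_alternatingGroup.2 (by decide)⟩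
  let b : alternatingGroup (Fin 6) := ⟨c[0, 2] * c[4, 5], Equiv.Perm.mem_alternatingGroup.2 (by decide)⟩
  let c : alternatingGroup (Fin 6) := ⟨c[1, 4] * c[3, 5], Equiv.Perm.mem_alternatingGroup.2 (by decide)⟩
  let d : alternatingGroup (Fin 6) := ⟨c[1, 2] * c[4, 5], Equiv.Perm.mem_alternatingGroup.2 (by decide)⟩
  have r1 : b * a * b⁻¹ = a⁻¹ := by decide
  have r2 : c * (a * a) * c⁻¹ = b := by decide
  have r3 : d * (a * a) * d⁻¹ = b * a := by decide
  have r4 : (a * a) * (a * a) = 1 := by decide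
  have r5 : a * a ≠ 1 := by decide
  have r6 : b * b = 1 := by decide
  clear_value a b c d
  obtain ⟨A, rfl⟩ := hφ a
  obtain ⟨B, rfl⟩ := hφ b
  have s1 : B * B = (A * A) * (A * A) :=
    aux_sq φ hφ ζ hζ2 hζc hker (A * A) B c (by simpa using r4) (by simpa using r2)
  have s2 : (B * A) * (B * A) = (A * A) * (A * A) :=
    aux_sq φ hφ ζ hζ2 hζc hker (A * A) (B * A) d (by simpa using r4) (by simpa using r3)
  have s3 : B * A * B⁻¹ = A⁻¹ := by
    have : B * A * B⁻¹ = ((B * A) * (B * A)) * A⁻¹ * (B * B)⁻¹ := by group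
    rw [this, s2, s1]; group
  have hoA : orderOf (φ A) = 4 := by
    apply orderOf_eq_prime_pow (p := 2) (n := 1)
    · simpa [pow_two] using r5
    · simpa [pow_succ, mul_assoc] using r4
  have hA4 : A ^ 4 = 1 ∨ A ^ 4 = ζ := by
    rw [← hker, map_pow]; simpa [pow_succ, mul_assoc] using r4
  have hB4 : B * B = A ^ 4 := by rw [s1]; simp [pow_succ, mul_assoc]
  rcases hA4 with h | h
  · exfalso
    have hodd : Odd (Subgroup.closure {φ A, φ B}).index := by
      refine aux_odd _ (2 * 4) 45 (by norm_num) (by decide) cA6 ?_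
      rw [← hoA]
      exact aux_card _ _ (r6 ▸ one_mem _) r1 (by rwa [pow_two])
    have hpz : φ ζ = 1 := (hker ζ).2 (Or.inr rfl)
    have := aux_transfer A B ζ 1 hζc hζ2 (Or.inl rfl) (by simpa using s3) ?_ ?_
    · exact this (hperf ▸ Subgroup.mem_top _)
    · rintro ⟨k, hk⟩
      have hk : (A * A * 1) ^ k = ζ := hk
      have h1 := congrArg φ hk
      rw [mul_one, ← zpow_two, ← zpow_mul, map_zpow, hpz] at h1
      have h2 := orderOf_dvd_iff_zpow_eq_one.2 h1
      rw [hoA] at h2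
      obtain ⟨l, hl⟩ := h2
      apply hζ1
      rw [← hk, mul_one, ← zpow_two, ← zpow_mul, hl, zpow_mul]
      have : A ^ ((4 : ℕ) : ℤ) = 1 := by rw [zpow_natCast, h]
      rw [this, one_zpow]
    · rwa [aux_comap φ ζ hker A B, Subgroup.index_comap_of_surjective _ hφ]
  · refine ⟨A, B, ?_, hB4, s3⟩
    apply orderOf_eq_prime_pow (p := 2) (n := 2)
    · rw [show 2 ^ 2 = 4 by norm_num, h]; exact hζ1
    · rw [show 2 ^ (2 + 1) = 4 * 2 by norm_num, pow_mul, h, pow_two, hζ2]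

theorem aux_perf5 : commutator (Matrix.SpecialLinearGroup (Fin 2) (ZMod 5)) = ⊤ := by
  have h0 : (2 : ZMod 5) ≠ 0 := by decide
  have h1 : (2 : ZMod 5) ^ 2 ≠ 1 := by decide
  have : Fact (Nat.Prime 5) := ⟨by norm_num⟩
  exact Matrix.SL2.commutator_eq_top h0 h1

theorem aux_perf7 : commutator (Matrix.SpecialLinearGroup (Fin 2) (ZMod 7)) = ⊤ := by
  have h0 : (2 : ZMod 7) ≠ 0 := by decide
  have h1 : (2 : ZMod 7) ^ 2 ≠ 1 := by decide
  have : Fact (Nat.Prime 7) := ⟨by norm_num⟩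
  exact Matrix.SL2.commutator_eq_top h0 h1

/-- Let `G` be isomorphic to one of the quasi-simple groups `SL₂(F₅) ≅ 2.A₅`, `SL₂(F₇)`,
or `2.A₆`.  Then every extension of `G` by a group of order `2` splits: if `E` is a finite
group with a normal subgroup `N` of order `2` such that `E/N ≅ G`, then `N` is central in `E`
and `E ≅ (ℤ/2ℤ) × G`. -/
theorem extension_by_mu2_splits (G : Type) [Group G] [Finite G]
    (hG : Nonempty (G ≃* Matrix.SpecialLinearGroup (Fin 2) (ZMod 5)) ∨
          Nonempty (G ≃* Matrix.SpecialLinearGroup (Fin 2) (ZMod 7)) ∨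
          IsDoubleCoverA6 G)
    (E : Type) [Group E] [Finite E] (N : Subgroup E) (hN : N.Normal)
    (hNcard : Nat.card N = 2) (hquot : Nonempty (E ⧸ N ≃* G)) :
    N ≤ Subgroup.center E ∧ Nonempty (E ≃* Multiplicative (ZMod 2) × G) := by
  rcases hG with ⟨⟨e⟩⟩ | ⟨⟨e⟩⟩ | h
  · obtain ⟨f⟩ := hquot
    obtain ⟨h1, ⟨g⟩⟩ := aux_main (Matrix.SpecialLinearGroup (Fin 2) (ZMod 5))
      aux_perf5
      ⟨!![2, 0; 0, 3], by decide⟩ ⟨!![0, 1; -1, 0], by decide⟩ 2 (by decide) (by decide)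
      (orderOf_eq_prime_pow (p := 2) (n := 1) (by decide) (by decide)) (by decide) (by decide)
      15 (by decide) aux_card5 E N hN hNcard ⟨f.trans e⟩
    exact ⟨h1, ⟨g.trans (MulEquiv.prodCongr (MulEquiv.refl _) e.symm)⟩⟩
  · obtain ⟨f⟩ := hquot
    obtain ⟨h1, ⟨g⟩⟩ := aux_main (Matrix.SpecialLinearGroup (Fin 2) (ZMod 7))
      aux_perf7
      ⟨!![0, -1; 1, 3], by decide⟩ ⟨!![1, 2; -1, -1], by decide⟩ 4 (by decide) (by decide)
      (orderOf_eq_prime_pow (p := 2) (n := 2) (by decide) (by decide)) (by decide) (by decide)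
      21 (by decide) aux_card7 E N hN hNcard ⟨f.trans e⟩
    exact ⟨h1, ⟨g.trans (MulEquiv.prodCongr (MulEquiv.refl _) e.symm)⟩⟩
  · obtain ⟨hperf, hcard, a, b, ha, hb, hba⟩ := aux_A6 G h
    exact aux_main G hperf a b 4 (by decide) (by decide) ha hb hba 45 (by decide) hcard
      E N hN hNcard hquot
end

section
/- Let H = (ℤ/22ℤ) ⋊ (ℤ/5ℤ) be the semidirect product in which ℤ/5ℤ acts on the ℤ/11ℤ factor of ℤ/22ℤ by an automorphism of order 5 and trivially on the ℤ/2ℤ factor. Let E be a finite group with a normal subgroup N of order 2 such that E/N ≅ H, and suppose the center of E contains an element of order 4. Then the kernel of the induced surjection E → ℤ/5ℤ is cyclic of order 44, and E admits no faithful three-dimensional complex representation. -/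
lemma aux_zmod : ∀ k : ZMod 11, k ^ 5 = 1 → k ≠ 1 → ∀ i j : Fin 5,
    k ^ (i : ℕ) = k ^ (j : ℕ) → i = j := by decide

lemma aux_eig (A : Matrix (Fin 3) (Fin 3) ℂ) (hA : A ^ 11 = 1) (hA1 : A ≠ 1) :
    ∃ ζ ∈ spectrum ℂ A, orderOf ζ = 11 := by
  haveI : Fact (Nat.Prime 11) := ⟨by norm_num⟩
  let p : Polynomial ℂ := ∑ i ∈ Finset.range 11, Polynomial.X ^ i
  have hp : p * (Polynomial.X - 1) = Polynomial.X ^ 11 - 1 := geom_sum_mul _ _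
  have h0 : Polynomial.aeval A p * (A - 1) = 0 := by
    have := congrArg (Polynomial.aeval A) hp
    simpa [hA] using this
  have hnu : ¬ IsUnit (Polynomial.aeval A p) := by
    intro hu
    apply hA1
    have := (hu.mul_right_eq_zero).1 h0
    exact sub_eq_zero.1 this
  have hmem : (0 : ℂ) ∈ spectrum ℂ (Polynomial.aeval A p) := spectrum.zero_mem_iff ℂ |>.2 hnu
  have hne : (spectrum ℂ A).Nonempty :=
    spectrum.nonempty_of_isAlgClosed_of_finiteDimensional ℂ A
  rw [spectrum.map_polynomial_aeval_of_nonempty _ _ hne] at hmem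
  obtain ⟨ζ, hζ, hζ0⟩ := hmem
  have hz0 : p.eval ζ = 0 := hζ0
  refine ⟨ζ, hζ, orderOf_eq_prime ?_ ?_⟩
  · have := congrArg (Polynomial.eval ζ) hp
    simp only [Polynomial.eval_mul, hz0, zero_mul] at this
    simp at this
    exact (sub_eq_zero.1 this.symm)
  · rintro rfl
    simp [p, Polynomial.eval_finset_sum] at hz0

lemma aux_norep {E : Type} [Group E] (x g : E) (k : ℕ) (hx : orderOf x = 11)
    (hg : g * x * g⁻¹ = x ^ k) (hne : g * x * g⁻¹ ≠ x) (h5 : g ^ 5 * x * (g ^ 5)⁻¹ = x)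
    (ρ : E →* GL (Fin 3) ℂ) (hρ : Function.Injective ρ) : False := by
  have hconj : ∀ i : ℕ, g ^ i * x * (g ^ i)⁻¹ = x ^ (k ^ i) := by
    intro i
    induction i with
    | zero => simp
    | succ i ih =>
      calc g ^ (i + 1) * x * (g ^ (i + 1))⁻¹ = g * (g ^ i * x * (g ^ i)⁻¹) * g⁻¹ := by
            rw [pow_succ']; group
        _ = (g * x * g⁻¹) ^ (k ^ i) := by rw [ih, conj_pow]
        _ = x ^ (k ^ (i + 1)) := by rw [hg, ← pow_mul, pow_succ']
  have hk5 : ((k : ZMod 11)) ^ 5 = 1 := by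
    have h := hconj 5
    rw [h5] at h
    have h' : x ^ (k ^ 5) = x ^ 1 := by rw [pow_one]; exact h.symm
    rw [pow_eq_pow_iff_modEq, hx, ← ZMod.natCast_eq_natCast_iff] at h'
    simpa using h'
  have hk1 : (k : ZMod 11) ≠ 1 := by
    intro h
    apply hne
    rw [hg]
    conv_rhs => rw [← pow_one x]
    rw [pow_eq_pow_iff_modEq, hx, ← ZMod.natCast_eq_natCast_iff]
    simpa using h
  let A : Matrix (Fin 3) (Fin 3) ℂ := (ρ x : GL (Fin 3) ℂ)
  have hA : A ^ 11 = 1 := by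
    have : (ρ x) ^ 11 = 1 := by rw [← map_pow, ← hx, pow_orderOf_eq_one, map_one]
    have := congrArg Units.val this
    simpa [A] using this
  have hA1 : A ≠ 1 := by
    intro h
    have h1 : ρ x = 1 := Units.ext h
    have h2 : x = 1 := hρ (by rw [h1, map_one])
    rw [h2] at hx
    simp at hx
  obtain ⟨ζ, hζ, hζo⟩ := aux_eig A hA hA1
  have hmem : ∀ i : Fin 5, ζ ^ (k ^ (i : ℕ)) ∈ spectrum ℂ A := by
    intro i
    have h1 : ζ ^ (k ^ (i : ℕ)) ∈ spectrum ℂ (A ^ (k ^ (i : ℕ))) := spectrum.pow_mem_pow A _ hζ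
    have h2 : A ^ (k ^ (i : ℕ)) = (ρ (g ^ (i : ℕ)) : GL (Fin 3) ℂ) * A *
        ((ρ (g ^ (i : ℕ)))⁻¹ : GL (Fin 3) ℂ) := by
      have := congrArg (fun y => ((ρ y : GL (Fin 3) ℂ) : Matrix (Fin 3) (Fin 3) ℂ))
        (hconj i)
      simp only [map_mul, map_inv, Units.val_mul] at this
      rw [this]
      simp [A]
    rw [h2, spectrum.units_conjugate] at h1
    exact h1
  have hinj : Function.Injective (fun i : Fin 5 => ζ ^ (k ^ (i : ℕ))) := by
    intro i j hij
    have hij' : ζ ^ (k ^ (i : ℕ)) = ζ ^ (k ^ (j : ℕ)) := hij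
    have hζ0 : IsUnit ζ := by
      have : ζ ^ 11 = 1 := by rw [← hζo, pow_orderOf_eq_one]
      exact IsUnit.of_pow_eq_one this (by norm_num)
    obtain ⟨u, rfl⟩ := hζ0
    rw [orderOf_units] at hζo
    have hu : u ^ (k ^ (i : ℕ)) = u ^ (k ^ (j : ℕ)) := Units.ext (by simpa using hij')
    rw [pow_eq_pow_iff_modEq, hζo, ← ZMod.natCast_eq_natCast_iff] at hu
    exact aux_zmod _ hk5 hk1 i j (by simpa using hu)
  have hcp : A.charpoly ≠ 0 := (Matrix.charpoly_monic A).ne_zero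
  have hsub : (Finset.univ.image (fun i : Fin 5 => ζ ^ (k ^ (i : ℕ)))) ⊆
      A.charpoly.roots.toFinset := by
    intro y hy
    simp only [Finset.mem_image, Finset.mem_univ, true_and] at hy
    obtain ⟨i, rfl⟩ := hy
    rw [Multiset.mem_toFinset, Polynomial.mem_roots hcp]
    exact Matrix.mem_spectrum_iff_isRoot_charpoly.1 (hmem i)
  have hc := Finset.card_le_card hsub
  rw [Finset.card_image_of_injective _ hinj] at hc
  have h3 := (Multiset.toFinset_card_le A.charpoly.roots).trans (Polynomial.card_roots' _)
  rw [Matrix.charpoly_natDegree_eq_dim] at h3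
  simp at hc h3
  omega

/-- Let `H = (ℤ/22ℤ) ⋊ (ℤ/5ℤ)` be the semidirect product in which `ℤ/5ℤ` acts on the `ℤ/11ℤ`
factor of `ℤ/22ℤ` by an automorphism of order `5` and trivially on the `ℤ/2ℤ` factor; this is
encoded by a normal cyclic subgroup `C` of order `22`, a complement `Q` of order `5` acting
nontrivially (hence with order `5`) on `C` but trivially on the order-`2` part of `C`.
Let `E` be a finite group with a normal subgroup `N` of order `2` such that `E/N ≅ H`, and
suppose the center of `E` contains an element of order `4`.  Then the kernel of the induced
surjection `E → ℤ/5ℤ` (namely the preimage of `C` in `E`) is cyclic of order `44`, and `E`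
admits no faithful three-dimensional complex representation. -/
theorem central_order_four_extension_of_22_rtimes_5
    (H : Type) [Group H] [Finite H]
    (C Q : Subgroup H) (hCnormal : C.Normal) (hCcyclic : IsCyclic C)
    (hCcard : Nat.card C = 22) (hQcard : Nat.card Q = 5)
    (hdisj : C ⊓ Q = ⊥) (hsup : C ⊔ Q = ⊤)
    (hact : ∀ q ∈ Q, q ≠ 1 → ∃ c ∈ C, q * c * q⁻¹ ≠ c)
    (htriv : ∀ c ∈ C, c ^ 2 = 1 → ∀ q ∈ Q, q * c * q⁻¹ = c)
    (E : Type) [Group E] [Finite E] (N : Subgroup E) (hNnormal : N.Normal)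
    (hNcard : Nat.card N = 2) (φ : E ⧸ N ≃* H)
    (hz : ∃ z ∈ Subgroup.center E, orderOf z = 4) :
    IsCyclic (Subgroup.comap (φ.toMonoidHom.comp (QuotientGroup.mk' N)) C) ∧
    Nat.card (Subgroup.comap (φ.toMonoidHom.comp (QuotientGroup.mk' N)) C) = 44 ∧
    ¬ ∃ ρ : E →* GL (Fin 3) ℂ, Function.Injective ρ := by
  haveI : Fact (Nat.Prime 11) := ⟨by norm_num⟩
  obtain ⟨z, hzc, hzo⟩ := hz
  rw [Subgroup.mem_center_iff] at hzc
  let f : E →* H := φ.toMonoidHom.comp (QuotientGroup.mk' N)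
  have hf : Function.Surjective f :=
    φ.surjective.comp (QuotientGroup.mk'_surjective N)
  have hcompl : C.IsComplement' Q := by
    refine Subgroup.isComplement'_of_disjoint_and_mul_eq_univ (disjoint_iff.2 hdisj) ?_
    rw [← Subgroup.normal_mul, hsup]; rfl
  have hHcard : Nat.card H = 110 := by
    rw [← hcompl.card_mul, hCcard, hQcard]
  have hCidx : C.index = 5 := by
    have := C.card_mul_index
    rw [hCcard, hHcard] at this
    omega
  have hEcard : Nat.card E = 220 := by
    rw [Subgroup.card_eq_card_quotient_mul_card_subgroup N, Nat.card_congr φ.toEquiv, hHcard,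
      hNcard]
  change IsCyclic (Subgroup.comap f C) ∧ Nat.card (Subgroup.comap f C) = 44 ∧ _
  set K := Subgroup.comap f C with hK
  haveI : K.Normal := hCnormal.comap f
  have hKidx : K.index = 5 := by
    rw [hK, Subgroup.index_comap_of_surjective _ hf, hCidx]
  have hKcard : Nat.card K = 44 := by
    have := K.card_mul_index
    rw [hKidx, hEcard] at this
    omega
  have hp5 : ∀ g : E, g ^ 5 ∈ K := fun g => by
    have := K.pow_index_mem g
    rwa [hKidx] at this
  have hzK : z ∈ K := by
    have h := hp5 z
    have h4 : z ^ 4 = 1 := by rw [← hzo, pow_orderOf_eq_one]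
    rwa [pow_succ, h4, one_mul] at h
  obtain ⟨x', hx'⟩ := exists_prime_orderOf_dvd_card' (G := K) 11 (by rw [hKcard]; norm_num)
  obtain ⟨x, hxK⟩ := x'
  have hx : orderOf x = 11 := by rw [← hx', Subgroup.orderOf_mk]
  have hcomm : Commute z x := (hzc x).symm
  have hw : orderOf (z * x) = 44 := by
    rw [hcomm.orderOf_mul_eq_mul_orderOf_of_coprime (by rw [hzo, hx]; norm_num), hzo, hx]
  have hwK : z * x ∈ K := K.mul_mem hzK hxK
  have hcyc : IsCyclic K :=
    isCyclic_of_orderOf_eq_card (⟨z * x, hwK⟩ : K) (by rw [Subgroup.orderOf_mk, hw, hKcard])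
  have hgen : ∀ y ∈ K, ∃ k : ℕ, (z * x) ^ k = y := by
    have hle : Subgroup.zpowers (z * x) ≤ K := by
      rwa [Subgroup.zpowers_le]
    have heq := Subgroup.eq_of_le_of_card_ge hle (by rw [hKcard, Nat.card_zpowers, hw])
    intro y hy
    rw [← heq] at hy
    exact mem_powers_iff_mem_zpowers.2 hy
  refine ⟨hcyc, hKcard, ?_⟩
  rintro ⟨ρ, hρ⟩
  haveI : Nontrivial Q := Finite.one_lt_card_iff_nontrivial.1 (by rw [hQcard]; norm_num)
  obtain ⟨⟨q, hq⟩, hq1⟩ := exists_ne (1 : Q)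
  obtain ⟨c, hc, hqc⟩ := hact q hq (fun h => hq1 (Subtype.ext h))
  obtain ⟨g, rfl⟩ := hf q
  obtain ⟨y, rfl⟩ := hf c
  have hz4 : z ^ 4 = 1 := by rw [← hzo, pow_orderOf_eq_one]
  have hx11 : x ^ 11 = 1 := by rw [← hx, pow_orderOf_eq_one]
  have hx12 : x = (z * x) ^ 12 := by
    rw [hcomm.mul_pow, show 12 = 4 * 3 by norm_num, pow_mul z, hz4, one_pow, one_mul,
      show 4 * 3 = 11 + 1 by norm_num, pow_succ, hx11, one_mul]
  have hne : g * x * g⁻¹ ≠ x := by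
    intro h
    apply hqc
    have hgx : Commute g x := by
      have : g * x = x * g := mul_inv_eq_iff_eq_mul.1 h
      exact this
    have hgz : Commute g z := hzc g
    obtain ⟨k, rfl⟩ := hgen y hc
    have : g * (z * x) ^ k = (z * x) ^ k * g := (hgz.mul_right hgx).pow_right k
    rw [← map_inv, ← map_mul, ← map_mul, this, mul_inv_cancel_right]
  obtain ⟨k, hk⟩ := hgen (g * (z * x) * g⁻¹) (‹K.Normal›.conj_mem _ hwK g)
  refine aux_norep x g k hx ?_ hne ?_ ρ hρ
  · calc g * x * g⁻¹ = g * (z * x) ^ 12 * g⁻¹ := by rw [← hx12]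
      _ = (g * (z * x) * g⁻¹) ^ 12 := by rw [conj_pow]
      _ = ((z * x) ^ 12) ^ k := by rw [← hk, ← pow_mul, ← pow_mul, mul_comm]
      _ = x ^ k := by rw [← hx12]
  · obtain ⟨m, hm⟩ := hgen (g ^ 5) (hp5 g)
    rw [← hm]
    have : Commute ((z * x) ^ m) x := (hcomm.mul_left (Commute.refl x)).pow_left m
    rw [this.eq, mul_inv_cancel_right]
end
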